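/- If M is a model of a superstable first-order theory T and A is an arbitrary subset of M, then A is weakly benign in M: for all finite tuples α, β from M, if α and β realize the same strong type over A, then α and β realize the same type over A in the expanded language L* = L ∪ {P}, where P is a new unary predicate interpreted as A. -/

import Mathlib

open FirstOrder Language Cardinal

universe u

namespace Benign

variable {L : FirstOrder.Language.{u, u}} {M : Type u} [L.Structure M]

/-- Two tuples (indexed by a type `α`) realize the same complete `L`-type over the
parameter set `A`. -/
def SameTypeOver (A : Set M) {α : Type} (x y : α → M) : Prop :=
  ∀ φ : L.Formula (α ⊕ ↥A),
    φ.Realize (Sum.elim x Subtype.val) ↔ φ.Realize (Sum.elim y Subtype.val)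

/-- Two tuples realize the same strong type over `A`: they realize the same type over `A`,
and they are equivalent under every `A`-definable equivalence relation with finitely many
classes. -/
def SameStrongTypeOver (A : Set M) {α : Type} (x y : α → M) : Prop :=
  SameTypeOver (L := L) A x y ∧
    ∀ φ : L.Formula ((α ⊕ α) ⊕ ↥A),
      (Equivalence fun u v : α → M => φ.Realize (Sum.elim (Sum.elim u v) Subtype.val)) →
      (∃ k : ℕ, ∀ g : Fin (k + 1) → α → M, ∃ i j, i ≠ j ∧
          φ.Realize (Sum.elim (Sum.elim (g i) (g j)) Subtype.val)) →
      φ.Realize (Sum.elim (Sum.elim x y) Subtype.val)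

/-- The language consisting of a single unary predicate symbol `P`. -/
def unaryLang : FirstOrder.Language.{0, 0} := ⟨fun _ => Empty, fun n => PLift (n = 1)⟩

/-- The interpretation of the unary predicate `P` as membership in `A`. -/
def unaryStructure (A : Set M) : unaryLang.Structure M where
  funMap := fun f _ => f.elim
  RelMap := fun {n} r v => v (Fin.cast r.down.symm 0) ∈ A

/-- Two tuples realize the same type over `A` in the expanded language
`L* = L ∪ {P}` where the new unary predicate `P` is interpreted as `A`. -/
def SameLstarTypeOver (A : Set M) {α : Type} (x y : α → M) : Prop :=
  letI : unaryLang.Structure M := unaryStructure A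
  SameTypeOver (L := L.sum unaryLang) A x y

/-- `A` is benign in `M`: tuples with the same `L`-type over `A` have the same `L*`-type
over `A`. -/
def IsBenign (A : Set M) : Prop :=
  ∀ (n : ℕ) (x y : Fin n → M),
    SameTypeOver (L := L) A x y → SameLstarTypeOver (L := L) A x y

/-- `A` is weakly benign in `M`: tuples with the same strong type over `A` have the same
`L*`-type over `A`. -/
def IsWeaklyBenign (A : Set M) : Prop :=
  ∀ (n : ℕ) (x y : Fin n → M),
    SameStrongTypeOver (L := L) A x y → SameLstarTypeOver (L := L) A x y

/-- The cardinality of the theory: `|T| = |L| + ℵ₀`. -/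
noncomputable def cardL (L : FirstOrder.Language.{u, u}) : Cardinal.{u} :=
  L.card ⊔ ℵ₀

/-- `T` is stable in `κ`: over every parameter set of size at most `κ` in a model of `T`
there are at most `κ` complete types. -/
def StableIn (L : FirstOrder.Language.{u, u}) (T : L.Theory) (κ : Cardinal.{u}) : Prop :=
  ∀ (N : Type u) (_ : L.Structure N), N ⊨ T → ∀ A : Set N, #A ≤ κ →
    ∀ n : ℕ, #(((L[[↥A]]).completeTheory N).CompleteType (Fin n)) ≤ κ

/-- `T` is stable: stable in some cardinal. -/
def Stable (L : FirstOrder.Language.{u, u}) (T : L.Theory) : Prop :=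
  ∃ κ, StableIn L T κ

/-- `T` is superstable: stable in every cardinal `κ ≥ 2 ^ |T|`. -/
def Superstable (L : FirstOrder.Language.{u, u}) (T : L.Theory) : Prop :=
  ∀ κ : Cardinal.{u}, 2 ^ cardL L ≤ κ → StableIn L T κ

/-- `T` is `ω`-stable. -/
def OmegaStable (L : FirstOrder.Language.{u, u}) (T : L.Theory) : Prop :=
  StableIn L T ℵ₀

/-- `M` is `κ`-saturated as an `L'`-structure: every finitely satisfiable set of
`L'`-formulas in one free variable over fewer than `κ` parameters is realized. -/
def SaturatedIn (L' : FirstOrder.Language.{u, u}) [L'.Structure M] (κ : Cardinal.{u}) : Prop :=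
  ∀ S : Set M, #S < κ →
    ∀ p : Set (L'.Formula (Fin 1 ⊕ ↥S)),
      (∀ fs : Finset (L'.Formula (Fin 1 ⊕ ↥S)), ↑fs ⊆ p →
        ∃ x : M, ∀ φ ∈ fs, φ.Realize (Sum.elim ![x] Subtype.val)) →
      ∃ x : M, ∀ φ ∈ p, φ.Realize (Sum.elim ![x] Subtype.val)

/-- The pair `(M, A)` is `κ`-saturated as a structure in the language `L* = L ∪ {P}`. -/
def PairSaturated (A : Set M) (κ : Cardinal.{u}) : Prop :=
  letI : unaryLang.Structure M := unaryStructure A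
  SaturatedIn (M := M) (L.sum unaryLang) κ

/-- A subset `N ⊆ M` is (the universe of) an elementary substructure of `M`
(Tarski–Vaught test). -/
def ElemSubset (N : Set M) : Prop :=
  N.Nonempty ∧
    ∀ (n : ℕ) (φ : L.BoundedFormula (Fin n) 1) (a : Fin n → M), (∀ i, a i ∈ N) →
      (∃ x : M, φ.Realize a ![x]) → ∃ x ∈ N, φ.Realize a ![x]

/-- `B` is relatively `κ`-saturated in `A`: every type over a subset of `B` of size `< κ`
which is realized (by a finite tuple) in `A` is realized in `B`. -/
def RelKappaSaturated (κ : Cardinal.{u}) (B A : Set M) : Prop :=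
  B ⊆ A ∧
    ∀ S : Set M, S ⊆ B → #S < κ →
      ∀ (n : ℕ) (a : Fin n → M), (∀ i, a i ∈ A) →
        ∃ b : Fin n → M, (∀ i, b i ∈ B) ∧ SameTypeOver (L := L) S a b

/-- A subset `N ⊆ M` is `κ`-saturated (as a structure in its own right, computed inside
`M`): every set of formulas over `< κ` parameters from `N` which is finitely satisfiable
in `N` is realized in `N`. -/
def SubsetSaturated (κ : Cardinal.{u}) (N : Set M) : Prop :=
  ∀ S : Set M, S ⊆ N → #S < κ →
    ∀ p : Set (L.Formula (Fin 1 ⊕ ↥S)),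
      (∀ fs : Finset (L.Formula (Fin 1 ⊕ ↥S)), ↑fs ⊆ p →
        ∃ x ∈ N, ∀ φ ∈ fs, φ.Realize (Sum.elim ![x] Subtype.val)) →
      ∃ x ∈ N, ∀ φ ∈ p, φ.Realize (Sum.elim ![x] Subtype.val)

/-- `f` is a sequence of `m`-tuples which is indiscernible over `C`. -/
def IndiscOver (C : Set M) {m : ℕ} (f : ℕ → Fin m → M) : Prop :=
  ∀ (k : ℕ) (i j : Fin k → ℕ), StrictMono i → StrictMono j →
    SameTypeOver (L := L) C
      (fun s : Fin k × Fin m => f (i s.1) s.2) (fun s : Fin k × Fin m => f (j s.1) s.2)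

/-- The formula `φ(x̄, b)` divides over `C`: there is a `C`-indiscernible sequence starting
with `b` along which the instances of `φ` are `k`-inconsistent. -/
def Divides (C : Set M) {n m : ℕ} (φ : L.Formula (Fin n ⊕ Fin m)) (b : Fin m → M) : Prop :=
  ∃ f : ℕ → Fin m → M, f 0 = b ∧ IndiscOver (L := L) C f ∧
    ∃ k : ℕ, 0 < k ∧ ∀ i : Fin k → ℕ, StrictMono i →
      ¬ ∃ a : Fin n → M, ∀ j : Fin k, φ.Realize (Sum.elim a (f (i j)))

/-- `tp(a / B)` forks over `C`: the type implies a finite disjunction of formulas,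
each of which divides over `C`. -/
def TupForksOver {n : ℕ} (a : Fin n → M) (B C : Set M) : Prop :=
  ∃ (r : ℕ) (ms : Fin r → ℕ) (φ : ∀ i : Fin r, L.Formula (Fin n ⊕ Fin (ms i)))
    (b : ∀ i : Fin r, Fin (ms i) → M),
    (∀ i, Divides (L := L) C (φ i) (b i)) ∧
    ∀ a' : Fin n → M, SameTypeOver (L := L) B a a' →
      ∃ i, (φ i).Realize (Sum.elim a' (b i))

/-- The tuple `a` is independent from `X` over `C` (nonforking independence). -/
def TupIndepOver {n : ℕ} (a : Fin n → M) (X C : Set M) : Prop :=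
  ¬ TupForksOver (L := L) a (X ∪ C) C

/-- The set `Y` is independent from `X` over `C`: the type of every finite tuple from `Y`
over `X ∪ C` does not fork over `C`. -/
def IndepOver (Y X C : Set M) : Prop :=
  ∀ (n : ℕ) (a : Fin n → M), (∀ i, a i ∈ Y) → TupIndepOver (L := L) a X C

/-- `g` is an elementary map on the set `D`. -/
def ElemOn (D : Set M) (g : M → M) : Prop :=
  ∀ (n : ℕ) (a : Fin n → M), (∀ i, a i ∈ D) →
    SameTypeOver (L := L) (∅ : Set M) a (g ∘ a)

/-- The algebraic closure of `B` inside `M`. -/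
def aclSet (B : Set M) : Set M :=
  {x | ∃ φ : L.Formula (Fin 1 ⊕ ↥B), φ.Realize (Sum.elim ![x] Subtype.val) ∧
        {y : M | φ.Realize (Sum.elim ![y] Subtype.val)}.Finite}

/-- The type `tp(d / B)` is algebraic. -/
def AlgebraicTp (B : Set M) {n : ℕ} (d : Fin n → M) : Prop :=
  {d' : Fin n → M | SameTypeOver (L := L) B d d'}.Finite

/-- The types `tp(d / B)` and `tp(e / C)` are orthogonal: over any common extension `D`
of the domains, realizations of the respective nonforking extensions are independent. -/
def TypesOrthogonal {n m : ℕ} (B : Set M) (d : Fin n → M) (C : Set M) (e : Fin m → M) :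
    Prop :=
  ∀ (D : Set M) (d' : Fin n → M) (e' : Fin m → M), B ⊆ D → C ⊆ D →
    SameTypeOver (L := L) B d d' → ¬ TupForksOver (L := L) d' D B →
    SameTypeOver (L := L) C e e' → ¬ TupForksOver (L := L) e' D C →
    ¬ TupForksOver (L := L) d' (D ∪ Set.range e') D

/-- The type `tp(d / B)` is orthogonal to the set `A`: it is orthogonal to every complete
type over `acl(A)`. -/
def TypeOrthSet (B : Set M) {n : ℕ} (d : Fin n → M) (A : Set M) : Prop :=
  ∀ (m : ℕ) (e : Fin m → M), TypesOrthogonal (L := L) B d (aclSet (L := L) A) e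

/-- `tp(Na / Ma)` is orthogonal to the type `tp(e / Ma)`: the type over `Ma` of every
finite tuple from `Na` is orthogonal to it. -/
def SetTpOrth (Na Ma : Set M) {m : ℕ} (e : Fin m → M) : Prop :=
  ∀ (n : ℕ) (d : Fin n → M), (∀ i, d i ∈ Na) →
    TypesOrthogonal (L := L) Ma d Ma e

/-- The type `tp(d / B)` is regular: it is orthogonal to all of its forking extensions. -/
def TypeRegular (B : Set M) {n : ℕ} (d : Fin n → M) : Prop :=
  ∀ (D : Set M) (d' : Fin n → M), B ⊆ D →
    SameTypeOver (L := L) B d d' → TupForksOver (L := L) d' D B →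
    TypesOrthogonal (L := L) B d D d'

/-- The type `tp(d / B)` is stationary: it has a unique nonforking extension to every
superset of its domain. -/
def TypeStationary (B : Set M) {n : ℕ} (d : Fin n → M) : Prop :=
  ∀ D : Set M, B ⊆ D → ∀ d₁ d₂ : Fin n → M,
    SameTypeOver (L := L) B d d₁ → SameTypeOver (L := L) B d d₂ →
    ¬ TupForksOver (L := L) d₁ D B → ¬ TupForksOver (L := L) d₂ D B →
    SameTypeOver (L := L) D d₁ d₂

/-- `D` is `κ`-atomic over `B`: the type of every finite tuple from `D` over `B` is
implied by its restriction to a subset of `B` of size `< κ`. -/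
def KappaAtomicOver (κ : Cardinal.{u}) (D B : Set M) : Prop :=
  ∀ (n : ℕ) (d : Fin n → M), (∀ i, d i ∈ D) →
    ∃ S : Set M, S ⊆ B ∧ #S < κ ∧
      ∀ d' : Fin n → M, SameTypeOver (L := L) S d d' → SameTypeOver (L := L) B d d'

/-- `N` is `κ`-prime over `X`: `N` is a `κ`-saturated elementary substructure containing
`X` which elementarily embeds over `X` into every `κ`-saturated elementary substructure
containing `X`. -/
def KappaPrimeOver (κ : Cardinal.{u}) (N X : Set M) : Prop :=
  ElemSubset (L := L) N ∧ X ⊆ N ∧ SubsetSaturated (L := L) κ N ∧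
    ∀ N' : Set M, ElemSubset (L := L) N' → X ⊆ N' → SubsetSaturated (L := L) κ N' →
      ∃ g : M → M, ElemOn (L := L) N g ∧ (∀ x ∈ X, g x = x) ∧ g '' N ⊆ N'

/-- `Ma` is `A`-full in `M`. -/
def AFull (A Ma : Set M) (κ : Cardinal.{u}) : Prop :=
  ∀ N : Set M, KappaPrimeOver (L := L) κ N (Ma ∪ A) →
    ∀ C0 C1 C2 : Set M, C0 ⊆ Ma → C1 ⊆ A → C0 ⊆ C2 → C1 ⊆ C2 → C2 ⊆ N →
      #C0 ≤ cardL L → #C1 ≤ cardL L → #C2 ≤ cardL L →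
      ∃ f : M → M, ElemOn (L := L) (C1 ∪ C2) f ∧ (∀ x ∈ C0, f x = x) ∧
        f '' (C1 ∪ C2) ⊆ Ma ∧ f '' C1 ⊆ A ∧
        (IndepOver (L := L) C2 A C1 → IndepOver (L := L) (f '' C2) A (f '' C1))

/-- `(M₁, A₁) ∈ K_c`. -/
structure Kc (κ : Cardinal.{u}) (A : Set M) (c : M) (M₁ A₁ : Set M) : Prop where
  elem : ElemSubset (L := L) M₁
  mem : c ∈ M₁
  relSat : RelKappaSaturated (L := L) κ A₁ A
  sub : A₁ ⊆ M₁
  indep : IndepOver (L := L) M₁ A A₁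
  cardA₁ : #A₁ ≤ κ
  cardM₁ : #M₁ ≤ κ
  sat : SubsetSaturated (L := L) κ M₁

/-- `⟨A₁, Ma, Mb, Na, g⟩ ∈ K¹_{a,b}`. -/
structure K1 (κ : Cardinal.{u}) (A : Set M) (a b : M) (A₁ Ma Mb Na : Set M)
    (g : M → M) : Prop where
  ka : Kc (L := L) κ A a Ma A₁
  kb : Kc (L := L) κ A b Mb A₁
  gBij : Set.BijOn g Ma Mb
  gFix : ∀ x ∈ A₁, g x = x
  gElem : ElemOn (L := L) Ma g
  gab : g a = b
  sub : Ma ⊆ Na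
  elemNa : ElemSubset (L := L) Na
  satNa : SubsetSaturated (L := L) κ Na
  cardNa : #Na = κ
  indepNa : IndepOver (L := L) Na A A₁

/-- `⟨A₁, Ma, Mb, Na, g⟩ ∈ K²_{a,b}`: additionally `g` is an isomorphism of `Ma^eq` onto
`Mb^eq` over `A₁^eq`, i.e. `g` preserves strong types over `A₁`. -/
def K2 (κ : Cardinal.{u}) (A : Set M) (a b : M) (A₁ Ma Mb Na : Set M)
    (g : M → M) : Prop :=
  K1 (L := L) κ A a b A₁ Ma Mb Na g ∧
    ∀ (n : ℕ) (t : Fin n → M), (∀ i, t i ∈ Ma) →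
      SameStrongTypeOver (L := L) A₁ t (g ∘ t)

/-- `K^i_{a,b}` for `i ∈ {1,2}` (`two = false` gives `K¹`, `two = true` gives `K²`). -/
def Ki (two : Bool) (κ : Cardinal.{u}) (A : Set M) (a b : M) (A₁ Ma Mb Na : Set M)
    (g : M → M) : Prop :=
  if two then K2 (L := L) κ A a b A₁ Ma Mb Na g
  else K1 (L := L) κ A a b A₁ Ma Mb Na g

/-- `d'` realizes `g(tp(d / Ma))`. -/
def RealizesGType (Ma : Set M) (g : M → M) {n : ℕ} (d d' : Fin n → M) : Prop :=
  ∀ (k : ℕ) (m : Fin k → M), (∀ i, m i ∈ Ma) →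
    ∀ φ : L.Formula (Fin n ⊕ Fin k),
      φ.Realize (Sum.elim d m) ↔ φ.Realize (Sum.elim d' (g ∘ m))

/-- The data `⟨A₁, Ma, Mb, Na, g⟩ ∈ K²_{a,b}` satisfies the conclusion of the
characterization of failure of weak benignity (conditions (a)–(f) of the main lemma). -/
structure CharWitness (κ : Cardinal.{u}) (A : Set M) (a b : M) (Astar Ma Mb Na : Set M)
    (g : M → M) : Prop where
  k2 : K2 (L := L) κ A a b Astar Ma Mb Na g
  ne : Ma ≠ Na
  full : AFull (L := L) A Ma κ
  indepNa : IndepOver (L := L) Na A Astar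
  orth : ∀ (n : ℕ) (e : Fin n → M), ¬ AlgebraicTp (L := L) Ma e →
    TypeOrthSet (L := L) Ma e A → SetTpOrth (L := L) Na Ma e
  noCopy : ∀ (n : ℕ) (d : Fin n → M), (∀ i, d i ∈ Na) → ¬ (∀ i, d i ∈ Ma) →
    ¬ ∃ d' : Fin n → M, RealizesGType (L := L) Ma g d d' ∧
        TupIndepOver (L := L) d' A Mb
  gStrong : ∀ (n : ℕ) (t : Fin n → M), (∀ i, t i ∈ Ma) →
    SameStrongTypeOver (L := L) Astar t (g ∘ t)

/-- An `L*`-elementary map from `(M, A)` to `(M', A')`. -/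
def LstarElementary {M' : Type u} [L.Structure M'] (A : Set M) (A' : Set M')
    (h : M → M') : Prop :=
  ∀ (n : ℕ) (φ : (L.sum unaryLang).Formula (Fin n)) (v : Fin n → M),
    (letI : unaryLang.Structure M := unaryStructure A; φ.Realize v) ↔
    (letI : unaryLang.Structure M' := unaryStructure A'; φ.Realize (h ∘ v))

/-- The family `I` of tuples is independent over `Y`: each member is independent over `Y`
from the union of the other members. -/
def IndepFamily (Y : Set M) (I : Set (Σ m : ℕ, Fin m → M)) : Prop :=
  ∀ t ∈ I, TupIndepOver (L := L) t.2 (⋃ s ∈ I \ {t}, Set.range s.2) Y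

/-- `tp(t / Y)` belongs to the family `P` of regular stationary types nonorthogonal to
`p* = tp(dstar / Pbase)`. -/
def InP {nd : ℕ} (Pbase : Set M) (dstar : Fin nd → M) {m : ℕ} (Y : Set M)
    (t : Fin m → M) : Prop :=
  TypeRegular (L := L) Y t ∧ TypeStationary (L := L) Y t ∧
    ¬ TypesOrthogonal (L := L) Y t Pbase dstar

/-- The `P`-weight `w_P(X, Y)` of the set `X` over the set `Y`, where
`P = {p : p regular, stationary, nonorthogonal to p* = tp(dstar / Pbase)}`: the supremum
of cardinalities of `Y`-independent families of tuples realizing types in `P` over `Y`,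
each of which forks with `X` over `Y`. -/
noncomputable def wP {nd : ℕ} (Pbase : Set M) (dstar : Fin nd → M) (X Y : Set M) :
    Cardinal.{u} :=
  sSup { c : Cardinal.{u} | ∃ I : Set (Σ m : ℕ, Fin m → M), #I = c ∧
    IndepFamily (L := L) Y I ∧
    ∀ t ∈ I, InP (L := L) Pbase dstar Y t.2 ∧
      TupForksOver (L := L) t.2 (Y ∪ X) Y }

/-- The set of realizations in `X` of the (1-)type `tp(e / B)`. -/
def qSet (B : Set M) (e : M) (X : Set M) : Set M :=
  {x ∈ X | SameTypeOver (L := L) B ![x] ![e]}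

/-- `dim(tp(d / B), N)` is finite: there is no infinite sequence of realizations of the
type in `N`, chosen successively independent. -/
def DimFinite (B : Set M) {n : ℕ} (d : Fin n → M) (N : Set M) : Prop :=
  ¬ ∃ f : ℕ → Fin n → M,
    ∀ j : ℕ, (∀ i, f j i ∈ N) ∧ SameTypeOver (L := L) B d (f j) ∧
      ¬ TupForksOver (L := L) (f j) (B ∪ ⋃ l ∈ Set.Iio j, Set.range (f l)) B

/-- The definable subsets (with parameters) of `N^n`. -/
def DefSet (N : Type u) [L.Structure N] (n : ℕ) : Set (Set (Fin n → N)) :=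
  {X | ∃ (m : ℕ) (φ : L.Formula (Fin n ⊕ Fin m)) (b : Fin m → N),
    X = {v | φ.Realize (Sum.elim v b)}}

/-- The Morley rank of the (definable) set `X` is at least `α`. -/
def MRge {N : Type u} [L.Structure N] {n : ℕ} (X : Set (Fin n → N)) (α : Ordinal.{u}) :
    Prop :=
  X.Nonempty ∧ ∀ β, β < α → ∃ f : ℕ → Set (Fin n → N),
    (∀ i, f i ∈ DefSet (L := L) N n ∧ f i ⊆ X ∧ MRge (f i) β) ∧
    Pairwise (Function.onFun Disjoint f)
termination_by α
decreasing_by exact ‹β < α›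

/-- The theory `T` has Morley rank `2`: in every `ℵ₀`-saturated model, the rank of the
whole universe (in one variable) is exactly `2`. -/
def MorleyRankTwo (L : FirstOrder.Language.{u, u}) (T : L.Theory) : Prop :=
  ∀ (N : Type u) (_ : L.Structure N), N ⊨ T → SaturatedIn (M := N) L ℵ₀ →
    MRge (L := L) (Set.univ : Set (Fin 1 → N)) 2 ∧
      ¬ MRge (L := L) (Set.univ : Set (Fin 1 → N)) 3

/-- `T` has NDOP: in any sufficiently saturated model, for elementary substructures
`N₁, N₂` independent over a common elementary substructure `N₀`, and `N₃` prime over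
`N₁ ∪ N₂`, every nonalgebraic type over `N₃` is nonorthogonal to `N₁` or to `N₂`. -/
def NDOP (L : FirstOrder.Language.{u, u}) (T : L.Theory) : Prop :=
  ∀ (N : Type u) (_ : L.Structure N), N ⊨ T →
    SaturatedIn (M := N) L (Order.succ ℵ₀) →
    ∀ N₀ N₁ N₂ N₃ : Set N,
      ElemSubset (L := L) N₀ → ElemSubset (L := L) N₁ → ElemSubset (L := L) N₂ →
      N₀ ⊆ N₁ → N₀ ⊆ N₂ → IndepOver (L := L) N₁ N₂ N₀ →
      KappaPrimeOver (L := L) ℵ₀ N₃ (N₁ ∪ N₂) →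
      ∀ (n : ℕ) (d : Fin n → N), ¬ AlgebraicTp (L := L) N₃ d →
        ¬ TypeOrthSet (L := L) N₃ d N₁ ∨ ¬ TypeOrthSet (L := L) N₃ d N₂

end Benign

namespace Benign

section Compactness
variable {L : FirstOrder.Language.{u, u}} {C : Type u} [L.Structure C] [Nonempty C]

/-- One elementary extension realizes all finitely satisfiable sets of formulas at once. -/
theorem exists_elementaryExtension_realizing (I : Type u) :
    ∃ (N : Type u) (_ : L.Structure N) (j : C ↪ₑ[L] N), ∀ Φ : Set (L.Formula (C ⊕ I)),
      (∀ F : Finset (L.Formula (C ⊕ I)), ↑F ⊆ Φ →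
        ∃ v : I → C, ∀ φ ∈ F, φ.Realize (Sum.elim id v)) →
      ∃ v : I → N, ∀ φ ∈ Φ, φ.Realize (Sum.elim j v) := by
  classical
  let X : Type u := ∀ Φ : Set (L.Formula (C ⊕ I)), Finset Φ
  let U : Ultrafilter X := Ultrafilter.of Filter.atTop
  have hU : (U : Filter X) ≤ Filter.atTop := Ultrafilter.of_le _
  refine ⟨(U : Filter X).Product fun _ => C, inferInstance,
    { toFun := fun c => ((fun _ : X => c : X → C) : (U : Filter X).Product fun _ => C)
      map_formula' := ?_ }, ?_⟩
  · intro n φ x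
    refine (Ultraproduct.realize_formula_cast (u := U) φ (fun i _ => x i)).trans ?_
    simp
  · intro Φ hΦ
    have h' : ∀ F : Finset Φ, ∃ v : I → C, ∀ φ ∈ F, (φ : L.Formula (C ⊕ I)).Realize
        (Sum.elim id v) := by
      intro F
      obtain ⟨v, hv⟩ := hΦ (F.map (Function.Embedding.subtype _)) (by simp)
      exact ⟨v, fun φ hφ => hv φ (by simp [hφ])⟩
    choose w hw using h'
    refine ⟨fun i => ((fun F : X => w (F Φ) i : X → C) : (U : Filter X).Product fun _ => C), ?_⟩
    intro φ hφ
    have key := Ultraproduct.realize_formula_cast (u := U) φ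
      (fun i (F : X) => Sum.elim id (w (F Φ)) i)
    have e : (fun i => (((fun F : X => Sum.elim id (w (F Φ)) i) : X → C) :
        (U : Filter X).Product fun _ => C)) = Sum.elim
        (fun c => ((fun _ : X => c : X → C) : (U : Filter X).Product fun _ => C))
        (fun i => ((fun F : X => w (F Φ) i : X → C) : (U : Filter X).Product fun _ => C)) := by
      funext i
      cases i <;> rfl
    rw [e] at key
    refine key.2 (Filter.Eventually.filter_mono hU ?_)
    filter_upwards [Filter.eventually_ge_atTop
      (fun Ψ => if h : Ψ = Φ then {⟨φ, h ▸ hφ⟩} else ∅ : X)] with F hF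
    have := hF Φ
    simp only [dif_pos] at this
    exact hw (F Φ) ⟨φ, hφ⟩ (by simpa using this)

/-- A set of formulas finitely satisfiable in `C` is satisfiable in some model of the theory
of `C`. -/
theorem exists_model_realizing {V : Type u} (Φ : Set (L.Formula V))
    (h : ∀ F : Finset (L.Formula V), ↑F ⊆ Φ → ∃ v : V → C, ∀ φ ∈ F, φ.Realize v) :
    ∃ (N : Type u) (_ : L.Structure N), (∀ T : L.Theory, C ⊨ T → N ⊨ T) ∧
      ∃ v : V → N, ∀ φ ∈ Φ, φ.Realize v := by
  classical
  obtain ⟨N, _, j, hj⟩ := exists_elementaryExtension_realizing (L := L) (C := C) V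
  refine ⟨N, inferInstance, fun T hT => (j.theory_model_iff T).1 hT, ?_⟩
  obtain ⟨v, hv⟩ := hj ((fun φ : L.Formula V => (φ.relabel Sum.inr : L.Formula (C ⊕ V))) '' Φ) (by
    intro F hF
    choose! g hg using fun ψ (hψ : ψ ∈ F) => hF hψ
    obtain ⟨v, hv⟩ := h (F.image g) (by
      intro ψ hψ
      obtain ⟨χ, hχ, rfl⟩ := Finset.mem_image.1 (Finset.mem_coe.1 hψ)
      exact (hg χ hχ).1)
    refine ⟨v, fun ψ hψ => ?_⟩
    rw [← (hg ψ hψ).2, Formula.realize_relabel]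
    exact hv _ (Finset.mem_image_of_mem g hψ))
  refine ⟨v, fun φ hφ => ?_⟩
  have := hv _ (Set.mem_image_of_mem _ hφ)
  rwa [Formula.realize_relabel] at this

end Compactness

section Chain

/-- `lev` is an increasing chain of subsets of `C`, each passing the Tarski–Vaught test in `C`,
such that every finitely satisfiable set of formulas in variables `I` over `lev n` is realized
in the union of the chain. -/
structure Filtration (L : FirstOrder.Language.{u, u}) {C : Type u} [L.Structure C] (I : Type u)
    (lev : ℕ → Set C) : Prop where
  mono : Monotone lev
  tv : ∀ n (ι κ : Type) [Finite κ] (φ : L.Formula (ι ⊕ κ)) (e : ι → C), (∀ i, e i ∈ lev n) →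
    (∃ x : κ → C, φ.Realize (Sum.elim e x)) →
    ∃ x : κ → C, (∀ i, x i ∈ lev n) ∧ φ.Realize (Sum.elim e x)
  sat : ∀ n (Φ : Set (L.Formula (lev n ⊕ I))),
    (∀ F : Finset (L.Formula (lev n ⊕ I)), ↑F ⊆ Φ →
      ∃ v : I → C, ∀ φ ∈ F, φ.Realize (Sum.elim Subtype.val v)) →
    ∃ v : I → C, (∀ i, ∃ m, v i ∈ lev m) ∧ ∀ φ ∈ Φ, φ.Realize (Sum.elim Subtype.val v)

variable {L : FirstOrder.Language.{u, u}}

section Limit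
variable {G : ℕ → Type u} [∀ n, L.Structure (G n)] (f : ∀ n, G n ↪ₑ[L] G (n + 1))

/-- The transition maps of a chain of elementary embeddings. -/
abbrev chainMap (m n : ℕ) (h : m ≤ n) : G m ↪[L] G n :=
  DirectedSystem.natLERec (fun n => (f n).toEmbedding) m n h

theorem chainMap_realize {α : Type*} {k : ℕ} (φ : L.BoundedFormula α k) {m n : ℕ} (h : m ≤ n)
    (v : α → G m) (x : Fin k → G m) :
    φ.Realize (chainMap f m n h ∘ v) (chainMap f m n h ∘ x) ↔ φ.Realize v x := by
  induction n, h using Nat.le_induction with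
  | base =>
    have : ∀ z : G m, chainMap f m m le_rfl z = z := fun z => by
      simp [chainMap, Nat.leRecOn_self]
    have h1 : ∀ {β : Type _} (w : β → G m), chainMap f m m le_rfl ∘ w = w := fun w => by
      funext i; exact this _
    have h2 : ∀ (w : Fin k → G m), chainMap f m m le_rfl ∘ w = w := fun w => by
      funext i; exact this _
    rw [h1, h2]
  | succ n h ih =>
    have : ∀ z : G m, chainMap f m (n + 1) (by omega) z = f n (chainMap f m n h z) := fun z => by
      simp [chainMap, Nat.leRecOn_succ h]
    have h1 : chainMap f m (n + 1) (by omega) ∘ v = f n ∘ (chainMap f m n h ∘ v) := by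
      funext i; exact this _
    have h2 : chainMap f m (n + 1) (by omega) ∘ x = f n ∘ (chainMap f m n h ∘ x) := by
      funext i; exact this _
    rw [h1, h2, (f n).map_boundedFormula, ih]

theorem of_realize {α : Type*} {k : ℕ} (φ : L.BoundedFormula α k) :
    ∀ {n : ℕ} (v : α → G n) (x : Fin k → G n),
    φ.Realize (Language.DirectLimit.of L ℕ G (chainMap f) n ∘ v)
      (Language.DirectLimit.of L ℕ G (chainMap f) n ∘ x) ↔ φ.Realize v x := by
  induction φ with
  | falsum => simp [BoundedFormula.Realize]
  | equal t₁ t₂ =>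
    intro n v x
    simp only [BoundedFormula.Realize]
    rw [← Sum.comp_elim, HomClass.realize_term, HomClass.realize_term,
      (Language.DirectLimit.of L ℕ G (chainMap f) n).injective.eq_iff]
  | rel R ts =>
    intro n v x
    simp only [BoundedFormula.Realize]
    rw [← Sum.comp_elim]
    simp only [HomClass.realize_term]
    exact StrongHomClass.map_rel (Language.DirectLimit.of L ℕ G (chainMap f) n) R _
  | imp φ ψ ih₁ ih₂ =>
    intro n v x
    simp only [BoundedFormula.realize_imp, ih₁, ih₂]
  | @all k φ ih =>
    intro n v x
    simp only [BoundedFormula.realize_all]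
    constructor
    · intro h a
      have := h (Language.DirectLimit.of L ℕ G (chainMap f) n a)
      rwa [← Fin.comp_snoc, ih] at this
    · intro h a
      obtain ⟨m, b, rfl⟩ := DirectLimit.exists_of a
      have e : ∀ {p : ℕ} (hp : p ≤ max m n) (z : G p),
          Language.DirectLimit.of L ℕ G (chainMap f) p z =
          Language.DirectLimit.of L ℕ G (chainMap f) (max m n) (chainMap f p _ hp z) :=
        fun hp z => (Language.DirectLimit.of_f).symm
      have e1 : Language.DirectLimit.of L ℕ G (chainMap f) n ∘ v =
          Language.DirectLimit.of L ℕ G (chainMap f) (max m n) ∘ (chainMap f n _ (le_max_right _ _) ∘ v) :=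
        funext fun _ => e _ _
      have e2 : Language.DirectLimit.of L ℕ G (chainMap f) n ∘ x =
          Language.DirectLimit.of L ℕ G (chainMap f) (max m n) ∘ (chainMap f n _ (le_max_right _ _) ∘ x) :=
        funext fun _ => e _ _
      rw [e (le_max_left _ _) b, e1, e2, ← Fin.comp_snoc, ih]
      have := (chainMap_realize f φ.all (le_max_right m n) v x).2
        (by simpa only [BoundedFormula.realize_all] using h)
      exact this _

theorem of_formula_realize {α : Type*} (φ : L.Formula α) {n : ℕ} (v : α → G n) :
    φ.Realize (Language.DirectLimit.of L ℕ G (chainMap f) n ∘ v) ↔ φ.Realize v := by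
  have := of_realize f φ v default
  rwa [Unique.eq_default (_ ∘ default)] at this

end Limit

/-- A structure bundled with its carrier. -/
structure BundledStr (L : FirstOrder.Language.{u, u}) where
  carrier : Type u
  [str : L.Structure carrier]
  [ne : Nonempty carrier]

attribute [instance] BundledStr.str BundledStr.ne

open scoped Classical in
theorem exists_realize_of_elementary {C N : Type u} [L.Structure C] [L.Structure N] [Nonempty C]
    (j : C → N) (hj : ∀ {α : Type u} (φ : L.Formula α) (v : α → C),
      φ.Realize (j ∘ v) ↔ φ.Realize v) {A I : Type u} (F : Finset (L.Formula (A ⊕ I)))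
    (a : A → C) (w : I → N) (h : ∀ φ ∈ F, φ.Realize (Sum.elim (j ∘ a) w)) :
    ∃ v : I → C, ∀ φ ∈ F, φ.Realize (Sum.elim a v) := by
  let φ : L.Formula (A ⊕ I) := Formula.iInf fun ψ : F => (ψ : L.Formula (A ⊕ I))
  let J : Type u := {i : I // Sum.inr i ∈ φ.freeVarFinset}
  have hJ : Finite J := Finite.of_injective
    (fun i : J => (⟨_, i.2⟩ : φ.freeVarFinset)) (by
      intro i i' h
      have := congrArg Subtype.val h
      exact Subtype.ext (Sum.inr_injective this))
  let g : φ.freeVarFinset → A ⊕ J := fun z => match z with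
    | ⟨Sum.inl b, _⟩ => Sum.inl b
    | ⟨Sum.inr i, h⟩ => Sum.inr ⟨i, h⟩
  have hg : ∀ {K : Type u} [L.Structure K] (b : A → K) (v : I → K),
      (φ.restrictFreeVar g).Realize (Sum.elim b fun i => v i.1) default ↔
        φ.Realize (Sum.elim b v) := by
    intro K _ b v
    refine BoundedFormula.realize_restrictFreeVar _ ?_
    rintro ⟨z | z, hz⟩ <;> rfl
  have h1 : φ.Realize (Sum.elim (j ∘ a) w) := by
    rw [Formula.realize_iInf]
    exact fun ψ => h _ ψ.2
  have h2 : (Formula.iExs J (φ.restrictFreeVar g)).Realize (j ∘ a) := by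
    rw [Formula.realize_iExs]
    exact ⟨fun i => w i.1, (hg _ _).2 h1⟩
  rw [hj, Formula.realize_iExs] at h2
  obtain ⟨v, hv⟩ := h2
  refine ⟨fun i => if h : Sum.inr i ∈ φ.freeVarFinset then v ⟨i, h⟩
    else Classical.arbitrary C, ?_⟩
  have h3 := (hg a fun i => if h : Sum.inr i ∈ φ.freeVarFinset then v ⟨i, h⟩
    else Classical.arbitrary C).1 (by
      have : (fun i : J => if h : Sum.inr i.1 ∈ φ.freeVarFinset then v ⟨i.1, h⟩
          else Classical.arbitrary C) = v := funext fun i => dif_pos i.2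
      rw [this]
      exact hv)
  rw [Formula.realize_iInf] at h3
  exact fun ψ hψ => h3 ⟨ψ, hψ⟩

theorem exists_next (I : Type u) (S : BundledStr L) : ∃ (S' : BundledStr L)
    (j : S.carrier ↪ₑ[L] S'.carrier), ∀ Φ : Set (L.Formula (S.carrier ⊕ I)),
      (∀ F : Finset (L.Formula (S.carrier ⊕ I)), ↑F ⊆ Φ →
        ∃ v : I → S.carrier, ∀ φ ∈ F, φ.Realize (Sum.elim id v)) →
      ∃ v : I → S'.carrier, ∀ φ ∈ Φ, φ.Realize (Sum.elim j v) := by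
  obtain ⟨N, _, j, hj⟩ := exists_elementaryExtension_realizing (L := L) (C := S.carrier) I
  have : Nonempty N := ⟨j (Classical.arbitrary _)⟩
  exact ⟨⟨N⟩, j, hj⟩

/-- An iterated elementary extension of a bundled structure. -/
noncomputable def chainStr (I : Type u) (S : BundledStr L) : ℕ → BundledStr L
  | 0 => S
  | n + 1 => (exists_next I (chainStr I S n)).choose

/-- Every structure has an elementary extension with a filtration whose bottom level is the
given structure. -/
theorem exists_filtration (I : Type u) (M : Type u) [L.Structure M] [Nonempty M] :
    ∃ (C : Type u) (_ : L.Structure C) (j : M ↪ₑ[L] C) (lev : ℕ → Set C),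
      Filtration L I lev ∧ lev 0 = Set.range j ∧ ∀ x, ∃ n, x ∈ lev n := by
  classical
  let G : ℕ → Type u := fun n => (chainStr (L := L) I ⟨M⟩ n).carrier
  let f : ∀ n, G n ↪ₑ[L] G (n + 1) := fun n =>
    (exists_next I (chainStr (L := L) I ⟨M⟩ n)).choose_spec.choose
  have hf : ∀ n (Φ : Set (L.Formula (G n ⊕ I))),
      (∀ F : Finset (L.Formula (G n ⊕ I)), ↑F ⊆ Φ →
        ∃ v : I → G n, ∀ φ ∈ F, φ.Realize (Sum.elim id v)) →
      ∃ v : I → G (n + 1), ∀ φ ∈ Φ, φ.Realize (Sum.elim (f n) v) := fun n =>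
    (exists_next I (chainStr (L := L) I ⟨M⟩ n)).choose_spec.choose_spec
  let o : ∀ n, G n → Language.DirectLimit G (chainMap f) := fun n => Language.DirectLimit.of L ℕ G (chainMap f) n
  have ho : ∀ n {α : Type u} (φ : L.Formula α) (v : α → G n),
      φ.Realize (o n ∘ v) ↔ φ.Realize v := fun n α φ v => of_formula_realize f φ v
  have ho' : ∀ n {α : Type} (φ : L.Formula α) (v : α → G n),
      φ.Realize (o n ∘ v) ↔ φ.Realize v := fun n α φ v => of_formula_realize f φ v
  have hstep : ∀ n z, o (n + 1) (f n z) = o n z := by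
    intro n z
    have : chainMap f n (n + 1) (by omega) z = f n z := by
      simp [chainMap, Nat.leRecOn_succ le_rfl, Nat.leRecOn_self]
    rw [← this]
    exact Language.DirectLimit.of_f
  refine ⟨Language.DirectLimit G (chainMap f), inferInstance, ⟨o 0, ?_⟩, fun n => Set.range (o n),
    ⟨monotone_nat_of_le_succ ?_, ?_, ?_⟩, rfl, ?_⟩
  · exact fun n φ x => of_formula_realize f φ (n := 0) x
  · rintro n _ ⟨z, rfl⟩
    exact ⟨f n z, hstep n z⟩
  · intro n ι κ _ φ e he ⟨x, hx⟩
    choose e' he' using he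
    obtain rfl : o n ∘ e' = e := funext he'
    have key := ho' n (Formula.iExs κ φ) e'
    rw [Formula.realize_iExs, Formula.realize_iExs] at key
    obtain ⟨a, ha⟩ := key.1 ⟨x, hx⟩
    refine ⟨o n ∘ a, fun i => ⟨_, rfl⟩, ?_⟩
    rw [← ho', Sum.comp_elim] at ha
    exact ha
  · intro n Φ hΦ
    have hinj : Function.Injective (o n) := (Language.DirectLimit.of L ℕ G (chainMap f) n).injective
    let u : Set.range (o n) ≃ G n := (Equiv.ofInjective _ hinj).symm
    have hu : ∀ z, o n (u z) = z := fun z => Equiv.apply_ofInjective_symm hinj z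
    obtain ⟨v, hv⟩ := hf n ((fun φ => φ.relabel (Sum.map u id)) '' Φ) (by
      intro F hF
      choose! g hg using fun ψ (hψ : ψ ∈ F) => hF hψ
      obtain ⟨w, hw⟩ := hΦ (F.image g) (by
        intro ψ hψ
        obtain ⟨χ, hχ, rfl⟩ := Finset.mem_image.1 (Finset.mem_coe.1 hψ)
        exact (hg χ hχ).1)
      obtain ⟨v, hv⟩ := exists_realize_of_elementary (o n) (ho n) F id w (by
        intro ψ hψ
        rw [← (hg ψ hψ).2, Formula.realize_relabel]
        convert hw _ (Finset.mem_image_of_mem g hψ)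
        ext i
        rcases i with i | i
        · exact hu i
        · rfl)
      exact ⟨v, hv⟩)
    refine ⟨o (n + 1) ∘ v, fun i => ⟨n + 1, _, rfl⟩, fun φ hφ => ?_⟩
    have := hv _ (Set.mem_image_of_mem _ hφ)
    rw [Formula.realize_relabel, ← ho] at this
    convert this using 1
    ext i
    rcases i with i | i
    · simp [hstep, hu]
    · rfl
  · intro x
    obtain ⟨n, z, h⟩ := DirectLimit.exists_of x
    exact ⟨n, z, h⟩

end Chain
end Benign

namespace Benign

section Sorts
variable (L : FirstOrder.Language.{u, u}) (C : Type u) [L.Structure C]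

/-- A sort over `C`: a quotient of a finite power of `C` by a definable equivalence relation. -/
class DSort (S : Type u) where
  idx : Type
  finite_idx : Finite idx
  rep' : (idx → C) → S
  rep_surjective' : Function.Surjective rep'
  definable_ker' : (∅ : Set C).Definable L
    {v : idx ⊕ idx → C | rep' (v ∘ Sum.inl) = rep' (v ∘ Sum.inr)}

attribute [instance] DSort.finite_idx

variable {C} in
/-- The element of a sort represented by a tuple. -/
def DSort.rep {S : Type u} [DSort L C S] (v : DSort.idx L C S → C) : S := DSort.rep' (L := L) v

variable {L C} in
theorem DSort.rep_surjective {S : Type u} [DSort L C S] :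
    Function.Surjective (DSort.rep L : (DSort.idx L C S → C) → S) := DSort.rep_surjective'

variable {L C} in
theorem DSort.definable_ker {S : Type u} [DSort L C S] : (∅ : Set C).Definable L
    {v : DSort.idx L C S ⊕ DSort.idx L C S → C |
      (DSort.rep L (v ∘ Sum.inl) : S) = DSort.rep L (v ∘ Sum.inr)} := DSort.definable_ker'

/-- `∅`-definable predicates on a sort. -/
def IsDfn {S : Type u} [DSort L C S] (Y : S → Prop) : Prop :=
  (∅ : Set C).Definable L {v | Y (DSort.rep L v)}

/-- Maps between sorts given by selecting coordinates of representatives. -/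
@[fun_prop]
def Coord {S T : Type u} [DSort L C S] [DSort L C T] (f : S → T) : Prop :=
  ∃ g : DSort.idx L C T → DSort.idx L C S, ∀ v : DSort.idx L C S → C,
    f (DSort.rep L v) = DSort.rep L (v ∘ g)

end Sorts

variable {L : FirstOrder.Language.{u, u}} {C : Type u} [L.Structure C]
variable {S T R E B : Type u}

local notation "Dfn" => IsDfn L C
local notation "Crd" => Coord L C

instance DSort.home : DSort L C C where
  idx := Unit
  finite_idx := inferInstance
  rep' v := v ()
  rep_surjective' x := ⟨fun _ => x, rfl⟩
  definable_ker' := by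
    refine Set.empty_definable_iff.2 ⟨Term.equal (Term.var (Sum.inl ())) (Term.var (Sum.inr ())), ?_⟩
    ext v
    simp

instance DSort.pi (ι : Type) [Finite ι] [DSort L C S] : DSort L C (ι → S) where
  idx := ι × DSort.idx L C S
  finite_idx := inferInstance
  rep' v i := DSort.rep L fun k => v (i, k)
  rep_surjective' x := by
    choose w hw using fun i => DSort.rep_surjective (L := L) (C := C) (x i)
    exact ⟨fun p => w p.1 p.2, funext hw⟩
  definable_ker' := by
    have : ∀ i : ι, (∅ : Set C).Definable L
        {v : (ι × DSort.idx L C S) ⊕ (ι × DSort.idx L C S) → C |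
          (DSort.rep L fun k => v (Sum.inl (i, k))) = DSort.rep L fun k => v (Sum.inr (i, k))} :=
      fun i => (DSort.definable_ker (L := L) (C := C) (S := S)).preimage_comp
        (Sum.map (Prod.mk i) (Prod.mk i))
    convert Set.definable_iInter_of_finite this using 1
    ext v
    simp [funext_iff, Function.comp_def]

instance DSort.prod [DSort L C S] [DSort L C T] : DSort L C (S × T) where
  idx := DSort.idx L C S ⊕ DSort.idx L C T
  finite_idx := inferInstance
  rep' v := (DSort.rep L (v ∘ Sum.inl), DSort.rep L (v ∘ Sum.inr))
  rep_surjective' x := by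
    obtain ⟨v, hv⟩ := DSort.rep_surjective (L := L) (C := C) x.1
    obtain ⟨w, hw⟩ := DSort.rep_surjective (L := L) (C := C) x.2
    exact ⟨Sum.elim v w, by simp [hv, hw]⟩
  definable_ker' := by
    have h1 := (DSort.definable_ker (L := L) (C := C) (S := S)).preimage_comp
      (Sum.map Sum.inl Sum.inl : _ → (_ ⊕ DSort.idx L C T) ⊕ (_ ⊕ DSort.idx L C T))
    have h2 := (DSort.definable_ker (L := L) (C := C) (S := T)).preimage_comp
      (Sum.map Sum.inr Sum.inr : _ → (DSort.idx L C S ⊕ _) ⊕ (DSort.idx L C S ⊕ _))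
    convert h1.inter h2 using 1
    ext v
    simp [Prod.ext_iff, Function.comp_def]

section Closure
variable [DSort L C S] [DSort L C T] [DSort L C R]

@[fun_prop] theorem Coord.id' : Crd (fun x : S => x) := ⟨_root_.id, fun _ => rfl⟩

@[fun_prop] theorem Coord.comp {f : T → R} {g : S → T} (hf : Crd f) (hg : Crd g) :
    Crd fun x => f (g x) := by
  obtain ⟨a, ha⟩ := hf
  obtain ⟨b, hb⟩ := hg
  exact ⟨b ∘ a, fun v => by simp only [hb, ha]; rfl⟩

@[fun_prop] theorem Coord.fst : Crd (Prod.fst : S × T → S) := ⟨Sum.inl, fun _ => rfl⟩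

@[fun_prop] theorem Coord.snd : Crd (Prod.snd : S × T → T) := ⟨Sum.inr, fun _ => rfl⟩

@[fun_prop] theorem Coord.mk {f : S → T} {g : S → R} (hf : Crd f) (hg : Crd g) :
    Crd fun x => (f x, g x) := by
  obtain ⟨a, ha⟩ := hf
  obtain ⟨b, hb⟩ := hg
  exact ⟨Sum.elim a b, fun v => by simp only [ha, hb]; rfl⟩

@[fun_prop] theorem Coord.apply {ι : Type} [Finite ι] (i : ι) :
    Crd fun x : ι → S => x i := ⟨Prod.mk i, fun _ => rfl⟩

@[fun_prop] theorem Coord.pi {ι : Type} [Finite ι] {f : S → ι → T}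
    (hf : ∀ i, Crd fun x => f x i) : Crd f := by
  choose a ha using hf
  exact ⟨fun p => a p.1 p.2, fun v => funext fun i => by simp only [ha]; rfl⟩

theorem IsDfn.comp {Y : T → Prop} (hY : Dfn Y) {f : S → T} (hf : Crd f) :
    Dfn fun x => Y (f x) := by
  obtain ⟨a, ha⟩ := hf
  have := Set.Definable.preimage_comp a hY
  unfold IsDfn
  simp only [ha]
  exact this

variable {Y Z : S → Prop}

theorem IsDfn.and (hY : Dfn Y) (hZ : Dfn Z) : Dfn fun x => Y x ∧ Z x := Set.Definable.inter hY hZ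

theorem IsDfn.or (hY : Dfn Y) (hZ : Dfn Z) : Dfn fun x => Y x ∨ Z x := Set.Definable.union hY hZ

theorem IsDfn.not (hY : Dfn Y) : Dfn fun x => ¬Y x := Set.Definable.compl hY

theorem IsDfn.imp (hY : Dfn Y) (hZ : Dfn Z) : Dfn fun x => Y x → Z x := by
  simpa only [imp_iff_not_or] using hY.not.or hZ

theorem IsDfn.iff (hY : Dfn Y) (hZ : Dfn Z) : Dfn fun x => Y x ↔ Z x := by
  simpa only [iff_iff_implies_and_implies] using (hY.imp hZ).and (hZ.imp hY)

theorem IsDfn.const (p : Prop) : Dfn fun _ : S => p := by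
  by_cases h : p
  · simpa [IsDfn, h] using Set.definable_univ
  · simpa [IsDfn, h] using Set.definable_empty

theorem IsDfn.forall_finite {ι : Type*} [Finite ι] {Y : ι → S → Prop} (h : ∀ i, Dfn (Y i)) :
    Dfn fun x => ∀ i, Y i x := by
  have := Set.definable_iInter_of_finite h
  unfold IsDfn
  convert this using 1
  ext v
  simp

theorem IsDfn.exists_finite {ι : Type*} [Finite ι] {Y : ι → S → Prop} (h : ∀ i, Dfn (Y i)) :
    Dfn fun x => ∃ i, Y i x := by
  simpa using (IsDfn.forall_finite fun i => (h i).not).not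

/-- Boolean combinations of finitely many definable predicates. -/
theorem IsDfn.bool {ι : Type*} [Finite ι] {Y : ι → S → Prop} (h : ∀ i, Dfn (Y i))
    (U : Set (Set ι)) : Dfn fun x => {i | Y i x} ∈ U := by
  have : Dfn fun x => ∃ W : Set ι, W ∈ U ∧ ∀ i, (Y i x ↔ i ∈ W) :=
    .exists_finite fun W => .and (.const _) (.forall_finite fun i => (h i).iff (.const _))
  convert this using 2 with x
  constructor
  · intro hx
    exact ⟨_, hx, fun i => Iff.rfl⟩
  · rintro ⟨W, hW, h⟩
    have : {i | Y i x} = W := Set.ext h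
    rwa [this]

theorem IsDfn.ex {Y : S → T → Prop} (hY : Dfn fun p : S × T => Y p.1 p.2) :
    Dfn fun x => ∃ y, Y x y := by
  have := Set.Definable.image_comp hY
    (Sum.inl : DSort.idx L C S → DSort.idx L C S ⊕ DSort.idx L C T)
  unfold IsDfn
  convert this using 1
  ext v
  simp only [Set.mem_setOf_eq, Set.mem_image]
  constructor
  · rintro ⟨y, hy⟩
    obtain ⟨w, rfl⟩ := DSort.rep_surjective (L := L) (C := C) y
    exact ⟨Sum.elim v w, hy, rfl⟩
  · rintro ⟨w, hw, rfl⟩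
    exact ⟨_, hw⟩

theorem IsDfn.all {Y : S → T → Prop} (hY : Dfn fun p : S × T => Y p.1 p.2) :
    Dfn fun x => ∀ y, Y x y := by
  simpa using (IsDfn.ex (Y := fun x y => ¬Y x y) hY.not).not

theorem IsDfn.eq {f g : S → T} (hf : Crd f) (hg : Crd g) : Dfn fun x => f x = g x := by
  have h : Dfn fun p : T × T => p.1 = p.2 := DSort.definable_ker
  exact h.comp (hf.mk hg)

end Closure

/-- Equality of types over `∅`. -/
def TpEq (L : FirstOrder.Language.{u, u}) (C : Type u) [L.Structure C] [DSort L C S]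
    (x y : S) : Prop :=
  ∀ P : S → Prop, IsDfn L C P → P x → P y

/-- `x` has a representative with coordinates in `N`. -/
def Rat (L : FirstOrder.Language.{u, u}) {C : Type u} [L.Structure C] [DSort L C S]
    (N : Set C) (x : S) : Prop :=
  ∃ v : DSort.idx L C S → C, (∀ i, v i ∈ N) ∧ DSort.rep L v = x

section TypeEq
variable [DSort L C S] [DSort L C T] [DSort L C R]

local notation "Tp" => TpEq L C

theorem TpEq.refl (x : S) : Tp x x := fun _ _ h => h

theorem TpEq.symm {x y : S} (h : Tp x y) : Tp y x := fun P hP hy => by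
  by_contra hx
  exact h _ hP.not hx hy

theorem TpEq.trans {x y z : S} (h : Tp x y) (h' : Tp y z) : Tp x z :=
  fun P hP hx => h' P hP (h P hP hx)

theorem TpEq.iff {x y : S} (h : Tp x y) {P : S → Prop} (hP : Dfn P) : P x ↔ P y :=
  ⟨h P hP, h.symm P hP⟩

theorem TpEq.map {x y : S} (h : Tp x y) {f : S → T} (hf : Crd f) : Tp (f x) (f y) :=
  fun _ hP hx => h _ (hP.comp hf) hx

theorem Rat.map {N : Set C} {x : S} (h : Rat L N x) {f : S → T} (hf : Crd f) :
    Rat L N (f x) := by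
  obtain ⟨v, hv, rfl⟩ := h
  obtain ⟨a, ha⟩ := hf
  exact ⟨v ∘ a, fun i => hv _, (ha v).symm⟩

theorem Rat.prod {N : Set C} {x : S} {y : T} (hx : Rat L N x) (hy : Rat L N y) :
    Rat L N (x, y) := by
  obtain ⟨v, hv, rfl⟩ := hx
  obtain ⟨w, hw, rfl⟩ := hy
  exact ⟨Sum.elim v w, by rintro (i | i) <;> simp [hv, hw], rfl⟩

theorem Rat.pi {ι : Type} [Finite ι] {N : Set C} {x : ι → S} (hx : ∀ i, Rat L N (x i)) :
    Rat L N x := by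
  choose v hv h using hx
  exact ⟨fun p => v p.1 p.2, fun p => hv _ _, funext h⟩

theorem Rat.mono {N N' : Set C} (h : N ⊆ N') {x : S} (hx : Rat L N x) : Rat L N' x := by
  obtain ⟨v, hv, rfl⟩ := hx
  exact ⟨v, fun i => h (hv i), rfl⟩

theorem exists_rat_of_cover {lev : ℕ → Set C} (hm : Monotone lev) {x : S}
    (h : Rat L {c | ∃ n, c ∈ lev n} x) : ∃ n, Rat L (lev n) x := by
  obtain ⟨v, hv, rfl⟩ := h
  choose n hn using hv
  have := Fintype.ofFinite (DSort.idx L C S)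
  exact ⟨Finset.univ.sup n, v, fun i => hm (Finset.le_sup (Finset.mem_univ i)) (hn i), rfl⟩

end TypeEq

section Sat
variable [Nonempty C] [DSort L C S]

/-- Saturation of a filtration, phrased with filters on a sort. -/
theorem Filtration.exists_realization {I : Type u} [Infinite I] {lev : ℕ → Set C}
    (hlev : Filtration L I lev) (n : ℕ) (ℱ : Filter S) [ℱ.NeBot] :
    ∃ x : S, Rat L {c | ∃ n, c ∈ lev n} x ∧ ∀ {E : Type u} [DSort L C E] (Y : S × E → Prop),
      Dfn Y → ∀ e, Rat L (lev n) e → (∀ᶠ s in ℱ, Y (s, e)) → Y (x, e) := by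
  classical
  obtain ⟨κ⟩ : Nonempty (DSort.idx L C S ↪ I) := by
    have := Fintype.ofFinite (DSort.idx L C S)
    exact ⟨(Fintype.equivFin _).toEmbedding.trans
      (Fin.valEmbedding.trans (Infinite.natEmbedding I))⟩
  obtain ⟨v, hv, hΦ⟩ := hlev.sat n ((fun ψ => ψ.relabel (Sum.map id κ)) ''
    {ψ : L.Formula (lev n ⊕ DSort.idx L C S) | ∀ᶠ s in ℱ, ∀ v : DSort.idx L C S → C,
      DSort.rep L v = s → ψ.Realize (Sum.elim Subtype.val v)}) (by
    intro F hF
    choose! g hg using fun ψ (hψ : ψ ∈ F) => hF hψ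
    have h1 : ∀ᶠ s in ℱ, ∀ ψ ∈ F, ∀ v : DSort.idx L C S → C,
        DSort.rep L v = s → (g ψ).Realize (Sum.elim Subtype.val v) :=
      (Filter.eventually_all_finset F).2 fun ψ hψ => (hg ψ hψ).1
    obtain ⟨s, hs⟩ := h1.exists
    obtain ⟨v, hv⟩ := DSort.rep_surjective (L := L) (C := C) s
    refine ⟨Function.extend κ v fun _ => Classical.arbitrary C, fun ψ hψ => ?_⟩
    rw [← (hg ψ hψ).2, Formula.realize_relabel, Sum.elim_comp_map,
      Function.extend_comp κ.injective]
    exact hs ψ hψ v hv)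
  refine ⟨DSort.rep L (v ∘ κ), ⟨_, fun i => hv _, rfl⟩, ?_⟩
  rintro E _ Y hY _ ⟨w, hw, rfl⟩ hY'
  obtain ⟨φ, hφ⟩ := Set.empty_definable_iff.1 hY
  have hφ' : ∀ v : _ → C, Y (DSort.rep L v) ↔ φ.Realize v := fun v => Set.ext_iff.1 hφ v
  have h := hΦ _ ⟨φ.relabel (Sum.elim Sum.inr fun i => Sum.inl ⟨w i, hw i⟩), by
    filter_upwards [hY'] with s hs v hv
    subst hv
    rw [Formula.realize_relabel]
    exact (show (Sum.elim Subtype.val v ∘ Sum.elim Sum.inr fun i => Sum.inl ⟨w i, hw i⟩) =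
      Sum.elim v w from funext (by rintro (i | i) <;> rfl)) ▸ (hφ' (Sum.elim v w)).1 hs, rfl⟩
  rw [Formula.realize_relabel, Formula.realize_relabel] at h
  refine (hφ' (Sum.elim (v ∘ κ) w)).2 ?_
  exact (show ((Sum.elim Subtype.val v ∘ Sum.map id κ) ∘
    Sum.elim Sum.inr fun i => Sum.inl ⟨w i, hw i⟩) = Sum.elim (v ∘ κ) w from
      funext (by rintro (i | i) <;> rfl)) ▸ h

/-- Each level of a filtration is closed under witnesses of definable conditions. -/
theorem Filtration.exists_rat_of_exists {I : Type u} {lev : ℕ → Set C}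
    (hlev : Filtration L I lev) (n : ℕ) [DSort L C E] {Y : S × E → Prop} (hY : Dfn Y) {e : E}
    (he : Rat L (lev n) e) (h : ∃ s, Y (s, e)) : ∃ s, Rat L (lev n) s ∧ Y (s, e) := by
  obtain ⟨w, hw, rfl⟩ := he
  obtain ⟨φ, hφ⟩ := Set.empty_definable_iff.1 hY
  have hφ' : ∀ v : _ → C, Y (DSort.rep L v) ↔ φ.Realize v := fun v => Set.ext_iff.1 hφ v
  have key : ∀ v, Y (DSort.rep L v, DSort.rep L w) ↔ (φ.relabel Sum.swap).Realize (Sum.elim w v) := by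
    intro v
    rw [Formula.realize_relabel, show Sum.elim w v ∘ Sum.swap = Sum.elim v w from
      funext (by rintro (i | i) <;> rfl)]
    exact hφ' (Sum.elim v w)
  obtain ⟨s, hs⟩ := h
  obtain ⟨v, rfl⟩ := DSort.rep_surjective (L := L) (C := C) s
  obtain ⟨v', h1, h2⟩ := hlev.tv n _ _ _ w hw ⟨v, (key v).1 hs⟩
  exact ⟨_, ⟨v', h1, rfl⟩, (key v').2 h2⟩

end Sat
end Benign

namespace Benign

theorem exists_lt_power_aleph0 (μ : Cardinal.{u}) : ∃ κ : Cardinal.{u}, μ ≤ κ ∧ ℵ₀ ≤ κ ∧ κ < κ ^ ℵ₀ := by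
  refine ⟨ℵ_ (μ.ord + Ordinal.omega0), ?_, aleph0_le_aleph _, ?_⟩
  · rw [← Cardinal.ord_le_ord, Cardinal.ord_aleph]
    exact le_self_add.trans (Ordinal.le_omega_self _)
  · have := Cardinal.lt_power_cof_ord (aleph0_le_aleph (μ.ord + Ordinal.omega0))
    rwa [Cardinal.ord_aleph, Ordinal.cof_omega (Ordinal.isSuccLimit_add _ Ordinal.isSuccLimit_omega0),
      Ordinal.cof_add _ Ordinal.omega0_ne_zero, Ordinal.cof_omega0] at this

section Count
variable {L : FirstOrder.Language.{u, u}} {C : Type u} [L.Structure C] [Nonempty C]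

theorem not_finitely_satisfiable_of_superstable {T : L.Theory} (hss : Superstable L T)
    (hT : C ⊨ T) {κ : Cardinal.{u}} (hκ : 2 ^ cardL L ≤ κ) {X D : Type u} {ι : Type} [Finite ι]
    (hD : #D ≤ κ) (hX : κ < #X) (Φ : Set (L.Formula ((X × ι) ⊕ D)))
    (hsplit : ∀ η ζ : X, η ≠ ζ → ∃ φ : L.Formula (ι ⊕ D), ∃ a b, ((a, b) = (η, ζ) ∨ (a, b) = (ζ, η)) ∧
      φ.relabel (Sum.map (Prod.mk a) id) ∈ Φ ∧ (φ.relabel (Sum.map (Prod.mk b) id)).not ∈ Φ)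
    (hΦ : ∀ F : Finset (L.Formula ((X × ι) ⊕ D)), ↑F ⊆ Φ → ∃ v : _ → C, ∀ φ ∈ F, φ.Realize v) :
    False := by
  classical
  obtain ⟨N, _, hN, v, hv⟩ := exists_model_realizing Φ hΦ
  obtain ⟨m, ⟨e⟩⟩ := Finite.exists_equiv_fin ι
  let A : Set N := Set.range (v ∘ Sum.inr)
  have hA : #A ≤ κ := mk_range_le.trans hD
  have key := hss κ hκ N inferInstance (hN T hT) A hA m
  have : Nonempty N := by
    by_contra h
    rw [not_nonempty_iff] at h
    obtain ⟨x⟩ : Nonempty X := by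
      rw [← mk_ne_zero_iff]; exact (hX.trans_le' zero_le).ne'
    have h1 := exists_elementaryExtension_realizing (L := L) (C := C) X
    have : N ⊨ L.completeTheory C := hN _ inferInstance
    have h2 : (Formula.iExs Unit (⊥ : L.Formula (Empty ⊕ Unit)).not : L.Sentence) ∈
        L.completeTheory C := by
      rw [mem_completeTheory]
      unfold Sentence.Realize
      rw [Formula.realize_iExs]
      exact ⟨fun _ => Classical.arbitrary C, by simp⟩
    have h3 := this.realize_of_mem _ h2
    unfold Sentence.Realize at h3
    rw [Formula.realize_iExs] at h3
    obtain ⟨f, -⟩ := h3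
    exact h.elim (f ())
  let τ : X → ((L[[↥A]]).completeTheory N).CompleteType (Fin m) := fun η =>
    Theory.typeOf _ fun i => v (Sum.inl (η, e.symm i))
  refine (hX.trans_le (mk_le_of_injective (f := τ) ?_)).not_ge key
  intro η ζ hηζ
  by_contra hne
  obtain ⟨φ, a, b, hab, h1, h2⟩ := hsplit η ζ hne
  have hτ : τ a = τ b := by
    rcases hab with h | h <;> obtain ⟨rfl, rfl⟩ := Prod.ext_iff.1 h
    · exact hηζ
    · exact hηζ.symm
  have h1 := hv _ h1
  have h2 := hv _ h2
  rw [Formula.realize_not, Formula.realize_relabel] at h2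
  rw [Formula.realize_relabel] at h1
  obtain ⟨ψ, hψ⟩ := Set.definable_iff_exists_formula_sum (A := A) (s := {w : Fin m → N |
    φ.Realize (Sum.elim (w ∘ e) (v ∘ Sum.inr))}) |>.2
      ⟨φ.relabel (Sum.elim (Sum.inr ∘ e) fun d => Sum.inl ⟨v (Sum.inr d), d, rfl⟩), by
        ext w
        simp only [Set.mem_setOf_eq, Formula.realize_relabel]
        exact iff_of_eq (congrArg _ (funext (by rintro (i | i) <;> rfl)))⟩
  have hψ' : ∀ w : Fin m → N, φ.Realize (Sum.elim (w ∘ e) (v ∘ Sum.inr)) ↔ ψ.Realize w :=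
    fun w => Set.ext_iff.1 hψ w
  have hmem : ∀ c : X, Formula.equivSentence ψ ∈ τ c ↔ φ.Realize (v ∘ Sum.map (Prod.mk c) id) := by
    intro c
    rw [Theory.CompleteType.formula_mem_typeOf, ← hψ']
    refine iff_of_eq (congrArg _ (funext ?_))
    rintro (i | i) <;> simp
  rw [← hmem] at h1 h2
  exact h2 (hτ ▸ h1)

/-- There is no configuration of more than `κ` elements pairwise separated by definable sets with
parameters from a set of size at most `κ`. -/
theorem no_split {T : L.Theory} (hss : Superstable L T)
    (hT : C ⊨ T) {κ : Cardinal.{u}} (hκ : 2 ^ cardL L ≤ κ) {X D : Type u}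
    (hD : #D ≤ κ) (hX : κ < #X) {S : Type u} [DSort L C S] {B : D → Type u} [∀ d, DSort L C (B d)]
    {ψ : ∀ d, S × B d → Prop} (hψ : ∀ d, IsDfn L C (ψ d)) (r : X → X → Prop) (w : X → X → D)
    (hr : ∀ η ζ, η ≠ ζ → r η ζ ∨ r ζ η)
    (h : ∀ H : Finset X, ∃ (a : X → S) (t : ∀ d, B d), ∀ η ∈ H, ∀ ζ ∈ H, r η ζ →
      ψ _ (a η, t (w η ζ)) ∧ ¬ψ _ (a ζ, t (w η ζ))) : False := by
  classical
  have hκ0 : ℵ₀ ≤ κ := (le_sup_right.trans (cantor _).le).trans hκ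
  choose φ hφ using fun d => Set.empty_definable_iff.1 (hψ d)
  have hφ' : ∀ d v, ψ d (DSort.rep L v) ↔ (φ d).Realize v := fun d v => Set.ext_iff.1 (hφ d) v
  let χ : ∀ d, L.Formula (DSort.idx L C S ⊕ Σ d, DSort.idx L C (B d)) := fun d =>
    (φ d).relabel (Sum.map id (Sigma.mk d))
  let Φ : Set (L.Formula ((X × DSort.idx L C S) ⊕ Σ d, DSort.idx L C (B d))) :=
    (fun p : X × X => ((χ (w p.1 p.2)).relabel (Sum.map (Prod.mk p.1) id) : L.Formula _)) '' {p | r p.1 p.2} ∪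
    (fun p : X × X => (((χ (w p.1 p.2)).relabel (Sum.map (Prod.mk p.2) id)).not : L.Formula _)) '' {p | r p.1 p.2}
  refine not_finitely_satisfiable_of_superstable hss hT hκ (D := Σ d, DSort.idx L C (B d)) ?_ hX Φ
    ?_ ?_
  · choose g hg using fun d => exists_injective_nat (DSort.idx L C (B d))
    refine (mk_le_of_injective (f := fun p : Σ d, DSort.idx L C (B d) => (p.1, g p.1 p.2)) ?_).trans ?_
    · rintro ⟨d, i⟩ ⟨d', i'⟩ h
      simp only [Prod.mk.injEq] at h
      obtain ⟨rfl, h⟩ := h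
      rw [hg d h]
    · simpa using (mul_le_mul' hD hκ0).trans (mul_eq_self hκ0).le
  · intro η ζ hne
    rcases hr η ζ hne with h | h
    · exact ⟨_, η, ζ, .inl rfl, .inl ⟨(η, ζ), h, rfl⟩, .inr ⟨(η, ζ), h, rfl⟩⟩
    · exact ⟨_, ζ, η, .inr rfl, .inl ⟨(ζ, η), h, rfl⟩, .inr ⟨(ζ, η), h, rfl⟩⟩
  · intro F hF
    have hF' : ∀ f ∈ F, ∃ p : X × X, r p.1 p.2 ∧ (f = (χ (w p.1 p.2)).relabel (Sum.map (Prod.mk p.1) id) ∨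
        f = ((χ (w p.1 p.2)).relabel (Sum.map (Prod.mk p.2) id)).not) := by
      intro f hf
      rcases hF hf with ⟨p, h, rfl⟩ | ⟨p, h, rfl⟩
      · exact ⟨p, h, .inl rfl⟩
      · exact ⟨p, h, .inr rfl⟩
    have : Nonempty X := by
      rw [← mk_ne_zero_iff]; exact (hX.trans_le' zero_le).ne'
    choose! p hp hpf using hF'
    obtain ⟨a, t, hat⟩ := h (F.image (fun f => (p f).1) ∪ F.image fun f => (p f).2)
    choose a' ha' using fun η => DSort.rep_surjective (L := L) (C := C) (a η)
    choose t' ht' using fun d => DSort.rep_surjective (L := L) (C := C) (t d)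
    refine ⟨Sum.elim (fun q => a' q.1 q.2) fun q => t' q.1 q.2, fun f hf => ?_⟩
    have h1 := hat (p f).1 (Finset.mem_union_left _ (Finset.mem_image_of_mem _ hf)) (p f).2
      (Finset.mem_union_right _ (Finset.mem_image_of_mem _ hf)) (hp f hf)
    have key : ∀ η d, ((χ d).relabel (Sum.map (Prod.mk η) id) : L.Formula _).Realize
        (Sum.elim (fun q : X × DSort.idx L C S => a' q.1 q.2) fun q : Σ d, DSort.idx L C (B d) => t' q.1 q.2) ↔
        ψ d (a η, t d) := by
      intro η d
      have : (a η, t d) = DSort.rep (C := C) (S := S × B d) L (Sum.elim (a' η) (t' d)) := by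
        rw [← ha' η, ← ht' d]; rfl
      rw [this, hφ', Formula.realize_relabel, Formula.realize_relabel]
      exact iff_of_eq (congrArg _ (funext (by rintro (i | i) <;> rfl)))
    rcases hpf f hf with h2 | h2 <;> rw [h2]
    · exact (key _ _).2 h1.1
    · exact Formula.realize_not.2 fun h => h1.2 ((key _ _).1 h)

theorem mk_sigma_fin_le {O : Type u} (hO : ℵ₀ ≤ #O) : #(Σ n, Fin n → O) ≤ #O := by
  have : Infinite O := Cardinal.infinite_iff.2 hO
  rw [← Cardinal.mk_congr (List.equivSigmaTuple (α := O)), Cardinal.mk_list_eq_mk]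

theorem exists_first_diff {O : Type*} {η ζ : ℕ → O} (h : η ≠ ζ) :
    ∃ n, (∀ i < n, η i = ζ i) ∧ η n ≠ ζ n := by
  classical
  have h' : ∃ n, η n ≠ ζ n := Function.ne_iff.1 h
  exact ⟨Nat.find h', fun i hi => not_not.1 (Nat.find_min h' hi), Nat.find_spec h'⟩

/-- Superstability excludes trees of definable separations. -/
theorem no_tree {T : L.Theory} (hss : Superstable L T) (hT : C ⊨ T)
    {S : Type u} [DSort L C S] {B : ℕ → Type u} [∀ n, DSort L C (B n)]
    {ψ : ∀ n, S × B n → Prop} (hψ : ∀ n, IsDfn L C (ψ n))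
    (h : ∀ (O : Type u) (H : Finset (ℕ → O)) (N : ℕ),
      ∃ (a : (ℕ → O) → S) (t : ∀ n, (Fin n → O) → B n), ∀ η ∈ H, ∀ ζ ∈ H, ∀ n < N,
        (∀ i < n, η i = ζ i) → η n ≠ ζ n →
          ψ (n + 1) (a η, t (n + 1) fun i => η i) ∧ ¬ψ (n + 1) (a ζ, t (n + 1) fun i => η i)) :
    False := by
  classical
  obtain ⟨κ, hκ, hκ0, hlt⟩ := exists_lt_power_aleph0 (2 ^ cardL L)
  obtain ⟨O, rfl⟩ : ∃ O : Type u, #O = κ := ⟨κ.out, mk_out κ⟩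
  choose! d hd using fun p : (ℕ → O) × (ℕ → O) => exists_first_diff (η := p.1) (ζ := p.2)
  refine no_split hss hT hκ (X := ℕ → O) (D := Σ n, Fin n → O) (mk_sigma_fin_le hκ0) (by simpa using hlt)
    (S := S) (B := fun d => B d.1) (ψ := fun d => ψ d.1) (fun d => hψ _) (fun η ζ => η ≠ ζ)
    (fun η ζ => ⟨d (η, ζ) + 1, fun i => η i⟩) (fun η ζ h => .inl h) fun H => ?_
  obtain ⟨a, t, hat⟩ := h O H ((H ×ˢ H).sup d + 1)
  refine ⟨a, fun d => t d.1 d.2, fun η hη ζ hζ hne => ?_⟩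
  exact hat η hη ζ hζ _ (Nat.lt_succ_of_le (Finset.le_sup (f := d) (Finset.mk_mem_product hη hζ)))
    (hd (η, ζ) hne).1 (hd (η, ζ) hne).2

/-- Superstable theories do not have the order property. -/
theorem no_order {T : L.Theory} (hss : Superstable L T) (hT : C ⊨ T)
    {S B : Type u} [DSort L C S] [DSort L C B] {Y : S × B → Prop} (hY : IsDfn L C Y)
    (x : ℕ → S) (y : ℕ → B) (h : ∀ i j, Y (x i, y j) ↔ i < j) : False := by
  classical
  obtain ⟨κ, hκ, hκ0, hlt⟩ := exists_lt_power_aleph0 (2 ^ cardL L)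
  obtain ⟨O, rfl⟩ : ∃ O : Type u, #O = κ := ⟨κ.out, mk_out κ⟩
  let := linearOrderOfSTO (WellOrderingRel (α := O))
  let R : (ℕ → O) → (ℕ → O) → Prop := fun η ζ => ∃ m, (∀ i < m, η i = ζ i) ∧ η m < ζ m
  let R' : (ℕ → O) → (Σ n, Fin n → O) → Prop := fun η d =>
    ∃ m, ∃ hm : m < d.1, (∀ i, ∀ hi : i < m, η i = d.2 ⟨i, hi.trans hm⟩) ∧ η m < d.2 ⟨m, hm⟩
  choose! d hd using fun p : (ℕ → O) × (ℕ → O) => exists_first_diff (η := p.1) (ζ := p.2)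
  refine no_split hss hT hκ (X := ℕ → O) (D := Σ n, Fin n → O) (mk_sigma_fin_le hκ0) (by simpa using hlt)
    (S := S) (B := fun d => B) (ψ := fun d => Y) (fun d => hY) R
    (fun η ζ => ⟨d (η, ζ) + 1, fun i => ζ i⟩) (fun η ζ h => ?_) fun H => ?_
  · obtain ⟨n, h1, h2⟩ := exists_first_diff h
    rcases lt_or_gt_of_ne h2 with h3 | h3
    · exact .inl ⟨n, h1, h3⟩
    · exact .inr ⟨n, fun i hi => (h1 i hi).symm, h3⟩
  · refine ⟨fun η => x (H.filter fun h => R h η).card, fun d => y (H.filter fun h => R' h d).card,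
      fun η hη ζ hζ hR => ?_⟩
    rw [h, h, not_lt]
    have hne : η ≠ ζ := by
      rintro rfl
      obtain ⟨m, -, hm⟩ := hR
      exact lt_irrefl _ hm
    obtain ⟨h1, h2⟩ := hd (η, ζ) hne
    have h3 : η (d (η, ζ)) < ζ (d (η, ζ)) := by
      obtain ⟨m, hm, hm'⟩ := hR
      rcases lt_trichotomy m (d (η, ζ)) with h | h | h
      · exact absurd (h1 m h) hm'.ne
      · exact h ▸ hm'
      · exact absurd (hm _ h) h2
    constructor
    · refine Finset.card_lt_card ⟨fun z hz => ?_, fun hsub => ?_⟩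
      · rw [Finset.mem_filter] at hz ⊢
        refine ⟨hz.1, ?_⟩
        obtain ⟨m, hm, hm'⟩ := hz.2
        rcases lt_trichotomy m (d (η, ζ)) with h | h | h
        · exact ⟨m, by simp; omega, fun i hi => (hm i hi).trans (h1 i (hi.trans h)), hm'.trans_eq (h1 m h)⟩
        · subst h
          exact ⟨_, Nat.lt_succ_self _, fun i hi => (hm i hi).trans (h1 i hi), hm'.trans h3⟩
        · exact ⟨_, Nat.lt_succ_self _, fun i hi => (hm i (hi.trans h)).trans (h1 i hi),
            (hm _ h).trans_lt h3⟩
      · have := hsub (Finset.mem_filter.2 ⟨hη, d (η, ζ), Nat.lt_succ_self _, h1, h3⟩)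
        obtain ⟨m, -, hm⟩ := (Finset.mem_filter.1 this).2
        exact lt_irrefl _ hm
    · refine Finset.card_le_card fun z hz => ?_
      rw [Finset.mem_filter] at hz ⊢
      obtain ⟨m, hm, hm'⟩ := hz.2
      exact ⟨hz.1, m, hm'⟩

end Count
end Benign

namespace Benign

/-- The properties of a sufficiently saturated model of a superstable theory that are used in
the sequel. -/
structure Monster (L : FirstOrder.Language.{u, u}) {C : Type u} [L.Structure C]
    (lev : ℕ → Set C) : Prop where
  mono : Monotone lev
  cover : ∀ x, ∃ n, x ∈ lev n
  sat : ∀ {S : Type u} [DSort L C S] (n : ℕ) (ℱ : Filter S) [ℱ.NeBot], ∃ x : S,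
    ∀ {E : Type u} [DSort L C E] (Y : S × E → Prop), IsDfn L C Y → ∀ e, Rat L (lev n) e →
      (∀ᶠ s in ℱ, Y (s, e)) → Y (x, e)
  tv : ∀ {S E : Type u} [DSort L C S] [DSort L C E] (n : ℕ) {Y : S × E → Prop}, IsDfn L C Y →
    ∀ {e : E}, Rat L (lev n) e → (∃ s, Y (s, e)) → ∃ s, Rat L (lev n) s ∧ Y (s, e)
  no_order : ∀ {S B : Type u} [DSort L C S] [DSort L C B] {Y : S × B → Prop}, IsDfn L C Y →
    ∀ (x : ℕ → S) (y : ℕ → B), ¬∀ i j, Y (x i, y j) ↔ i < j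
  no_tree : ∀ {S : Type u} [DSort L C S] {B : ℕ → Type u} [∀ n, DSort L C (B n)]
    {ψ : ∀ n, S × B n → Prop}, (∀ n, IsDfn L C (ψ n)) →
    ¬∀ (O : Type u) (H : Finset (ℕ → O)) (N : ℕ),
      ∃ (a : (ℕ → O) → S) (t : ∀ n, (Fin n → O) → B n), ∀ η ∈ H, ∀ ζ ∈ H, ∀ n < N,
        (∀ i < n, η i = ζ i) → η n ≠ ζ n →
          ψ (n + 1) (a η, t (n + 1) fun i => η i) ∧ ¬ψ (n + 1) (a ζ, t (n + 1) fun i => η i)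

section Stab
variable {S T : Type*}

/-- A relation without a half-graph. -/
def Stab (Y : S → T → Prop) : Prop :=
  ∀ (x : ℕ → S) (y : ℕ → T), ¬(∀ i j, i < j → Y (x i) (y j) ∧ ¬Y (x j) (y i)) ∧
    ¬(∀ i j, i < j → ¬Y (x i) (y j) ∧ Y (x j) (y i))

theorem Stab.precomp {Y : S → T → Prop} (h : Stab Y) {S' T' : Type*} (f : S' → S) (g : T' → T) :
    Stab fun x y => Y (f x) (g y) := fun x y => h (f ∘ x) (g ∘ y)

theorem Stab.not {Y : S → T → Prop} (h : Stab Y) : Stab fun x y => ¬Y x y := fun x y =>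
  ⟨fun H => (h x y).2 fun i j hij => by simpa using H i j hij,
   fun H => (h x y).1 fun i j hij => by simpa using H i j hij⟩

theorem Stab.eventually_imp {Y : S → T → Prop} (h : Stab Y) (p : Ultrafilter S) (q : Ultrafilter T)
    (h1 : ∀ᶠ x in p, ∀ᶠ y in q, Y x y) : ∀ᶠ y in q, ∀ᶠ x in p, Y x y := by
  by_contra h2
  rw [← Ultrafilter.eventually_not] at h2
  simp only [← Ultrafilter.eventually_not] at h2
  obtain ⟨f, -, hf⟩ := exists_seq_of_forall_finset_exists
    (fun z : S × T => (∀ᶠ y in q, Y z.1 y) ∧ ∀ᶠ x in p, ¬Y x z.2)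
    (fun z z' => Y z.1 z'.2 ∧ ¬Y z'.1 z.2) (by
      intro s hs
      obtain ⟨x, hx1, hx2⟩ := (h1.and ((Filter.eventually_all_finset s).2 fun z hz => (hs z hz).2)).exists
      obtain ⟨y, hy1, hy2⟩ := (h2.and ((Filter.eventually_all_finset s).2 fun z hz => (hs z hz).1)).exists
      exact ⟨(x, y), ⟨hx1, hy1⟩, fun z hz => ⟨hy2 z hz, hx2 z hz⟩⟩)
  exact (h (fun i => (f i).1) fun i => (f i).2).1 fun i j hij => hf i j hij

theorem Stab.eventually_comm {Y : S → T → Prop} (h : Stab Y) (p : Ultrafilter S) (q : Ultrafilter T) :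
    (∀ᶠ x in p, ∀ᶠ y in q, Y x y) ↔ ∀ᶠ y in q, ∀ᶠ x in p, Y x y := by
  refine ⟨h.eventually_imp p q, fun h1 => ?_⟩
  by_contra h2
  rw [← Ultrafilter.eventually_not] at h2
  simp only [← Ultrafilter.eventually_not] at h2
  obtain ⟨y, hy1, hy2⟩ := (h1.and (h.not.eventually_imp p q h2)).exists
  obtain ⟨x, hx, hx'⟩ := (hy1.and hy2).exists
  exact hx' hx

/-- Definability of the trace of an ultrafilter. -/
theorem Stab.exists_trace {Y : S → T → Prop} (h : Stab Y) (p : Ultrafilter S) :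
    ∃ (N : ℕ) (w : Fin N → S), ∀ y z, (∀ i, Y (w i) y → Y (w i) z) →
      (∀ᶠ x in p, Y x y) → ∀ᶠ x in p, Y x z := by
  classical
  by_contra hcon
  push Not at hcon
  obtain ⟨f, -, hf⟩ := exists_seq_of_forall_finset_exists
    (fun v : S × T × T => (∀ᶠ x in p, Y x v.2.1) ∧ ∀ᶠ x in p, ¬Y x v.2.2)
    (fun v v' => (Y v.1 v'.2.1 → Y v.1 v'.2.2) ∧ Y v'.1 v.2.1 ∧ ¬Y v'.1 v.2.2) (by
      intro s hs
      obtain ⟨y, z, h1, h2, h3⟩ := hcon s.card fun i => (s.equivFin.symm i).1.1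
      replace h3 : ∀ᶠ x in p, ¬Y x z := by simpa using h3
      obtain ⟨x, h4⟩ := ((Filter.eventually_all_finset s).2 fun v hv => (hs v hv).1.and (hs v hv).2).exists
      refine ⟨(x, y, z), ⟨h2, h3⟩, fun v hv => ⟨?_, h4 v hv⟩⟩
      simpa using h1 (s.equivFin ⟨v, hv⟩))
  have hlt : ∀ i : ℕ, ∀ᶠ j in (Filter.hyperfilter ℕ : Filter ℕ), i < j := fun i =>
    Nat.hyperfilter_le_atTop (Filter.eventually_gt_atTop i)
  have h1 := (h.precomp (fun i => (f i).1) fun i => (f i).2.1).eventually_comm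
    (Filter.hyperfilter ℕ) (Filter.hyperfilter ℕ) |>.2
      (.of_forall fun i => (hlt i).mono fun j hj => (hf i j hj).2.1)
  have h2 := (h.not.precomp (fun i => (f i).1) fun i => (f i).2.2).eventually_comm
    (Filter.hyperfilter ℕ) (Filter.hyperfilter ℕ) |>.2
      (.of_forall fun i => (hlt i).mono fun j hj => (hf i j hj).2.2)
  obtain ⟨j, h3, h4⟩ := (h1.and h2).exists
  obtain ⟨i, ⟨h5, h6⟩, h7⟩ := ((h3.and h4).and (hlt j)).exists
  exact h6 ((hf j i h7).1 h5)

end Stab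

variable {L : FirstOrder.Language.{u, u}} {C : Type u} [L.Structure C] {lev : ℕ → Set C}
variable {S T R E B : Type u} [DSort L C S] [DSort L C T] [DSort L C R] [DSort L C E] [DSort L C B]
local notation "Dfn" => IsDfn L C
local notation "Crd" => Coord L C
local notation "Tp" => TpEq L C

theorem exists_rat_univ (x : S) : Rat L (Set.univ : Set C) x := by
  obtain ⟨v, rfl⟩ := DSort.rep_surjective (L := L) (C := C) x
  exact ⟨v, by simp, rfl⟩

namespace Monster

theorem exists_rat (hM : Monster L lev) (x : S) : ∃ n, Rat L (lev n) x :=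
  exists_rat_of_cover hM.mono ((exists_rat_univ (L := L) x).mono fun c _ => hM.cover c)

theorem stab (hM : Monster L lev) {Y : S × T → Prop} (hY : Dfn Y) : Stab fun s t => Y (s, t) := by
  have key : ∀ Y : S × T → Prop, Dfn Y → ∀ (x : ℕ → S) (y : ℕ → T),
      ¬∀ i j, i < j → Y (x i, y j) ∧ ¬Y (x j, y i) := by
    intro Y hY x y h
    refine hM.no_order hY (fun i => x (2 * i + 1)) (fun j => y (2 * j)) fun i j => ⟨fun h1 => ?_, fun h1 => ?_⟩
    · by_contra h2
      exact (h _ _ (by omega)).2 h1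
    · exact (h _ _ (by omega)).1
  refine fun x y => ⟨key Y hY x y, fun h => key _ hY.not x y fun i j hij => ?_⟩
  simpa using h i j hij

theorem sat_fip (hM : Monster L lev)
    {ι : Type*} {Q : ι → S × E → Prop} (hQ : ∀ i, Dfn (Q i)) (e : E)
    (h : ∀ t : Finset ι, ∃ x, ∀ i ∈ t, Q i (x, e)) : ∃ x, ∀ i, Q i (x, e) := by
  classical
  obtain ⟨n, hn⟩ := hM.exists_rat e
  have : (Filter.generate (Set.range fun i => {x | Q i (x, e)})).NeBot := by
    rw [Filter.generate_neBot_iff]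
    intro t ht hfin
    lift t to Finset (Set S) using hfin
    obtain ⟨t', ht'⟩ := Finset.subset_set_image_iff (s := Set.univ) (f := fun i => {x | Q i (x, e)}) (t := t) |>.1
      (by simpa using ht)
    obtain ⟨x, hx⟩ := h t'
    refine ⟨x, fun X hX => ?_⟩
    rw [Finset.mem_coe, ← ht'.2] at hX
    obtain ⟨i, hi, rfl⟩ := Finset.mem_image.1 hX
    exact hx i hi
  obtain ⟨x, hx⟩ := hM.sat n (Filter.generate (Set.range fun i => {x | Q i (x, e)}))
  exact ⟨x, fun i => hx _ (hQ i) e hn (Filter.mem_generate_of_mem ⟨i, rfl⟩)⟩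

theorem tp_ext (hM : Monster L lev)
    {b b' : B} (h : Tp b b') (x : S) : ∃ x' : S, Tp (x, b) (x', b') := by
  obtain ⟨x', hx'⟩ := hM.sat_fip (Q := fun P : {P : S × B → Prop // Dfn P ∧ P (x, b)} => P.1)
    (fun P => P.2.1) b' (by
      intro t
      have h1 : Dfn fun b : B => ∃ x : S, ∀ i : t, i.1.1 (x, b) := by
        refine .ex ?_
        exact .forall_finite fun i => i.1.2.1.comp (by fun_prop)
      obtain ⟨x', hx'⟩ := h _ h1 ⟨x, fun i => i.1.2.2⟩
      exact ⟨x', fun i hi => hx' ⟨i, hi⟩⟩)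
  exact ⟨x', fun P hP hx => hx' ⟨P, hP, hx⟩⟩

/-- A definable set invariant under equality of types over `b` is definable over `b`. -/
theorem dfn_of_invariant (hM : Monster L lev) {Z : S × E → Prop} (hZ : Dfn Z) (w : E) (b : B)
    (h : ∀ s s', Tp (s, b) (s', b) → Z (s, w) → Z (s', w)) :
    ∃ P : S × B → Prop, Dfn P ∧ ∀ s, Z (s, w) ↔ P (s, b) := by
  have h1 : ∀ s, Z (s, w) → ∃ P : S × B → Prop, Dfn P ∧ P (s, b) ∧ ∀ s', P (s', b) → Z (s', w) := by
    intro s hs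
    by_contra hcon
    push Not at hcon
    obtain ⟨s', h'⟩ := hM.sat_fip (e := (w, b))
      (Q := fun (P : {P : S × B → Prop // Dfn P ∧ P (s, b)}) (x : S × (E × B)) =>
        P.1 (x.1, x.2.2) ∧ ¬Z (x.1, x.2.1))
      (fun P => (P.2.1.comp (by fun_prop)).and (hZ.comp (f := fun x : S × (E × B) => (x.1, x.2.1)) (by fun_prop)).not) (by
        intro t
        obtain ⟨s', h1, h2⟩ := hcon (fun x => ∀ i : t, i.1.1 x) (.forall_finite fun i => i.1.2.1)
          fun i => i.1.2.2
        exact ⟨s', fun i hi => ⟨h1 ⟨i, hi⟩, h2⟩⟩)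
    exact (h' ⟨fun _ => True, .const _, trivial⟩).2 (h s s' (fun P hP hx => (h' ⟨P, hP, hx⟩).1) hs)
  by_contra hcon
  push Not at hcon
  obtain ⟨s', h'⟩ := hM.sat_fip (e := (w, b))
    (Q := fun (P : {P : S × B → Prop // Dfn P ∧ ∀ s', P (s', b) → Z (s', w)}) (x : S × (E × B)) =>
      ¬P.1 (x.1, x.2.2) ∧ Z (x.1, x.2.1))
    (fun P => (P.2.1.comp (f := fun x : S × (E × B) => (x.1, x.2.2)) (by fun_prop)).not.and (hZ.comp (by fun_prop))) (by
      intro t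
      obtain ⟨s, hs⟩ := hcon (fun x => ∃ i : t, i.1.1 x) (.exists_finite fun i => i.1.2.1)
      have h2 : (∃ i : t, i.1.1 (s, b)) → Z (s, w) := fun ⟨i, hi⟩ => i.1.2.2 s hi
      refine ⟨s, fun i hi => ?_⟩
      rcases hs with hs | hs
      · exact ⟨fun h3 => hs.2 ⟨⟨i, hi⟩, h3⟩, hs.1⟩
      · exact absurd (h2 hs.2) hs.1)
  obtain ⟨P, hP, h2, h3⟩ := h1 s' (h' ⟨fun _ => False, .const _, by simp⟩).2
  exact (h' ⟨P, hP, h3⟩).1 h2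

/-- The trace of an ultrafilter on a definable family is definable. -/
theorem exists_trace (hM : Monster L lev) {Y : S × T → Prop} (hY : Dfn Y) (p : Ultrafilter S) :
    ∃ (N : ℕ) (Z : T × (Fin N → S) → Prop), Dfn Z ∧ ∃ w, ∀ t, (∀ᶠ s in p, Y (s, t)) ↔ Z (t, w) := by
  obtain ⟨N, w, h⟩ := (hM.stab hY).exists_trace p
  refine ⟨N, fun z => {i | Y (z.2 i, z.1)} ∈ (fun t => {i | Y (w i, t)}) '' {t | ∀ᶠ s in p, Y (s, t)},
    .bool (fun i => hY.comp (by fun_prop)) _, w, fun t => ⟨fun ht => ⟨t, ht, rfl⟩, ?_⟩⟩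
  rintro ⟨t', h1, h2⟩
  exact h t' t (fun i => (Set.ext_iff.1 h2 i).1) h1

end Monster
end Benign

namespace Benign

section Tree
variable {S T : Type*}

/-- A stable relation does not admit a binary tree of nonempty sets split by instances. -/
theorem Stab.no_binary_tree {Y : S → T → Prop} (h : Stab Y) (Good : Set S → Prop)
    (h0 : Good Set.univ) (hne : ∀ X, Good X → X.Nonempty)
    (hs : ∀ X, Good X → ∃ e, Good (X ∩ {s | Y s e}) ∧ Good (X ∩ {s | ¬Y s e})) : False := by
  classical
  have hT : Nonempty T := ⟨(hs _ h0).choose⟩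
  have hS : Nonempty S := ⟨(hne _ h0).some⟩
  choose! e he1 he2 using hs
  let X : List Bool → Set S := fun σ => σ.rec Set.univ fun c _ X => X ∩ {s | Y s (e X) ↔ c = true}
  have hX : ∀ c σ, X (c :: σ) = X σ ∩ {s | Y s (e (X σ)) ↔ c = true} := fun _ _ => rfl
  have hgood : ∀ σ, Good (X σ) := by
    intro σ
    induction σ with
    | nil => exact h0
    | cons c σ ih =>
      rw [hX]
      cases c
      · simpa using he2 _ ih
      · simpa using he1 _ ih
  choose s hsX using fun σ => hne _ (hgood σ)
  let pre : (ℕ → Bool) → ℕ → List Bool := fun η n => n.rec [] fun n σ => η n :: σ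
  have hpre : ∀ η n, pre η (n + 1) = η n :: pre η n := fun _ _ => rfl
  have hanti : ∀ η, Antitone fun n => X (pre η n) := fun η => antitone_nat_of_succ_le fun n => by
    rw [hpre, hX]
    exact Set.inter_subset_left
  let p : (ℕ → Bool) → Ultrafilter (List Bool) := fun η => (Filter.hyperfilter ℕ).map (pre η)
  have hp : ∀ η n, ∀ᶠ τ in p η, s τ ∈ X (pre η n) := fun η n => by
    have : ∀ᶠ m in (Filter.hyperfilter ℕ : Filter ℕ), n ≤ m :=
      Nat.hyperfilter_le_atTop (Filter.eventually_ge_atTop n)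
    exact this.mono fun m hm => hanti η hm (hsX _)
  have hdec : ∀ η n, (∀ᶠ τ in p η, Y (s τ) (e (X (pre η n)))) ↔ η n = true := by
    intro η n
    have h1 := hp η (n + 1)
    rw [hpre, hX] at h1
    constructor
    · intro h2
      obtain ⟨τ, h3, h4⟩ := (h1.and h2).exists
      exact h3.2.1 h4
    · intro h2
      exact h1.mono fun τ hτ => hτ.2.2 h2
  choose N w hw using fun η => (h.precomp s fun σ => e (X σ)).exists_trace (p η)
  let code : (ℕ → Bool) → Σ N, (Fin N → List Bool) × Set (Set (Fin N)) := fun η =>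
    ⟨N η, w η, (fun σ => {i | Y (s (w η i)) (e (X σ))}) '' {σ | ∀ᶠ τ in p η, Y (s τ) (e (X σ))}⟩
  have hcode : ∀ η σ, (∀ᶠ τ in p η, Y (s τ) (e (X σ))) ↔
      {i | Y (s ((code η).2.1 i)) (e (X σ))} ∈ (code η).2.2 := by
    refine fun η σ => ⟨fun hσ => ⟨σ, hσ, rfl⟩, ?_⟩
    rintro ⟨σ', h1, h2⟩
    exact hw η σ' σ (fun i => (Set.ext_iff.1 h2 i).1) h1
  have hinj : Function.Injective code := by
    intro η ζ hηζ
    by_contra hne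
    have h' : ∃ n, η n ≠ ζ n := Function.ne_iff.1 hne
    have h1 : ∀ m ≤ Nat.find h', pre η m = pre ζ m := by
      intro m
      induction m with
      | zero => intro _; rfl
      | succ m ih =>
        intro hm
        rw [hpre, hpre, ih (by omega), not_not.1 (Nat.find_min h' (show m < Nat.find h' by omega))]
    refine Nat.find_spec h' ?_
    rw [Bool.eq_iff_iff, ← hdec, ← hdec, hcode, hcode, hηζ, h1 _ le_rfl]
  have : Uncountable (ℕ → Bool) := by
    rw [← not_countable_iff]
    intro hc
    obtain ⟨f, hf⟩ := exists_surjective_nat (ℕ → Bool)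
    obtain ⟨n, hn⟩ := hf fun n => !(f n n)
    have := congrFun hn n
    simp at this
  exact not_injective_uncountable_countable code hinj

end Tree

/-- A relation that holds between any two elements of the same colour, for some finite
colouring. -/
def FinIdx {S : Type*} (R : S → S → Prop) : Prop :=
  ∃ (ι : Type) (_ : Finite ι) (φ : S → ι), ∀ x y, φ x = φ y → R x y

theorem FinIdx.and {S : Type*} {R R' : S → S → Prop} (h : FinIdx R) (h' : FinIdx R') :
    FinIdx fun x y => R x y ∧ R' x y := by
  obtain ⟨ι, _, φ, hφ⟩ := h
  obtain ⟨κ, _, ψ, hψ⟩ := h'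
  refine ⟨ι × κ, inferInstance, fun x => (φ x, ψ x), fun x y h => ?_⟩
  simp only [Prod.mk.injEq] at h
  exact ⟨hφ _ _ h.1, hψ _ _ h.2⟩

theorem FinIdx.comap {S T : Type*} {R : S → S → Prop} (h : FinIdx R) (f : T → S) :
    FinIdx fun x y => R (f x) (f y) := by
  obtain ⟨ι, _, φ, hφ⟩ := h
  exact ⟨ι, inferInstance, φ ∘ f, fun x y h => hφ _ _ h⟩

theorem FinIdx.exists_reps {S : Type*} {R : S → S → Prop} (h : FinIdx R) :
    ∃ (ι : Type) (_ : Finite ι) (r : ι → S), ∀ x, ∃ i, R x (r i) := by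
  obtain ⟨ι, _, φ, hφ⟩ := h
  choose r hr using fun i : Set.range φ => i.2
  exact ⟨Set.range φ, inferInstance, r, fun x => ⟨⟨φ x, x, rfl⟩, hφ _ _ (hr ⟨φ x, x, rfl⟩).symm⟩⟩

theorem FinIdx.of_reps {S : Type*} {R : S → S → Prop} (hR : Equivalence R) {ι : Type} [Finite ι]
    (r : ι → S) (hr : ∀ x, ∃ i, R x (r i)) : FinIdx R := by
  choose φ hφ using hr
  exact ⟨ι, inferInstance, φ, fun x y h => hR.trans (hφ x) (h ▸ hR.symm (hφ y))⟩

theorem FinIdx.exists_mem {S : Type*} {R : S → S → Prop} (h : FinIdx R) (p : Ultrafilter S) :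
    ∃ x, ∀ᶠ y in p, R x y := by
  obtain ⟨ι, _, φ, hφ⟩ := h
  have h1 : ∀ᶠ y in p, ∃ i, φ y = i := .of_forall fun y => ⟨_, rfl⟩
  rw [Ultrafilter.eventually_exists_iff] at h1
  obtain ⟨i, hi⟩ := h1
  obtain ⟨x, hx⟩ := hi.exists
  exact ⟨x, hi.mono fun y hy => hφ _ _ (hx.trans hy.symm)⟩

variable {L : FirstOrder.Language.{u, u}} {C : Type u} [L.Structure C] {lev : ℕ → Set C}
variable {S T R E B : Type u} [DSort L C S] [DSort L C T] [DSort L C R] [DSort L C E] [DSort L C B]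
local notation "Dfn" => IsDfn L C
local notation "Crd" => Coord L C
local notation "Tp" => TpEq L C

/-- Predicates definable with parameters. -/
def DfnP (L : FirstOrder.Language.{u, u}) (C : Type u) [L.Structure C] [DSort L C S] (X : S → Prop) :
    Prop :=
  ∃ (E : Type u) (_ : DSort L C E) (Z : S × E → Prop), IsDfn L C Z ∧ ∃ e, ∀ s, X s ↔ Z (s, e)

theorem DfnP.and {X Y : S → Prop} (hX : DfnP L C X) (hY : DfnP L C Y) :
    DfnP L C fun s => X s ∧ Y s := by
  obtain ⟨E, _, Z, hZ, e, h⟩ := hX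
  obtain ⟨E', _, Z', hZ', e', h'⟩ := hY
  exact ⟨E × E', inferInstance, fun x => Z (x.1, x.2.1) ∧ Z' (x.1, x.2.2),
    (hZ.comp (by fun_prop)).and (hZ'.comp (by fun_prop)), (e, e'), fun s => by simp [h, h']⟩

theorem DfnP.not {X : S → Prop} (hX : DfnP L C X) : DfnP L C fun s => ¬X s := by
  obtain ⟨E, _, Z, hZ, e, h⟩ := hX
  exact ⟨E, inferInstance, _, hZ.not, e, fun s => by simp [h]⟩

theorem DfnP.iff {X Y : S → Prop} (hX : DfnP L C X) (hY : DfnP L C Y) :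
    DfnP L C fun s => X s ↔ Y s := by
  convert ((hX.and hY.not).not).and ((hY.and hX.not).not) using 2
  tauto

theorem DfnP.comp {X : T → Prop} (hX : DfnP L C X) {f : S → T} (hf : Crd f) :
    DfnP L C fun s => X (f s) := by
  obtain ⟨E, _, Z, hZ, e, h⟩ := hX
  exact ⟨E, inferInstance, fun x => Z (f x.1, x.2), hZ.comp (by fun_prop), e, fun s => h _⟩

theorem DfnP.const (s : Prop) : DfnP L C fun _ : S => s :=
  ⟨Fin 0 → S, inferInstance, _, .const s, Fin.elim0, fun _ => Iff.rfl⟩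

theorem DfnP.forall_finite {ι : Type*} [Finite ι] {X : ι → S → Prop} (h : ∀ i, DfnP L C (X i)) :
    DfnP L C fun s => ∀ i, X i s := by
  classical
  have := Fintype.ofFinite ι
  have key : ∀ t : Finset ι, DfnP L C fun s => ∀ i ∈ t, X i s := by
    intro t
    induction t using Finset.induction with
    | empty => simpa using DfnP.const (S := S) (L := L) (C := C) True
    | insert i t _ ih => simpa using (h i).and ih
  simpa using key Finset.univ

/-- `F` is a finite equivalence relation over `b`. -/
structure IsFER (L : FirstOrder.Language.{u, u}) (C : Type u) [L.Structure C] [DSort L C S]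
    [DSort L C B] (F : (S × S) × B → Prop) (b : B) : Prop where
  dfn : IsDfn L C F
  equiv : Equivalence fun x y => F ((x, y), b)
  fin : FinIdx fun x y => F ((x, y), b)

/-- Equality of strong types over `b`. -/
def StpEq (L : FirstOrder.Language.{u, u}) (C : Type u) [L.Structure C] [DSort L C S]
    [DSort L C B] (b : B) (x y : S) : Prop :=
  ∀ F : (S × S) × B → Prop, IsFER L C F b → F ((x, y), b)

local notation "FER" => IsFER L C
local notation "Stp" => StpEq L C

/-- The class of `x` modulo a FER is large, and the definition schema is almost over `b`. -/
structure IsGen (L : FirstOrder.Language.{u, u}) (C : Type u) [L.Structure C] [DSort L C S]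
    [DSort L C B] (x : S) (b : B) (p : Ultrafilter S) : Prop where
  mem : ∀ F : (S × S) × B → Prop, IsFER L C F b → ∀ᶠ s in p, F ((x, s), b)
  dfn : ∀ {E : Type u} [DSort L C E] (Y : S × E → Prop), IsDfn L C Y →
    ∃ F : (E × E) × B → Prop, IsFER L C F b ∧ ∀ e e', F ((e, e'), b) →
      ((∀ᶠ s in p, Y (s, e)) ↔ ∀ᶠ s in p, Y (s, e'))

theorem IsFER.and {F G : (S × S) × B → Prop} {b : B} (hF : FER F b) (hG : FER G b) :
    FER (fun z : (S × S) × B => F z ∧ G z) b :=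
  ⟨hF.dfn.and hG.dfn, ⟨fun x => ⟨hF.equiv.refl x, hG.equiv.refl x⟩,
    fun h => ⟨hF.equiv.symm h.1, hG.equiv.symm h.2⟩,
    fun h h' => ⟨hF.equiv.trans h.1 h'.1, hG.equiv.trans h.2 h'.2⟩⟩, hF.fin.and hG.fin⟩

theorem IsFER.true (b : B) : FER (fun _ : (S × S) × B => True) b :=
  ⟨.const _, ⟨fun _ => trivial, fun _ => trivial, fun _ _ => trivial⟩,
    Unit, inferInstance, fun _ => (), fun _ _ _ => trivial⟩

/-- The FER of having the same truth value for a predicate over `b`. -/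
theorem IsFER.of_pred {P : S × B → Prop} (hP : Dfn P) (b : B) :
    FER (fun z : (S × S) × B => P (z.1.1, z.2) ↔ P (z.1.2, z.2)) b :=
  ⟨(hP.comp (by fun_prop)).iff (hP.comp (by fun_prop)),
    ⟨fun _ => Iff.rfl, Iff.symm, Iff.trans⟩,
    Prop, inferInstance, fun s => P (s, b), fun _ _ h => iff_of_eq h⟩

theorem StpEq.tp {b : B} {x y : S} (h : Stp b x y) : Tp (x, b) (y, b) := fun _ hP hx =>
  (h _ (.of_pred hP b)).1 hx

end Benign

namespace Benign

variable {L : FirstOrder.Language.{u, u}} {C : Type u} [L.Structure C] {lev : ℕ → Set C}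
variable {S T R E B B' : Type u} [DSort L C S] [DSort L C T] [DSort L C R] [DSort L C E]
  [DSort L C B] [DSort L C B']
local notation "Dfn" => IsDfn L C
local notation "Crd" => Coord L C
local notation "Tp" => TpEq L C
local notation "FER" => IsFER L C
local notation "Stp" => StpEq L C

theorem IsFER.transport {F : (S × S) × B → Prop} {b b' : B} (hF : FER F b) (h : Tp b b') :
    FER F b' := by
  obtain ⟨h1, h2, h3⟩ := hF
  obtain ⟨ι, _, r, hr⟩ := h3.exists_reps
  have d1 : Dfn fun b : B => ∀ x, F ((x, x), b) := .all (h1.comp (by fun_prop))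
  have d2 : Dfn fun b : B => ∀ z : S × S, F ((z.1, z.2), b) → F ((z.2, z.1), b) :=
    .all ((h1.comp (by fun_prop)).imp (h1.comp (by fun_prop)))
  have d3 : Dfn fun b : B => ∀ z : S × S × S, F ((z.1, z.2.1), b) → F ((z.2.1, z.2.2), b) →
      F ((z.1, z.2.2), b) :=
    .all ((h1.comp (by fun_prop)).imp ((h1.comp (by fun_prop)).imp (h1.comp (by fun_prop))))
  have d4 : Dfn fun b : B => ∃ r : ι → S, ∀ x, ∃ i, F ((x, r i), b) :=
    .ex (.all (.exists_finite fun i => h1.comp (by fun_prop)))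
  have e1 := h _ d1 h2.refl
  have e2 := h _ d2 fun z => h2.symm
  have e3 := h _ d3 fun z => h2.trans
  obtain ⟨r', hr'⟩ := h _ d4 ⟨r, hr⟩
  have h2' : Equivalence fun x y => F ((x, y), b') :=
    ⟨e1, fun {x y} => e2 (x, y), fun {x y z} => e3 (x, y, z)⟩
  exact ⟨h1, h2', .of_reps h2' r' hr'⟩

theorem IsFER.comap {F : (S × S) × B → Prop} {b : B'} {g : B' → B} (hF : FER F (g b)) {f : T → S}
    (hf : Crd f) (hg : Crd g) :
    FER (fun z : (T × T) × B' => F ((f z.1.1, f z.1.2), g z.2)) b :=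
  ⟨hF.dfn.comp (f := fun z : (T × T) × B' => ((f z.1.1, f z.1.2), g z.2)) (by fun_prop),
    ⟨fun _ => hF.equiv.refl _, hF.equiv.symm, hF.equiv.trans⟩, hF.fin.comap f⟩

theorem IsFER.forall_finite {ι : Type*} [Finite ι] {F : ι → (S × S) × B → Prop} {b : B}
    (h : ∀ i, FER (F i) b) : FER (fun z : (S × S) × B => ∀ i, F i z) b := by
  classical
  have := Fintype.ofFinite ι
  have key : ∀ t : Finset ι, FER (fun z : (S × S) × B => ∀ i ∈ t, F i z) b := by
    intro t
    induction t using Finset.induction with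
    | empty => simpa using IsFER.true (S := S) (L := L) (C := C) b
    | insert i t _ ih => simpa using (h i).and ih
  simpa using key Finset.univ

theorem StpEq.refl (b : B) (x : S) : Stp b x x := fun _ hF => hF.equiv.refl x

theorem StpEq.symm {b : B} {x y : S} (h : Stp b x y) : Stp b y x := fun F hF =>
  hF.equiv.symm (h F hF)

theorem StpEq.trans {b : B} {x y z : S} (h : Stp b x y) (h' : Stp b y z) : Stp b x z :=
  fun F hF => hF.equiv.trans (h F hF) (h' F hF)

theorem StpEq.map {b : B} {x y : S} (h : Stp b x y) {f : S → T} {g : B → B'} (hf : Crd f)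
    (hg : Crd g) : Stp (g b) (f x) (f y) := fun _ hF => h _ (hF.comap hf hg)

theorem StpEq.transport {b b' : B} {x y x' y' : S} (h : Stp b x y)
    (ht : Tp ((x, y), b) ((x', y'), b')) : Stp b' x' y' := fun F hF =>
  ht F hF.dfn (h F (hF.transport (ht.symm.map .snd)))

/-- Strong types over `b` extend to strong types of pairs with parameters in `b`. -/
theorem StpEq.with_base {b : B} {x y : S} (h : Stp b x y) : Stp b (x, b) (y, b) := by
  intro F hF
  exact h (fun z => F (((z.1.1, z.2), (z.1.2, z.2)), z.2))
    ⟨hF.dfn.comp (f := fun z : (S × S) × B => (((z.1.1, z.2), (z.1.2, z.2)), z.2)) (by fun_prop),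
      ⟨fun _ => hF.equiv.refl _, hF.equiv.symm, hF.equiv.trans⟩, hF.fin.comap fun s => (s, b)⟩

namespace Monster

theorem exists_fer_of_invariant (hM : Monster L lev)
    {Q : S → S → Prop} (hQ : DfnP L C fun z : S × S => Q z.1 z.2)
    (he : Equivalence Q) (hfin : FinIdx Q) (b : B)
    (hinv : ∀ z z' : S × S, Tp (z, b) (z', b) → Q z.1 z.2 → Q z'.1 z'.2) :
    ∃ F, FER F b ∧ ∀ x y, F ((x, y), b) ↔ Q x y := by
  obtain ⟨W, _, Z, hZ, w, hw⟩ := hQ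
  obtain ⟨P, hP, h⟩ := hM.dfn_of_invariant hZ w b fun s s' ht hs => (hw s').1
    (hinv s s' ht.symm.symm ((hw s).2 hs))
  have h' : (fun x y => P ((x, y), b)) = Q := by
    funext x y
    exact propext ((h (x, y)).symm.trans (hw (x, y)).symm)
  exact ⟨P, ⟨hP, h' ▸ he, h' ▸ hfin⟩, fun x y => by rw [← h']⟩

/-- Strong types extend. -/
theorem stp_ext (hM : Monster L lev)
    {b : B} {y y' : T} (h : Stp b y y') (x : S) : ∃ x', Stp b (x, y) (x', y') := by
  obtain ⟨x', hx'⟩ := hM.sat_fip (S := S)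
    (Q := fun F : {F : ((S × T) × (S × T)) × B → Prop // FER F b} =>
      fun z : S × (S × T) × T × B => F.1 ((z.2.1, (z.1, z.2.2.1)), z.2.2.2))
    (fun F => F.2.dfn.comp (by fun_prop)) ((x, y), y', b) (by
      intro t
      have hG : FER (fun z => ∀ F : t, F.1.1 z) b := .forall_finite fun F => F.1.2
      set G : ((S × T) × (S × T)) × B → Prop := fun z => ∀ F : t, F.1.1 z
      have hH : FER (fun z : (T × T) × B => (∀ u : S, ∃ v : S, G (((u, z.1.1), (v, z.1.2)), z.2)) ∧
          ∀ u : S, ∃ v : S, G (((u, z.1.2), (v, z.1.1)), z.2)) b := by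
        refine ⟨.and ?_ ?_, ⟨?_, ?_, ?_⟩, ?_⟩
        · exact .all (.ex (hG.dfn.comp (by fun_prop)))
        · exact .all (.ex (hG.dfn.comp (by fun_prop)))
        · exact fun x => ⟨fun u => ⟨u, hG.equiv.refl _⟩, fun u => ⟨u, hG.equiv.refl _⟩⟩
        · exact fun h => ⟨h.2, h.1⟩
        · rintro x y z ⟨h1, h2⟩ ⟨h3, h4⟩
          refine ⟨fun u => ?_, fun u => ?_⟩
          · obtain ⟨v, hv⟩ := h1 u
            obtain ⟨v', hv'⟩ := h3 v
            exact ⟨v', hG.equiv.trans hv hv'⟩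
          · obtain ⟨v, hv⟩ := h4 u
            obtain ⟨v', hv'⟩ := h2 v
            exact ⟨v', hG.equiv.trans hv hv'⟩
        · obtain ⟨ι, _, φ, hφ⟩ := hG.fin
          refine ⟨Set ι, inferInstance, fun y => {i | ∃ u, φ (u, y) = i}, fun y y' hyy' => ⟨fun u => ?_, fun u => ?_⟩⟩
          · obtain ⟨v, hv⟩ := (Set.ext_iff.1 hyy' (φ (u, y))).1 ⟨u, rfl⟩
            exact ⟨v, hφ _ _ hv.symm⟩
          · obtain ⟨v, hv⟩ := (Set.ext_iff.1 hyy' (φ (u, y'))).2 ⟨u, rfl⟩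
            exact ⟨v, hφ _ _ hv.symm⟩
      obtain ⟨x', hx'⟩ := (h _ hH).1 x
      exact ⟨x', fun F hF => hx' ⟨F, hF⟩⟩)
  exact ⟨x', fun F hF => hx' ⟨F, hF⟩⟩

end Monster

section Generic
variable {x : S} {b : B}

/-- The filter of the complete type of `x` over `b`. -/
def typeFilter (L : FirstOrder.Language.{u, u}) (C : Type u) [L.Structure C] [DSort L C S]
    [DSort L C B] (x : S) (b : B) : Filter S where
  sets := {X | ∃ P : S × B → Prop, IsDfn L C P ∧ P (x, b) ∧ ∀ s, P (s, b) → s ∈ X}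
  univ_sets := ⟨fun _ => True, .const _, trivial, fun _ _ => trivial⟩
  sets_of_superset := by
    rintro X Y ⟨P, h1, h2, h3⟩ h
    exact ⟨P, h1, h2, fun s hs => h (h3 s hs)⟩
  inter_sets := by
    rintro X Y ⟨P, h1, h2, h3⟩ ⟨P', h1', h2', h3'⟩
    exact ⟨_, h1.and h1', ⟨h2, h2'⟩, fun s hs => ⟨h3 s hs.1, h3' s hs.2⟩⟩

/-- A filter whose trace on definable sets is invariant under conjugation over `b`. -/
def InvFilter (L : FirstOrder.Language.{u, u}) (C : Type u) [L.Structure C] [DSort L C S]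
    [DSort L C B] (b : B) (ℱ : Filter S) : Prop :=
  ∀ {E : Type u} [DSort L C E] {Y : S × E → Prop}, IsDfn L C Y → ∀ {e e' : E},
    TpEq L C (e, b) (e', b) → (∀ᶠ s in ℱ, Y (s, e)) → ∀ᶠ s in ℱ, Y (s, e')

end Generic
end Benign

namespace Benign

variable {L : FirstOrder.Language.{u, u}} {C : Type u} [L.Structure C] {lev : ℕ → Set C}
variable {S T R E B B' : Type u} [DSort L C S] [DSort L C T] [DSort L C R] [DSort L C E]
  [DSort L C B] [DSort L C B']
local notation "Dfn" => IsDfn L C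
local notation "Crd" => Coord L C
local notation "Tp" => TpEq L C
local notation "FER" => IsFER L C
local notation "Stp" => StpEq L C

theorem exists_minimal_filter {S : Type*} (p : Filter S → Prop)
    (hp : ∀ c : Set (Filter S), c.Nonempty → IsChain (· ≤ ·) c → (∀ ℱ ∈ c, ℱ.NeBot ∧ p ℱ) →
      p (sInf c))
    (ℱ : Filter S) (h : ℱ.NeBot) (h' : p ℱ) :
    ∃ 𝒢 ≤ ℱ, 𝒢.NeBot ∧ p 𝒢 ∧ ∀ ℋ ≤ 𝒢, ℋ.NeBot → p ℋ → 𝒢 ≤ ℋ := by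
  obtain ⟨m, hm1, hm2⟩ := zorn_le_nonempty₀ (α := (Filter S)ᵒᵈ)
    {𝒢 | (OrderDual.ofDual 𝒢).NeBot ∧ p (OrderDual.ofDual 𝒢)} (by
      intro c hc hchain y hy
      have hchain' : IsChain (· ≤ ·) (OrderDual.toDual ⁻¹' c) := hchain.symm
      have hne : (sInf (OrderDual.toDual ⁻¹' c)).NeBot := by
        refine Filter.sInf_neBot_of_directed' ⟨y, hy⟩ ?_ fun hb => (hc hb).1.ne rfl
        exact (hchain.directedOn : _)
      exact ⟨OrderDual.toDual (sInf (OrderDual.toDual ⁻¹' c)),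
        ⟨hne, hp _ ⟨y, hy⟩ hchain' fun ℱ hℱ => hc hℱ⟩, fun z hz => sInf_le (α := Filter S) hz⟩)
    (OrderDual.toDual ℱ) ⟨h, h'⟩
  exact ⟨OrderDual.ofDual m, hm1, hm2.1.1, hm2.1.2, fun ℋ h1 h2 h3 => hm2.2 (y := OrderDual.toDual ℋ) ⟨h2, h3⟩ h1⟩

section Generic
variable {x : S} {b : B}

theorem invFilter_typeFilter : InvFilter L C b (typeFilter L C x b) := by
  rintro E _ Y hY e e' h ⟨P, h1, h2, h3⟩
  have : Dfn fun z : E × B => ∀ s : S, P (s, z.2) → Y (s, z.1) :=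
    .all ((h1.comp (f := fun z : (E × B) × S => (z.2, z.1.2)) (by fun_prop)).imp
      (hY.comp (f := fun z : (E × B) × S => (z.2, z.1.1)) (by fun_prop)))
  exact ⟨P, h1, h2, h _ this h3⟩

instance : (typeFilter L C x b).NeBot := by
  rw [← Filter.forall_mem_nonempty_iff_neBot]
  rintro X ⟨P, -, h1, h2⟩
  exact ⟨x, h2 x h1⟩

/-- Minimality among invariant filters. -/
def MinInv (L : FirstOrder.Language.{u, u}) (C : Type u) [L.Structure C] [DSort L C S]
    [DSort L C B] (b : B) (ℱ : Filter S) : Prop :=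
  ℱ.NeBot ∧ InvFilter L C b ℱ ∧ ∀ ℋ ≤ ℱ, ℋ.NeBot → InvFilter L C b ℋ → ℱ ≤ ℋ

theorem exists_minInv (x : S) (b : B) : ∃ ℱ ≤ typeFilter L C x b, MinInv L C b ℱ := by
  obtain ⟨𝒢, h1, h2, h3, h4⟩ := exists_minimal_filter (InvFilter L C b) (by
    intro c hne hc h
    have hmem : ∀ {X : Set S}, X ∈ sInf c ↔ ∃ ℱ ∈ c, X ∈ ℱ := by
      have := hne.to_subtype
      intro X
      rw [sInf_eq_iInf', Filter.mem_iInf_of_directed fun i j => (hc.total i.2 j.2).elim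
        (fun h => ⟨i, le_rfl, h⟩) fun h => ⟨j, h, le_rfl⟩]
      simp
    intro E _ Y hY e e' ht hs
    obtain ⟨ℱ, hℱ, h5⟩ := hmem.1 hs
    exact hmem.2 ⟨ℱ, hℱ, (h ℱ hℱ).2 hY ht h5⟩) (typeFilter L C x b) inferInstance
    invFilter_typeFilter
  exact ⟨𝒢, h1, h2, h3, h4⟩

namespace Monster

theorem exists_deciding (hM : Monster L lev)
    {ℱ : Filter S} (hF : MinInv L C b ℱ) {Y : S × E → Prop} (hY : Dfn Y) :
    ∃ (W : Type u) (_ : DSort L C W) (Z : S × W → Prop), Dfn Z ∧ ∃ w,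
      (∃ᶠ s in ℱ, Z (s, w)) ∧ ∀ e, (∀ᶠ s in ℱ, Z (s, w) → Y (s, e)) ∨
        ∀ᶠ s in ℱ, Z (s, w) → ¬Y (s, e) := by
  have := hF.1
  by_contra hcon
  push Not at hcon
  refine (hM.stab hY).no_binary_tree (fun X => (∃ (W : Type u) (_ : DSort L C W) (Z : S × W → Prop),
    Dfn Z ∧ ∃ w, ∀ s, s ∈ X ↔ Z (s, w)) ∧ ∃ᶠ s in ℱ, s ∈ X) ?_ ?_ ?_
  · exact ⟨⟨Fin 0 → S, inferInstance, fun _ => True, .const _, Fin.elim0, by simp⟩, by simpa using hF.1⟩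
  · rintro X ⟨-, h⟩
    exact h.exists
  · rintro X ⟨⟨W, _, Z, hZ, w, hw⟩, h⟩
    obtain ⟨e, h1, h2⟩ := hcon W _ Z hZ w (by simpa only [hw] using h)
    refine ⟨e, ⟨⟨W × E, inferInstance, fun z => Z (z.1, z.2.1) ∧ Y (z.1, z.2.2),
      (hZ.comp (by fun_prop)).and (hY.comp (by fun_prop)), (w, e), fun s => and_congr_left' (hw s)⟩, ?_⟩,
      ⟨W × E, inferInstance, fun z => Z (z.1, z.2.1) ∧ ¬Y (z.1, z.2.2),
      (hZ.comp (by fun_prop)).and (hY.not.comp (f := fun z : S × W × E => (z.1, z.2.2)) (by fun_prop)), (w, e), fun s => and_congr_left' (hw s)⟩, ?_⟩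
    · simpa only [Set.mem_inter_iff, hw] using h2.mono fun s hs => by simpa using hs
    · simpa only [Set.mem_inter_iff, hw] using h1.mono fun s hs => by simpa using hs

theorem exists_deciding_cover (hM : Monster L lev)
    {ℱ : Filter S} (hF : MinInv L C b ℱ) {Y : S × E → Prop} (hY : Dfn Y) :
    ∃ (W : Type u) (_ : DSort L C W) (Z : S × W → Prop) (ι : Type) (_ : Finite ι) (w : ι → W),
      Dfn Z ∧ (∀ i, ∃ᶠ s in ℱ, Z (s, w i)) ∧ (∀ᶠ s in ℱ, ∃ i, Z (s, w i)) ∧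
        ∀ i e, (∀ᶠ s in ℱ, Z (s, w i) → Y (s, e)) ∨ ∀ᶠ s in ℱ, Z (s, w i) → ¬Y (s, e) := by
  obtain ⟨W, _, Z, hZ, w, h1, h2⟩ := hM.exists_deciding hF hY
  obtain ⟨hne, hinv, hmin⟩ := hF
  let 𝒢 : Filter S :=
    { sets := {X | ∃ (ι : Type) (_ : Finite ι) (v : ι → W), (∀ i, Tp (v i, b) (w, b)) ∧
        ∀ᶠ s in ℱ, (∀ i, ¬Z (s, v i)) → s ∈ X}
      univ_sets := ⟨Fin 0, inferInstance, Fin.elim0, fun i => i.elim0, by simp⟩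
      sets_of_superset := by
        rintro X Y ⟨ι, hι, v, hv, h⟩ hXY
        exact ⟨ι, hι, v, hv, h.mono fun s hs h' => hXY (hs h')⟩
      inter_sets := by
        rintro X Y ⟨ι, hι, v, hv, h⟩ ⟨ι', hι', v', hv', h'⟩
        refine ⟨ι ⊕ ι', inferInstance, Sum.elim v v', ?_, ?_⟩
        · rintro (i | i)
          exacts [hv i, hv' i]
        · filter_upwards [h, h'] with s hs hs' hall
          exact ⟨hs fun i => hall (Sum.inl i), hs' fun i => hall (Sum.inr i)⟩ }
  have hG : ∀ {X : Set S}, X ∈ 𝒢 ↔ ∃ (ι : Type) (_ : Finite ι) (v : ι → W),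
      (∀ i, Tp (v i, b) (w, b)) ∧ ∀ᶠ s in ℱ, (∀ i, ¬Z (s, v i)) → s ∈ X := Iff.rfl
  have hbot : ¬𝒢.NeBot := by
    intro hne'
    have hle : ℱ ≤ 𝒢 := by
      refine hmin 𝒢 (fun X hX => hG.2 ⟨Fin 0, inferInstance, Fin.elim0, fun i => i.elim0,
        Filter.mem_of_superset hX fun s hs _ => hs⟩) hne' ?_
      rintro E' _ Y' hY' e e' ht hs
      obtain ⟨ι, hι, v, hv, h⟩ := hG.1 hs
      obtain ⟨v', hv'⟩ := hM.tp_ext ht v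
      refine hG.2 ⟨ι, hι, v', fun i => ?_, ?_⟩
      · exact (hv'.map (f := fun z : (ι → W) × E' × B => (z.1 i, z.2.2)) (by fun_prop)).symm.trans (hv i)
      · have hd : Dfn fun z : S × (ι → W) × E' => (∀ i, ¬Z (z.1, z.2.1 i)) → Y' (z.1, z.2.2) :=
          .imp (.forall_finite fun i => (hZ.comp (f := fun z : S × (ι → W) × E' => (z.1, z.2.1 i)) (by fun_prop)).not) (hY'.comp (by fun_prop))
        exact hinv hd (hv'.map (f := fun z : (ι → W) × E' × B => ((z.1, z.2.1), z.2.2)) (by fun_prop)) h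
    refine h1 (hle (hG.2 ⟨Unit, inferInstance, fun _ => w, fun _ => .refl _, .of_forall fun s hs => ?_⟩))
    exact hs ()
  rw [Filter.not_neBot, ← Filter.empty_mem_iff_bot] at hbot
  obtain ⟨ι, hι, v, hv, h⟩ := hG.1 hbot
  refine ⟨W, inferInstance, Z, ι, hι, v, hZ, fun i => ?_, ?_, fun i e => ?_⟩
  · intro h'
    exact h1 (hinv hZ.not (hv i) h')
  · exact h.mono fun s hs => by simpa using hs
  · obtain ⟨e', he'⟩ := hM.tp_ext (hv i) e
    have ht := (he'.map (f := fun z : E × W × B => ((z.2.1, z.1), z.2.2)) (by fun_prop)).symm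
    have d1 : Dfn fun z : S × W × E => Z (z.1, z.2.1) → Y (z.1, z.2.2) :=
      (hZ.comp (by fun_prop)).imp (hY.comp (by fun_prop))
    have d2 : Dfn fun z : S × W × E => Z (z.1, z.2.1) → ¬Y (z.1, z.2.2) :=
      (hZ.comp (by fun_prop)).imp (hY.comp (f := fun z : S × W × E => (z.1, z.2.2)) (by fun_prop)).not
    exact (h2 e').imp (hinv d1 ht) (hinv d2 ht)

theorem exists_fer_of_minInv (hM : Monster L lev)
    {ℱ : Filter S} (hF : MinInv L C b ℱ) {Y : S × E → Prop} (hY : Dfn Y) :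
    ∃ F, FER F b ∧ ∀ e e', F ((e, e'), b) ↔ ∀ᶠ s in ℱ, (Y (s, e) ↔ Y (s, e')) := by
  obtain ⟨W, _, Z, ι, _, w, hZ, h1, h2, h3⟩ := hM.exists_deciding_cover hF hY
  obtain ⟨hne, hinv, hmin⟩ := hF
  have key : ∀ e e', (∀ i, (∀ᶠ s in ℱ, Z (s, w i) → Y (s, e)) ↔ ∀ᶠ s in ℱ, Z (s, w i) → Y (s, e')) →
      ∀ᶠ s in ℱ, (Y (s, e) ↔ Y (s, e')) := by
    intro e e' h
    have h4 : ∀ i, ∀ᶠ s in ℱ, Z (s, w i) → (Y (s, e) ↔ Y (s, e')) := by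
      intro i
      by_cases h5 : ∀ᶠ s in ℱ, Z (s, w i) → Y (s, e)
      · filter_upwards [h5, (h i).1 h5] with s hs hs' hz
        exact iff_of_true (hs hz) (hs' hz)
      · filter_upwards [(h3 i e).resolve_left h5, (h3 i e').resolve_left (mt (h i).2 h5)] with s hs hs' hz
        exact iff_of_false (hs hz) (hs' hz)
    filter_upwards [h2, Filter.eventually_all.2 h4] with s ⟨i, hi⟩ hs
    exact hs i hi
  have hex : ∀ i, ∃ p : Ultrafilter S, (p : Filter S) ≤ ℱ ∧ ∀ᶠ s in p, Z (s, w i) := by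
    intro i
    have : (ℱ ⊓ Filter.principal {s | Z (s, w i)}).NeBot := Filter.inf_principal_neBot_iff.2
      fun U hU => ((h1 i).and_eventually hU).exists.imp fun s hs => ⟨hs.2, hs.1⟩
    exact ⟨Ultrafilter.of _, (Ultrafilter.of_le _).trans inf_le_left,
      (Ultrafilter.of_le _).trans inf_le_right (Filter.mem_principal_self _)⟩
  choose p hp1 hp2 using hex
  have key2 : ∀ i e, (∀ᶠ s in p i, Y (s, e)) ↔ ∀ᶠ s in ℱ, Z (s, w i) → Y (s, e) := by
    refine fun i e => ⟨fun h => (h3 i e).resolve_right fun h' => ?_, fun h => ?_⟩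
    · obtain ⟨s, h4, h5, h6⟩ := (h.and ((hp2 i).and (hp1 i h'))).exists
      exact h6 h5 h4
    · filter_upwards [hp1 i h, hp2 i] with s hs hs'
      exact hs hs'
  have key3 : (fun e e' => ∀ᶠ s in ℱ, (Y (s, e) ↔ Y (s, e'))) = fun e e' =>
      ∀ i, (∀ᶠ s in p i, Y (s, e)) ↔ ∀ᶠ s in p i, Y (s, e') := by
    funext e e'
    refine propext ⟨fun h i => ?_, fun h => key e e' fun i => by rw [← key2, ← key2]; exact h i⟩
    exact Filter.eventually_congr (hp1 i h)
  refine hM.exists_fer_of_invariant (Q := fun e e' => ∀ᶠ s in ℱ, (Y (s, e) ↔ Y (s, e'))) ?_ ?_ ?_ b ?_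
  · rw [show (fun z : E × E => ∀ᶠ s in ℱ, (Y (s, z.1) ↔ Y (s, z.2))) = fun z =>
      ∀ i, (∀ᶠ s in p i, Y (s, z.1)) ↔ ∀ᶠ s in p i, Y (s, z.2) from
        funext fun z => congrFun (congrFun key3 z.1) z.2]
    refine .forall_finite fun i => ?_
    obtain ⟨N, Z', hZ', w', hw'⟩ := hM.exists_trace hY (p i)
    have : DfnP L C fun e => ∀ᶠ s in p i, Y (s, e) := ⟨_, _, Z', hZ', w', hw'⟩
    exact (this.comp Coord.fst).iff (this.comp Coord.snd)
  · exact ⟨fun e => .of_forall fun s => Iff.rfl, fun h => h.mono fun s => Iff.symm,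
      fun h h' => (h.and h').mono fun s hs => hs.1.trans hs.2⟩
  · refine ⟨Set ι, inferInstance, fun e => {i | ∀ᶠ s in ℱ, Z (s, w i) → Y (s, e)}, fun e e' h => ?_⟩
    exact key e e' fun i => Set.ext_iff.1 h i
  · intro z z' ht h
    have d : Dfn fun v : S × E × E => (Y (v.1, v.2.1) ↔ Y (v.1, v.2.2)) :=
      (hY.comp (by fun_prop)).iff (hY.comp (by fun_prop))
    exact hinv d ht h

/-- Nonforking extensions to the whole structure exist. -/
theorem exists_gen (hM : Monster L lev) (x : S) (b : B) : ∃ p : Ultrafilter S, IsGen L C x b p := by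
  obtain ⟨ℱ, hle, hF⟩ := exists_minInv (L := L) (C := C) x b
  obtain ⟨hne, hinv, -⟩ := id hF
  have h1 : ∀ F : (S × S) × B → Prop, FER F b → ¬∀ᶠ s in ℱ, ¬F ((x, s), b) := by
    intro F hFE h
    obtain ⟨ι, _, r, hr⟩ := hFE.fin.exists_reps
    have h2 : ∀ x', Tp (x, b) (x', b) → ∀ᶠ s in ℱ, ¬F ((x', s), b) := fun x' hx' =>
      hinv (Y := fun z : S × S × B => ¬F ((z.2.1, z.1), z.2.2)) (hFE.dfn.comp (f := fun z : S × S × B => ((z.2.1, z.1), z.2.2)) (by fun_prop)).not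
        (e := (x, b)) (e' := (x', b)) (hx'.map (f := fun z : S × B => (z, z.2)) (by fun_prop)) h
    let U : S → Prop := fun s => ∃ x', Tp (x, b) (x', b) ∧ F ((x', s), b)
    have hU : ∀ s, U s ↔ ∃ i, U (r i) ∧ F ((r i, s), b) := by
      refine fun s => ⟨?_, ?_⟩
      · rintro ⟨x', h3, h4⟩
        obtain ⟨i, hi⟩ := hr s
        exact ⟨i, ⟨x', h3, hFE.equiv.trans h4 hi⟩, hFE.equiv.symm hi⟩
      · rintro ⟨i, ⟨x', h3, h4⟩, h5⟩
        exact ⟨x', h3, hFE.equiv.trans h4 h5⟩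
    have hd : Dfn fun z : S × (ι → S) × B => ∃ i, U (r i) ∧ F ((z.2.1 i, z.1), z.2.2) :=
      .exists_finite fun i => (IsDfn.const _).and (hFE.dfn.comp (by fun_prop))
    obtain ⟨P, hP, hPU⟩ := hM.dfn_of_invariant hd (r, b) b (by
      intro s s' ht hs
      obtain ⟨x', h3, h4⟩ := (hU s).2 hs
      refine (hU s').1 ?_
      obtain ⟨x'', hx''⟩ := hM.tp_ext ht x'
      exact ⟨x'', h3.trans (hx''.map (f := fun z : S × S × B => (z.1, z.2.2)) (by fun_prop)),
        hx''.map (f := fun z : S × S × B => ((z.1, z.2.1), z.2.2)) (by fun_prop) _ hFE.dfn h4⟩)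
    have h3 : ∀ᶠ s in ℱ, U s := hle ⟨P, hP, (hPU x).1 ((hU x).1 ⟨x, .refl _, hFE.equiv.refl x⟩),
      fun s hs => (hU s).2 ((hPU s).2 hs)⟩
    have h4 : ∀ i, ∀ᶠ s in ℱ, U (r i) → ¬F ((r i, s), b) := by
      intro i
      by_cases hi : U (r i)
      · obtain ⟨x', h5, h6⟩ := hi
        exact (h2 x' h5).mono fun s hs _ h7 => hs (hFE.equiv.trans h6 h7)
      · exact .of_forall fun s h => absurd h hi
    obtain ⟨s, hs, hs'⟩ := (h3.and (Filter.eventually_all.2 h4)).exists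
    obtain ⟨i, hi, hi'⟩ := (hU s).1 hs
    exact hs' i hi hi'
  let 𝒟 : Filter S :=
    { sets := {X | ∃ F : (S × S) × B → Prop, FER F b ∧ ∀ s, F ((x, s), b) → s ∈ X}
      univ_sets := ⟨_, .true b, by simp⟩
      sets_of_superset := by
        rintro X Y ⟨F, h, h'⟩ hXY
        exact ⟨F, h, fun s hs => hXY (h' s hs)⟩
      inter_sets := by
        rintro X Y ⟨F, h, h'⟩ ⟨F', h1, h1'⟩
        exact ⟨_, h.and h1, fun s hs => ⟨h' s hs.1, h1' s hs.2⟩⟩ }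
  have : (ℱ ⊓ 𝒟).NeBot := by
    rw [Filter.inf_neBot_iff]
    rintro U hU V ⟨F, hFE, hFV⟩
    by_contra hcon
    refine h1 F hFE (Filter.mem_of_superset hU fun s hs hF => hcon ⟨s, hs, hFV s hF⟩)
  have hp := Ultrafilter.of_le (ℱ ⊓ 𝒟)
  refine ⟨Ultrafilter.of (ℱ ⊓ 𝒟), fun F hFE => ?_, fun Y hY => ?_⟩
  · exact (hp.trans inf_le_right) ⟨F, hFE, fun s hs => hs⟩
  · obtain ⟨F, hFE, h⟩ := hM.exists_fer_of_minInv hF hY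
    exact ⟨F, hFE, fun e e' hee' => Filter.eventually_congr ((hp.trans inf_le_left) ((h e e').1 hee'))⟩

end Monster
end Generic
end Benign

namespace Benign

variable {L : FirstOrder.Language.{u, u}} {C : Type u} [L.Structure C] {lev : ℕ → Set C}
variable {S T R E B B' : Type u} [DSort L C S] [DSort L C T] [DSort L C R] [DSort L C E]
  [DSort L C B] [DSort L C B']
local notation "Dfn" => IsDfn L C
local notation "Crd" => Coord L C
local notation "Tp" => TpEq L C
local notation "FER" => IsFER L C
local notation "Stp" => StpEq L C

section Dcl

/-- `b'` is definable over `b`. -/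
def Dcl (L : FirstOrder.Language.{u, u}) (C : Type u) [L.Structure C] [DSort L C B] [DSort L C B']
    (b : B) (b' : B') : Prop :=
  ∃ Γ : B × B' → Prop, IsDfn L C Γ ∧ Γ (b, b') ∧ ∀ b'', Γ (b, b'') → b'' = b'

theorem Coord.dcl {f : B → B'} (hf : Crd f) (b : B) : Dcl L C b (f b) :=
  ⟨fun z => f z.1 = z.2, .eq (by fun_prop) (by fun_prop), rfl, fun _ h => h.symm⟩

theorem Dcl.trans {b : B} {b' : B'} {e : E} (h : Dcl L C b b') (h' : Dcl L C b' e) :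
    Dcl L C b e := by
  obtain ⟨Γ, h1, h2, h3⟩ := h
  obtain ⟨Δ, h4, h5, h6⟩ := h'
  refine ⟨fun z => ∃ y, Γ (z.1, y) ∧ Δ (y, z.2), .ex ((h1.comp (by fun_prop)).and (h4.comp (by fun_prop))),
    ⟨b', h2, h5⟩, ?_⟩
  rintro e' ⟨y, h7, h8⟩
  rw [h3 y h7] at h8
  exact h6 _ h8

theorem Dcl.mk {b : B} {e : E} {t : T} (h : Dcl L C b e) (h' : Dcl L C b t) :
    Dcl L C b (e, t) := by
  obtain ⟨Γ, h1, h2, h3⟩ := h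
  obtain ⟨Δ, h4, h5, h6⟩ := h'
  exact ⟨fun z => Γ (z.1, z.2.1) ∧ Δ (z.1, z.2.2), (h1.comp (by fun_prop)).and (h4.comp (by fun_prop)),
    ⟨h2, h5⟩, fun z hz => Prod.ext (h3 _ hz.1) (h6 _ hz.2)⟩

/-- Predicates over `b'` are predicates over `b`. -/
theorem Dcl.exists_dfn {b : B} {b' : B'} (h : Dcl L C b b') {P : S × B' → Prop} (hP : Dfn P) :
    ∃ P' : S × B → Prop, Dfn P' ∧ ∀ s, P' (s, b) ↔ P (s, b') := by
  obtain ⟨Γ, h1, h2, h3⟩ := h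
  refine ⟨fun z => ∃ y, Γ (z.2, y) ∧ P (z.1, y), .ex ((h1.comp (by fun_prop)).and (hP.comp (by fun_prop))),
    fun s => ⟨?_, fun hs => ⟨b', h2, hs⟩⟩⟩
  rintro ⟨y, h7, h8⟩
  rwa [h3 y h7] at h8

theorem IsFER.of_dcl {b : B} {b' : B'} (h : Dcl L C b b') {F : (S × S) × B' → Prop}
    (hF : FER F b') : ∃ F', FER F' b ∧ ∀ z, F' (z, b) ↔ F (z, b') := by
  obtain ⟨F', h1, h2⟩ := h.exists_dfn hF.dfn
  have : (fun x y => F ((x, y), b')) = fun x y => F' ((x, y), b) := by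
    funext x y
    exact propext (h2 (x, y)).symm
  exact ⟨F', ⟨h1, this ▸ hF.equiv, this ▸ hF.fin⟩, h2⟩

theorem StpEq.of_dcl {b : B} {b' : B'} (h : Dcl L C b b') {x y : S} (hs : Stp b x y) :
    Stp b' x y := fun F hF => by
  obtain ⟨F', h1, h2⟩ := hF.of_dcl h
  exact (h2 _).1 (hs F' h1)

theorem IsGen.of_dcl {b : B} {b' : B'} (h : Dcl L C b b') (h' : Dcl L C b' b) {x : S}
    {p : Ultrafilter S} (hp : IsGen L C x b p) : IsGen L C x b' p := by
  refine ⟨fun F hF => ?_, fun Y hY => ?_⟩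
  · obtain ⟨F', h1, h2⟩ := hF.of_dcl h
    exact (hp.mem F' h1).mono fun s hs => (h2 _).1 hs
  · obtain ⟨F, h1, h2⟩ := hp.dfn Y hY
    obtain ⟨F', h3, h4⟩ := h1.of_dcl h'
    exact ⟨F', h3, fun e e' he => h2 e e' ((h4 _).1 he)⟩

theorem IsFER.with_base {F : ((S × B) × (S × B)) × B → Prop} {b : B} (hF : FER F b) :
    FER (fun z : (S × S) × B => F (((z.1.1, z.2), (z.1.2, z.2)), z.2)) b :=
  ⟨hF.dfn.comp (f := fun z : (S × S) × B => (((z.1.1, z.2), (z.1.2, z.2)), z.2)) (by fun_prop),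
    ⟨fun _ => hF.equiv.refl _, hF.equiv.symm, hF.equiv.trans⟩, hF.fin.comap fun s => (s, b)⟩

/-- Strong types over `(b, c)` give strong types of pairs with `c` over `b`. -/
theorem StpEq.pair {b : B} {c : E} {x y : S} (h : Stp (b, c) x y) : Stp b (x, c) (y, c) := by
  intro F hF
  exact h (fun z => F (((z.1.1, z.2.2), (z.1.2, z.2.2)), z.2.1))
    ⟨hF.dfn.comp (f := fun z : (S × S) × (B × E) => (((z.1.1, z.2.2), (z.1.2, z.2.2)), z.2.1)) (by fun_prop),
      ⟨fun _ => hF.equiv.refl _, hF.equiv.symm, hF.equiv.trans⟩, hF.fin.comap fun s => (s, c)⟩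

end Dcl

/-- A nonforking global extension of the strong type of `x` over `b`. -/
noncomputable def gen (L : FirstOrder.Language.{u, u}) (C : Type u) [L.Structure C] [DSort L C S]
    [DSort L C B] (x : S) (b : B) : Ultrafilter S :=
  haveI : Nonempty (Ultrafilter S) := ⟨pure x⟩
  Classical.epsilon fun p => IsGen L C x b p

/-- The definition schema of the nonforking extension. -/
def DefSch (L : FirstOrder.Language.{u, u}) (C : Type u) [L.Structure C] [DSort L C S]
    [DSort L C B] (x : S) (b : B) (Y : S × E × B → Prop) (e : E) : Prop :=
  ∀ᶠ s in gen L C x b, Y (s, e, b)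

/-- Independence. -/
def Indep (L : FirstOrder.Language.{u, u}) (C : Type u) [L.Structure C] [DSort L C S]
    [DSort L C B] [DSort L C E] (x : S) (b : B) (e : E) : Prop :=
  ∀ Y : S × E × B → Prop, IsDfn L C Y → (Y (x, e, b) ↔ DefSch L C x b Y e)

local notation "DS" => DefSch L C
local notation "Ind" => Indep L C

theorem IsGen.of_stp {x x' : S} {b : B} {p : Ultrafilter S} (hp : IsGen L C x b p)
    (h : Stp b x x') : IsGen L C x' b p :=
  ⟨fun F hF => (hp.mem F hF).mono fun _ hs => hF.equiv.trans (hF.equiv.symm (h F hF)) hs, hp.dfn⟩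

theorem DefSch.not {x : S} {b : B} {Y : S × E × B → Prop} {e : E} :
    DS x b (fun z => ¬Y z) e ↔ ¬DS x b Y e := Ultrafilter.eventually_not

namespace Monster

theorem gen_spec (hM : Monster L lev) (x : S) (b : B) : IsGen L C x b (gen L C x b) :=
  @Classical.epsilon_spec _ (fun p => IsGen L C x b p) (hM.exists_gen x b)

theorem gen_symm (hM : Monster L lev)
    {x : S} {e : E} {b : B} {p : Ultrafilter S} {r : Ultrafilter E}
    (hp : IsGen L C x b p) (hr : IsGen L C e b r) {Y : S × E × B → Prop} (hY : Dfn Y) :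
    (∀ᶠ s in p, Y (s, e, b)) ↔ ∀ᶠ e' in r, Y (x, e', b) := by
  obtain ⟨F, hF, h1⟩ := hp.dfn Y hY
  obtain ⟨G, hG, h2⟩ := hr.dfn (fun z : E × S × B => Y (z.2.1, z.1, z.2.2)) (hY.comp (by fun_prop))
  have h3 : (∀ᶠ s in p, Y (s, e, b)) ↔ ∀ᶠ e' in r, ∀ᶠ s in p, Y (s, e', b) := by
    have : ∀ᶠ e' in r, ((∀ᶠ s in p, Y (s, e, b)) ↔ ∀ᶠ s in p, Y (s, e', b)) :=
      (hr.mem _ hF.with_base).mono fun e' he' => h1 _ _ he'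
    rw [← Filter.eventually_congr this]
    simp
  have h4 : (∀ᶠ e' in r, Y (x, e', b)) ↔ ∀ᶠ s in p, ∀ᶠ e' in r, Y (s, e', b) := by
    have : ∀ᶠ s in p, ((∀ᶠ e' in r, Y (x, e', b)) ↔ ∀ᶠ e' in r, Y (s, e', b)) :=
      (hp.mem _ hG.with_base).mono fun e' he' => h2 _ _ he'
    rw [← Filter.eventually_congr this]
    simp
  rw [h3, h4]
  have hd : Dfn fun z : (S × B) × (E × B) => Y (z.1.1, z.2.1, z.1.2) := hY.comp (by fun_prop)
  exact (((hM.stab hd).precomp (fun s => (s, b)) fun e => (e, b)).eventually_comm p r).symm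

theorem gen_iff (hM : Monster L lev) {x : S} {b : B} {p : Ultrafilter S} (hp : IsGen L C x b p)
    {Y : S × E × B → Prop} (hY : Dfn Y) (e : E) : (∀ᶠ s in p, Y (s, e, b)) ↔ DS x b Y e := by
  rw [hM.gen_symm hp (hM.gen_spec e b) hY]
  exact (hM.gen_symm (hM.gen_spec x b) (hM.gen_spec e b) hY).symm

theorem defSch_symm (hM : Monster L lev)
    (x : S) (b : B) (e : E) {Y : S × E × B → Prop} (hY : Dfn Y) :
    DS x b Y e ↔ DS e b (fun z : E × S × B => Y (z.2.1, z.1, z.2.2)) x :=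
  hM.gen_symm (hM.gen_spec x b) (hM.gen_spec e b) hY

theorem defSch_congr_stp (hM : Monster L lev)
    {x x' : S} {b : B} (h : Stp b x x') {Y : S × E × B → Prop} (hY : Dfn Y)
    (e : E) : DS x b Y e ↔ DS x' b Y e := hM.gen_iff ((hM.gen_spec x b).of_stp h) hY e

theorem defSch_iff (hM : Monster L lev)
    (x : S) (b : B) (e : E) {Y : S × E × B → Prop} (hY : Dfn Y) :
    DS x b Y e ↔ ∃ F : (E × E) × B → Prop, FER F b ∧ ∀ G : (S × S) × B → Prop, FER G b →
      ∀ (n : ℕ) (f : Fin n → E), (∀ i, F ((e, f i), b)) → ∃ s, G ((x, s), b) ∧ ∀ i, Y (s, f i, b) := by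
  have hp := hM.gen_spec x b
  have hr := hM.gen_spec e b
  constructor
  · intro h
    obtain ⟨F, hF, h1⟩ := hp.dfn Y hY
    refine ⟨_, hF.with_base, fun G hG n f hf => ?_⟩
    exact ((hp.mem G hG).and (Filter.eventually_all.2 fun i => (h1 _ _ (hf i)).1 h)).exists
  · rintro ⟨F, hF, h⟩
    obtain ⟨G, hG, h2⟩ := hr.dfn (fun z : E × S × B => Y (z.2.1, z.1, z.2.2)) (hY.comp (by fun_prop))
    by_contra hcon
    have hcon' := mt (hM.gen_symm hp hr hY).2 hcon
    obtain ⟨q, hq1, hq2⟩ : ∃ q : Ultrafilter S,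
        (∀ G : (S × S) × B → Prop, FER G b → ∀ᶠ s in q, G ((x, s), b)) ∧
          ∀ e', F ((e, e'), b) → ∀ᶠ s in q, Y (s, e', b) := by
      let 𝒟 : Filter S :=
        { sets := {X | ∃ G : (S × S) × B → Prop, FER G b ∧ ∃ (n : ℕ) (f : Fin n → E),
            (∀ i, F ((e, f i), b)) ∧ ∀ s, G ((x, s), b) → (∀ i, Y (s, f i, b)) → s ∈ X}
          univ_sets := ⟨_, .true b, 0, Fin.elim0, fun i => i.elim0, by simp⟩
          sets_of_superset := by
            rintro X X' ⟨G, hG, n, f, hf, h⟩ hX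
            exact ⟨G, hG, n, f, hf, fun s h1 h2 => hX (h s h1 h2)⟩
          inter_sets := by
            rintro X X' ⟨G, hG, n, f, hf, h⟩ ⟨G', hG', n', f', hf', h'⟩
            refine ⟨_, hG.and hG', n + n', Fin.append f f', fun i => ?_, fun s h1 h2 => ⟨h s h1.1 fun i => ?_, h' s h1.2 fun i => ?_⟩⟩
            · refine Fin.addCases (fun i => ?_) (fun i => ?_) i
              · simpa using hf i
              · simpa using hf' i
            · simpa using h2 (Fin.castAdd n' i)
            · simpa using h2 (Fin.natAdd n i) }
      have : 𝒟.NeBot := by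
        rw [← Filter.forall_mem_nonempty_iff_neBot]
        rintro X ⟨G, hG, n, f, hf, h'⟩
        obtain ⟨s, h1, h2⟩ := h G hG n f hf
        exact ⟨s, h' s h1 h2⟩
      refine ⟨Ultrafilter.of 𝒟, fun G hG => Ultrafilter.of_le 𝒟 ⟨G, hG, 0, Fin.elim0, fun i => i.elim0, fun s hs _ => hs⟩,
        fun e' he' => Ultrafilter.of_le 𝒟 ⟨_, .true b, 1, fun _ => e', fun _ => he', fun s _ hs => hs 0⟩⟩
    have h3 : ∀ᶠ s in q, ∀ᶠ e' in gen L C e b, ¬Y (s, e', b) := by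
      filter_upwards [hq1 _ hG.with_base] with s hs
      rw [Ultrafilter.eventually_not]
      exact fun h4 => hcon' ((h2 (x, b) (s, b) hs).2 h4)
    have hd : Dfn fun z : (S × B) × (E × B) => ¬Y (z.1.1, z.2.1, z.1.2) :=
      (hY.comp (f := fun z : (S × B) × (E × B) => (z.1.1, z.2.1, z.1.2)) (by fun_prop)).not
    have h5 := (((hM.stab hd).precomp (fun s => (s, b)) fun e => (e, b)).eventually_comm q (gen L C e b)).1 h3
    obtain ⟨e', h6, h7⟩ := (h5.and (hr.mem F hF)).exists
    obtain ⟨s, h8, h9⟩ := (h6.and (hq2 e' h7)).exists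
    exact h8 h9

theorem defSch_transport (hM : Monster L lev)
    {x x' : S} {b b' : B} {e e' : E} (h : Tp ((x, e), b) ((x', e'), b'))
    {Y : S × E × B → Prop} (hY : Dfn Y) (hD : DS x b Y e) : DS x' b' Y e' := by
  rw [hM.defSch_iff _ _ _ hY] at hD ⊢
  obtain ⟨F, hF, hD⟩ := hD
  have hb : Tp b b' := h.map .snd
  refine ⟨F, hF.transport hb, fun G hG n => ?_⟩
  have hd : Dfn fun z : (S × E) × B => ∀ f : Fin n → E, (∀ i, F ((z.1.2, f i), z.2)) →
      ∃ s, G ((z.1.1, s), z.2) ∧ ∀ i, Y (s, f i, z.2) := by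
    refine .all (.imp (.forall_finite fun i => hF.dfn.comp (by fun_prop)) (.ex (.and (hG.dfn.comp (by fun_prop)) ?_)))
    exact .forall_finite fun i => hY.comp (by fun_prop)
  exact h _ hd (hD G (hG.transport hb.symm) n)

theorem defSch_congr (hM : Monster L lev)
    {x x' : S} {b b' : B} {e e' : E} (h : Tp ((x, e), b) ((x', e'), b'))
    {Y : S × E × B → Prop} (hY : Dfn Y) : DS x b Y e ↔ DS x' b' Y e' :=
  ⟨hM.defSch_transport h hY, hM.defSch_transport h.symm hY⟩

/-- The definition schema is uniformly definable. -/
theorem exists_defSch (hM : Monster L lev) (x : S) (b : B) {Y : S × E × B → Prop} (hY : Dfn Y) :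
    ∃ G : (S × B) × E → Prop, Dfn G ∧ ∀ x' b', Tp (x, b) (x', b') → ∀ e,
      (DS x' b' Y e ↔ G ((x', b'), e)) := by
  obtain ⟨N, Z, hZ, w, hw⟩ := hM.exists_trace hY (gen L C x b)
  obtain ⟨P, hP, h1⟩ := hM.dfn_of_invariant (Z := fun z : E × ((Fin N → S) × B) => Z ((z.1, z.2.2), z.2.1))
    (hZ.comp (by fun_prop)) (w, b) (x, b) (by
      intro s s' ht hs
      refine (hw _).1 (hM.defSch_transport (x := x) (x' := x) (b := b) (b' := b) (e := s) (e' := s') ?_ hY ((hw (s, b)).2 hs))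
      exact ht.map (f := fun z : E × S × B => ((z.2.1, z.1), z.2.2)) (by fun_prop))
  have h2 : ∀ s, DS x b Y s ↔ P (s, x, b) := fun s => (hw (s, b)).trans (h1 s)
  refine ⟨fun z => P (z.2, z.1), hP.comp (by fun_prop), fun x' b' ht e => ?_⟩
  obtain ⟨e0, he0⟩ := hM.tp_ext ht.symm e
  rw [hM.defSch_congr (he0.map (f := fun z : E × S × B => ((z.2.1, z.1), z.2.2)) (by fun_prop)) hY, h2]
  exact (he0.iff hP).symm

end Monster
end Benign

namespace Benign

variable {L : FirstOrder.Language.{u, u}} {C : Type u} [L.Structure C] {lev : ℕ → Set C}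
variable {S T R E B B' : Type u} [DSort L C S] [DSort L C T] [DSort L C R] [DSort L C E]
  [DSort L C B] [DSort L C B']
local notation "Dfn" => IsDfn L C
local notation "Crd" => Coord L C
local notation "Tp" => TpEq L C
local notation "FER" => IsFER L C
local notation "Stp" => StpEq L C
local notation "DS" => DefSch L C
local notation "Ind" => Indep L C

theorem Indep.of_imp {x : S} {b : B} {e : E}
    (h : ∀ Y : S × E × B → Prop, Dfn Y → DS x b Y e → Y (x, e, b)) : Ind x b e := by
  refine fun Y hY => ⟨fun h1 => ?_, h Y hY⟩
  by_contra h2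
  exact h _ hY.not (DefSch.not.2 h2) h1

namespace Monster

theorem ind_symm (hM : Monster L lev) {x : S} {b : B} {e : E} (h : Ind x b e) : Ind e b x := by
  intro Y hY
  have hd : Dfn fun z : S × E × B => Y (z.2.1, z.1, z.2.2) := hY.comp (by fun_prop)
  rw [hM.defSch_symm e b x hY]
  exact h _ hd

theorem ind_transport (hM : Monster L lev)
    {x x' : S} {b b' : B} {e e' : E} (h : Tp ((x, e), b) ((x', e'), b'))
    (hi : Ind x b e) : Ind x' b' e' := fun Y hY => by
  rw [← hM.defSch_congr h hY, ← hi Y hY]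
  have hd : Dfn fun z : (S × E) × B => Y (z.1.1, z.1.2, z.2) := hY.comp (by fun_prop)
  exact (h.iff hd).symm

theorem ind_mono (hM : Monster L lev)
    {x : S} {b : B} {e : E} {e' : T} (h : Ind x b e) (hd : Dcl L C (e, b) e') :
    Ind x b e' := by
  obtain ⟨Γ, h1, h2, h3⟩ := hd
  intro Y hY
  have key : ∀ s, Y (s, e', b) ↔ ∃ e'', Γ ((e, b), e'') ∧ Y (s, e'', b) := by
    refine fun s => ⟨fun hs => ⟨e', h2, hs⟩, ?_⟩
    rintro ⟨e'', h4, h5⟩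
    rwa [← h3 e'' h4]
  have hD : Dfn fun z : S × E × B => ∃ e'', Γ (z.2, e'') ∧ Y (z.1, e'', z.2.2) :=
    .ex ((h1.comp (by fun_prop)).and (hY.comp (by fun_prop)))
  rw [key, h _ hD]
  exact Filter.eventually_congr (.of_forall fun s => (key s).symm)

theorem ind_map (hM : Monster L lev)
    {x : S} {b : B} {e : E} (h : Ind x b e) {f : E → T} (hf : Crd f) :
    Ind x b (f e) := hM.ind_mono h ((Coord.fst.dcl (e, b)).trans (hf.dcl e))

theorem ind_map_left (hM : Monster L lev)
    {x : S} {b : B} {e : E} (h : Ind x b e) {f : S → T} (hf : Crd f) :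
    Ind (f x) b e := hM.ind_symm (hM.ind_map (hM.ind_symm h) hf)

/-- Realizations of the nonforking extension over a level. -/
theorem exists_free (hM : Monster L lev) (x : S) (b : B) (n : ℕ) : ∃ x', Stp b x x' ∧
    ∀ {E : Type u} [DSort L C E] (e : E), Rat L (lev n) e → Ind x' b e := by
  obtain ⟨m, hm⟩ := hM.exists_rat (x, b)
  obtain ⟨x', hx'⟩ := hM.sat (max n m) (gen L C x b : Filter S)
  have hbx : Rat L (lev (max n m)) (x, b) := hm.mono (hM.mono (le_max_right _ _))
  have hs : Stp b x x' := fun F hF =>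
    hx' (fun z : S × S × B => F ((z.2.1, z.1), z.2.2)) (hF.dfn.comp (by fun_prop)) (x, b) hbx
      ((hM.gen_spec x b).mem F hF)
  refine ⟨x', hs, fun e he => .of_imp fun Y hY hD => ?_⟩
  exact hx' Y hY (e, b) ((he.mono (hM.mono (le_max_left _ _))).prod (hbx.map Coord.snd))
    ((hM.defSch_congr_stp hs hY e).2 hD)

theorem exists_ind (hM : Monster L lev)
    (x : S) (b : B) (e : E) : ∃ x', Stp b x x' ∧ Ind x' b e := by
  obtain ⟨n, hn⟩ := hM.exists_rat e
  obtain ⟨x', h1, h2⟩ := hM.exists_free x b n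
  exact ⟨x', h1, h2 e hn⟩

/-- Two independent realizations of a strong type have the same type over the parameters. -/
theorem tp_of_ind (hM : Monster L lev)
    {x x' : S} {b : B} {e : E} (hs : Stp b x x') (h : Ind x b e) (h' : Ind x' b e) :
    Tp ((x, e), b) ((x', e), b) := by
  intro P hP hx
  have hd : Dfn fun z : S × E × B => P ((z.1, z.2.1), z.2.2) := hP.comp (by fun_prop)
  exact (h' _ hd).2 ((hM.defSch_congr_stp hs hd e).1 ((h _ hd).1 hx))

theorem gen_of_ind (hM : Monster L lev) {x : S} {b : B} {e : E} (h : Ind x b e) {p : Ultrafilter S}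
    (hp : IsGen L C x b p) : IsGen L C x (b, e) p := by
  refine ⟨fun F hF => ?_, fun Y hY => ?_⟩
  · obtain ⟨s0, hs0⟩ := hF.fin.exists_mem p
    obtain ⟨x', h1, h2⟩ := hM.exists_ind x b (e, s0, x)
    have hd0 : Dfn fun z : S × (E × S × S) × B => F ((z.2.1.2.1, z.1), z.2.2, z.2.1.1) :=
      hF.dfn.comp (by fun_prop)
    have h3 : F ((s0, x'), b, e) := (h2 _ hd0).2 ((hM.defSch_congr_stp h1 hd0 _).1
      ((hM.gen_iff hp hd0 (e, s0, x)).1 hs0))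
    have hd : Dfn fun z : S × (S × E) × B => F ((z.2.1.1, z.1), z.2.2, z.2.1.2) :=
      hF.dfn.comp (by fun_prop)
    refine (hM.gen_iff hp hd (x, e)).2 ?_
    have ht := hM.tp_of_ind h1 h (hM.ind_map h2 (f := fun z : E × S × S => z.1) (by fun_prop))
    rw [hM.defSch_congr (ht.map (f := fun z : (S × E) × B => ((z.1.1, (z.1.1, z.1.2)), z.2)) (by fun_prop)) hd,
      ← hM.defSch_congr_stp h1 hd, ← hM.gen_iff hp hd]
    exact hs0.mono fun s hs => hF.equiv.trans (hF.equiv.symm h3) hs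
  · obtain ⟨F, hF, h1⟩ := hp.dfn Y hY
    exact ⟨_, hF.comap (g := fun z : B × E => z.1) (b := (b, e)) Coord.id' (by fun_prop), h1⟩

/-- Strong types have a unique nonforking extension. -/
theorem stp_of_ind (hM : Monster L lev)
    {x x' : S} {b : B} {e : E} (hs : Stp b x x') (h : Ind x b e) (h' : Ind x' b e) :
    Stp (b, e) x x' := by
  intro F hF
  have h1 := hM.gen_of_ind h (hM.gen_spec x b)
  have h2 := hM.gen_of_ind h' ((hM.gen_spec x b).of_stp hs)
  obtain ⟨s, h3, h4⟩ := ((h1.mem F hF).and (h2.mem F hF)).exists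
  exact hF.equiv.trans h3 (hF.equiv.symm h4)

theorem ind_trans (hM : Monster L lev)
    {x : S} {b : B} {e : E} {f : T} (h : Ind x b e) (h' : Ind x (b, e) f) :
    Ind x b (e, f) := by
  intro Y hY
  have hd : Dfn fun z : S × T × B × E => Y (z.1, (z.2.2.2, z.2.1), z.2.2.1) := hY.comp (by fun_prop)
  exact (h' _ hd).trans (hM.gen_iff (hM.gen_of_ind h (hM.gen_spec x b)) hd f).symm

theorem ind_left (hM : Monster L lev)
    {x : S} {b : B} {e : E} {f : T} (h : Ind x b (e, f)) : Ind x b e :=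
  hM.ind_map h Coord.fst

theorem ind_right (hM : Monster L lev)
    {x : S} {b : B} {e : E} {f : T} (h : Ind x b (e, f)) : Ind x (b, e) f := by
  intro Y hY
  have hd : Dfn fun z : S × (E × T) × B => Y (z.1, z.2.1.2, z.2.2, z.2.1.1) := hY.comp (by fun_prop)
  exact (h _ hd).trans (hM.gen_iff (hM.gen_of_ind (hM.ind_left h) (hM.gen_spec x b)) hY f)

theorem ind_of_dcl (hM : Monster L lev)
    {x : S} {b : B} {b' : B'} {e : E} (h : Ind x b e) (hd : Dcl L C b b')
    (hd' : Dcl L C b' b) : Ind x b' e := by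
  intro Y hY
  have hg := (hM.gen_spec x b).of_dcl hd hd'
  rw [← hM.gen_iff hg hY]
  obtain ⟨Γ, h1, h2, h3⟩ := hd
  have key : ∀ s, Y (s, e, b') ↔ ∃ b'', Γ (b, b'') ∧ Y (s, e, b'') := by
    refine fun s => ⟨fun hs => ⟨b', h2, hs⟩, ?_⟩
    rintro ⟨e'', h4, h5⟩
    rwa [← h3 e'' h4]
  have hD : Dfn fun z : S × E × B => ∃ b'', Γ (z.2.2, b'') ∧ Y (z.1, z.2.1, b'') :=
    .ex ((h1.comp (by fun_prop)).and (hY.comp (by fun_prop)))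
  rw [key, h _ hD]
  exact Filter.eventually_congr (.of_forall fun s => (key s).symm)

theorem ind_base (hM : Monster L lev)
    {x : S} {b : B} {b' : B'} {e : E} (h : Ind x b e) {f : B → B'} {g : B' → B}
    (hf : Crd f) (hg : Crd g) (h1 : f b = b') (h2 : g b' = b) : Ind x b' e :=
  hM.ind_of_dcl h (h1 ▸ hf.dcl b) (h2 ▸ hg.dcl b')

/-- Independence from a tuple over a part of it. -/
theorem ind_over (hM : Monster L lev) {x : S} {b : B} {e : E} {b' : B'} {f : T} (h : Ind x b e)
    (hb : Dcl L C b' b) (hb' : Dcl L C (e, b) b') (hf : Dcl L C (e, b) f) : Ind x b' f := by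
  have h1 : Ind x b (b', f) := hM.ind_mono h (hb'.mk hf)
  exact hM.ind_of_dcl (hM.ind_right h1) (Coord.snd.dcl _) (hb.mk (Coord.id'.dcl _))

theorem ind_self (hM : Monster L lev) {x : S} {b : B} {e : E} (hd : Dcl L C b e) : Ind x b e := by
  have h : Ind x b b := by
    intro Y hY
    have h1 := (hM.gen_spec x b).mem _ (IsFER.of_pred (P := fun z : S × B => Y (z.1, z.2, z.2)) (hY.comp (by fun_prop)) b)
    unfold DefSch
    rw [← Filter.eventually_congr h1]
    simp
  exact hM.ind_mono h ((Coord.fst.dcl (b, b)).trans hd)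

end Monster
end Benign

namespace Benign

variable {L : FirstOrder.Language.{u, u}} {C : Type u} [L.Structure C] {lev : ℕ → Set C}
local notation "Dfn" => IsDfn L C
local notation "Crd" => Coord L C
local notation "Tp" => TpEq L C
local notation "FER" => IsFER L C
local notation "Stp" => StpEq L C
local notation "DS" => DefSch L C
local notation "Ind" => Indep L C

namespace Monster

theorem exists_tree (hM : Monster L lev)
    {U : Type u} [DSort L C U] {B : ℕ → Type u} [∀ n, DSort L C (B n)] {N : ℕ}
    {q : ∀ n, U → B n} (hq : ∀ n ≤ N, Crd (q n)) {pr : ∀ n, B (n + 1) → B n}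
    (hpr : ∀ n, Crd (pr n)) (hqp : ∀ n < N, ∀ u, pr n (q (n + 1) u) = q n u) (u0 : U) {O : Type*}
    (H : Finset (ℕ → O)) :
    ∃ u : (ℕ → O) → U, (∀ η ∈ H, Tp (u η) u0) ∧ ∀ η ∈ H, ∀ ζ ∈ H, ∀ k ≤ N, (∀ i < k, η i = ζ i) →
      q k (u η) = q k (u ζ) ∧ (k < N → η k ≠ ζ k →
        Stp (q k (u η)) (q (k + 1) (u η)) (q (k + 1) (u ζ)) ∧ Ind (u η) (q k (u η)) (u ζ)) := by
  classical
  have hqeq : ∀ u v k n, k ≤ n → n ≤ N → q n u = q n v → q k u = q k v := by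
    intro u v k n hk
    induction n, hk using Nat.le_induction with
    | base => exact fun _ h => h
    | succ n hkn ih =>
      intro hn h
      refine ih (by omega) ?_
      rw [← hqp n (by omega), ← hqp n (by omega), h]
  have hdcl : ∀ u k n, k ≤ n → n ≤ N → Dcl L C (q n u) (q k u) := by
    intro u k n hk
    induction n, hk using Nat.le_induction with
    | base => exact fun _ => Coord.id'.dcl _
    | succ n hkn ih =>
      intro hn
      refine Dcl.trans ?_ (ih (by omega))
      rw [← hqp n (by omega)]
      exact (hpr n).dcl _
  induction H using Finset.induction with
  | empty => exact ⟨fun _ => u0, by simp, by simp⟩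
  | insert ζ H hζ ih =>
    obtain ⟨u, hu, hK⟩ := ih
    suffices ∃ v, Tp v u0 ∧ ∀ η ∈ H, ∀ k ≤ N, (∀ i < k, η i = ζ i) →
      q k (u η) = q k v ∧ (k < N → η k ≠ ζ k →
        Stp (q k (u η)) (q (k + 1) (u η)) (q (k + 1) v) ∧ Ind (u η) (q k (u η)) v) by
      obtain ⟨v, hv, hKv⟩ := this
      have hne : ∀ η ∈ H, η ≠ ζ := fun η hη h => hζ (h ▸ hη)
      refine ⟨Function.update u ζ v, fun η hη => ?_, fun η hη η' hη' k hk hag => ?_⟩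
      · rcases Finset.mem_insert.1 hη with rfl | hη
        · simpa using hv
        · simpa [Function.update_of_ne (hne η hη)] using hu η hη
      · rcases Finset.mem_insert.1 hη with rfl | hηH <;> rcases Finset.mem_insert.1 hη' with rfl | hη'H
        · exact ⟨rfl, fun _ h => absurd rfl h⟩
        · obtain ⟨h1, h2⟩ := hKv η' hη'H k hk fun i hi => (hag i hi).symm
          rw [Function.update_self, Function.update_of_ne (hne η' hη'H), ← h1]
          exact ⟨rfl, fun h3 h4 => ⟨(h2 h3 h4.symm).1.symm, hM.ind_symm (h2 h3 h4.symm).2⟩⟩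
        · rw [Function.update_self, Function.update_of_ne (hne η hηH)]
          exact hKv η hηH k hk hag
        · rw [Function.update_of_ne (hne η hηH), Function.update_of_ne (hne η' hη'H)]
          exact hK η hηH η' hη'H k hk hag
    rcases H.eq_empty_or_nonempty with rfl | hHne
    · exact ⟨u0, .refl _, by simp⟩
    obtain ⟨η0, hη0, hmax⟩ := H.exists_max_image
      (fun η => Nat.findGreatest (fun k => ∀ i < k, η i = ζ i) N) hHne
    set n := Nat.findGreatest (fun k => ∀ i < k, η0 i = ζ i) N with hn
    have hnN : n ≤ N := Nat.findGreatest_le N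
    have hag0 : ∀ i < n, η0 i = ζ i :=
      Nat.findGreatest_spec (P := fun k => ∀ i < k, η0 i = ζ i) (Nat.zero_le N) (by simp)
    have hle : ∀ η ∈ H, ∀ k ≤ N, (∀ i < k, η i = ζ i) → k ≤ n := fun η hη k hk h =>
      (Nat.le_findGreatest hk h).trans (hmax η hη)
    rcases hnN.eq_or_lt with hnN' | hnN'
    · refine ⟨u η0, hu η0 hη0, fun η hη k hk hag => ?_⟩
      have hkn := hle η hη k hk hag
      obtain ⟨h1, h2⟩ := hK η hη η0 hη0 k hk fun i hi => (hag i hi).trans (hag0 i (by omega)).symm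
      refine ⟨h1, fun h3 h4 => h2 h3 ?_⟩
      rwa [hag0 k (by omega)]
    · obtain ⟨v, hv1, hv2⟩ := hM.exists_ind (u η0) (q n (u η0)) fun i : Fin H.card => u (H.equivFin.symm i).1
      have hv2' : ∀ η ∈ H, Ind (u η) (q n (u η0)) v := by
        intro η hη
        have := hM.ind_symm (hM.ind_map hv2 (f := fun z => z (H.equivFin ⟨η, hη⟩)) (by fun_prop))
        simpa using this
      have hqn : q n v = q n (u η0) := by
        have hd : Dfn fun z : U × B n => q n z.1 = z.2 := .eq ((hq n hnN).comp Coord.fst) Coord.snd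
        exact hv1.tp _ hd rfl
      refine ⟨v, (hv1.tp.map Coord.fst).symm.trans (hu η0 hη0), fun η hη k hk hag => ?_⟩
      have hkn := hle η hη k hk hag
      have hag' : ∀ i < k, η i = η0 i := fun i hi => (hag i hi).trans (hag0 i (by omega)).symm
      obtain ⟨h1, h2⟩ := hK η hη η0 hη0 k hk hag'
      refine ⟨h1.trans (hqeq _ _ k n hkn hnN hqn).symm, fun h3 h4 => ?_⟩
      rcases hkn.eq_or_lt with hkn' | hkn'
      · rw [hkn'] at h1 h2 h3 h4 hag' ⊢
        have h5 : Stp (q n (u η)) (q (n + 1) (u η)) (q (n + 1) (u η0)) := by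
          by_cases h6 : η n = η0 n
          · rw [(hK η hη η0 hη0 (n + 1) (by omega) fun i hi => ?_).1]
            · exact .refl _ _
            · rcases Nat.lt_succ_iff_lt_or_eq.1 hi with hi | rfl
              exacts [hag' i hi, h6]
          · exact (h2 h3 h6).1
        rw [h1] at h5 ⊢
        exact ⟨h5.trans (hv1.map (hq (n + 1) (by omega)) Coord.id'), hv2' η hη⟩
      · obtain ⟨h5, h6⟩ := h2 h3 (by rwa [hag0 k hkn'])
        rw [hqeq _ _ (k + 1) n hkn' hnN hqn]
        refine ⟨h5, ?_⟩
        have h7 : Ind (u η) (q k (u η)) (q n (u η0)) := hM.ind_map h6 (hq n hnN)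
        have h8 : Ind (u η) (q k (u η), q n (u η0)) v := by
          refine hM.ind_of_dcl (hv2' η hη) (.mk ?_ (Coord.id'.dcl _)) (Coord.snd.dcl _)
          rw [h1]
          exact hdcl _ _ _ hkn hnN
        exact hM.ind_map (hM.ind_trans h7 h8) Coord.snd

/-- Superstability: there is no infinite chain of forking extensions. -/
theorem no_forking_chain (hM : Monster L lev)
    {S : Type u} [DSort L C S] (B : ℕ → Type u) [∀ n, DSort L C (B n)]
    (b : ∀ n, B n) (x : ℕ → S) (pr : ∀ n, B (n + 1) → B n) (hpr : ∀ n, Crd (pr n))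
    (hb : ∀ n, pr n (b (n + 1)) = b n) (hx : ∀ n, Tp (x (n + 1), b n) (x n, b n))
    (hf : ∀ n, ¬Ind (x (n + 1)) (b n) (b (n + 1))) : False := by
  classical
  have hY : ∀ n, ∃ Y : S × B (n + 1) × B n → Prop, Dfn Y ∧ Y (x (n + 1), b (n + 1), b n) ∧
      ¬DS (x (n + 1)) (b n) Y (b (n + 1)) := by
    intro n
    by_contra hcon
    push Not at hcon
    refine hf n (Indep.of_imp fun Y hY h1 => ?_)
    by_contra h2
    exact DefSch.not.1 (hcon _ hY.not h2) h1
  choose Y hYd hY1 hY2 using hY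
  have hpast : ∀ N m, m ≤ N → Tp (x (N + 1), b m) (x N, b m) := by
    intro N m hm
    induction hm using Nat.decreasingInduction with
    | self => exact hx N
    | of_succ k hk ih' =>
      rw [← hb k]
      exact ih'.map (f := fun z : S × B (k + 1) => (z.1, pr k z.2)) (by
        have := hpr k
        fun_prop)
  have htp : ∀ n N, n ≤ N → Tp (x N, b n) (x n, b n) := by
    intro n N h
    induction N, h using Nat.le_induction with
    | base => exact .refl _
    | succ N h ih => exact (hpast N n h).trans ih
  refine hM.no_tree (S := S) (B := B) (ψ := fun n => match n with
    | 0 => fun _ => True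
    | n + 1 => fun z => Y n (z.1, z.2, pr n z.2)) ?_ fun O H N => ?_
  · rintro (_ | n)
    · exact .const _
    · have := hpr n
      exact (hYd n).comp (by fun_prop)
  · let Q : ∀ n (_ : n ≤ N), B N → B n := fun n h y =>
      Nat.decreasingInduction (motive := fun m _ => B m) (fun k _ => pr k) y h
    have hQs : ∀ n (h : n < N) y, pr n (Q (n + 1) h y) = Q n h.le y := fun n h y =>
      (Nat.decreasingInduction_succ_left (motive := fun m _ => B m) (fun k _ => pr k) y h h.le).symm
    have hQ0 : ∀ y, Q N le_rfl y = y := fun y =>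
      Nat.decreasingInduction_self (motive := fun m _ => B m) (fun k _ => pr k) y
    have hQc : ∀ n (h : n ≤ N), Crd (Q n h) := by
      intro n h
      induction h using Nat.decreasingInduction with
      | self =>
        rw [show Q N le_rfl = fun y => y from funext hQ0]
        exact Coord.id'
      | of_succ k hk ih =>
        rw [show Q k hk.le = fun y => pr k (Q (k + 1) hk y) from funext fun y => (hQs k hk y).symm]
        exact (hpr k).comp ih
    have hQb : ∀ n (h : n ≤ N), Q n h (b N) = b n := by
      intro n h
      induction h using Nat.decreasingInduction with
      | self => exact hQ0 _
      | of_succ k hk ih => rw [← hQs k hk, ih, hb]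
    let q : ∀ n, S × B N → B n := fun n z => if h : n ≤ N then Q n h z.2 else b n
    have hqe : ∀ n (h : n ≤ N), q n = fun z => Q n h z.2 := fun n h => by
      funext z
      exact dif_pos h
    have hq : ∀ n ≤ N, Crd (q n) := fun n h => by
      rw [hqe n h]
      exact (hQc n h).comp Coord.snd
    obtain ⟨u, hu, hK⟩ := hM.exists_tree hq hpr (fun n h z => by
      rw [hqe n h.le, hqe (n + 1) h]
      exact hQs n h z.2) (x N, b N) H
    refine ⟨fun η => (u η).1, fun n σ => if h : ∃ η ∈ H, (fun i : Fin n => η i) = σ then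
      q n (u h.choose) else b n, fun η hη ζ hζ n hn hag hne => ?_⟩
    have ht : (if h : ∃ η' ∈ H, (fun i : Fin (n + 1) => η' i) = (fun i : Fin (n + 1) => η i) then
      q (n + 1) (u h.choose) else b (n + 1)) = q (n + 1) (u η) := by
      have h : ∃ η' ∈ H, (fun i : Fin (n + 1) => η' i) = (fun i : Fin (n + 1) => η i) := ⟨η, hη, rfl⟩
      rw [dif_pos h]
      exact (hK _ h.choose_spec.1 η hη (n + 1) hn fun i hi => congrFun h.choose_spec.2 ⟨i, hi⟩).1
    dsimp only
    rw [ht]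
    have hpq : ∀ z, pr n (q (n + 1) z) = q n z := fun z => by
      rw [hqe n hn.le, hqe (n + 1) hn]
      exact hQs n hn z.2
    have htpη : ∀ η ∈ H, Tp (((u η).1, q (n + 1) (u η)), q n (u η)) ((x (n + 1), b (n + 1)), b n) := by
      intro η hη
      have h1 := (hu η hη).map (f := fun z : S × B N => (z.1, q (n + 1) z)) (Coord.fst.mk (hq _ hn))
      have h2 : q (n + 1) (x N, b N) = b (n + 1) := by
        rw [hqe (n + 1) hn]
        exact hQb _ _
      rw [h2] at h1
      have h3 := (h1.trans (htp (n + 1) N hn)).map (f := fun z : S × B (n + 1) => ((z.1, z.2), pr n z.2)) (by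
        have := hpr n
        fun_prop)
      simpa only [hpq, hb] using h3
    obtain ⟨hqq, hsplit⟩ := hK ζ hζ η hη n hn.le fun i hi => (hag i hi).symm
    obtain ⟨hstp, hind⟩ := hsplit hn hne.symm
    constructor
    · change Y n _
      rw [hpq]
      have hd : Dfn fun z : (S × B (n + 1)) × B n => Y n (z.1.1, z.1.2, z.2) := (hYd n).comp (by fun_prop)
      exact ((htpη η hη).iff hd).2 (hY1 n)
    · change ¬Y n _
      rw [hpq]
      intro hcon
      rw [← hqq] at hcon
      have h1 : Ind (u ζ).1 (q n (u ζ)) (q (n + 1) (u η)) :=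
        hM.ind_map_left (hM.ind_map hind (hq (n + 1) hn)) Coord.fst
      have h2 := (h1 _ (hYd n)).1 hcon
      rw [hM.defSch_symm _ _ _ (hYd n), ← hM.defSch_congr_stp hstp ((hYd n).comp (by fun_prop)),
        ← hM.defSch_symm _ _ _ (hYd n)] at h2
      exact hY2 n (hM.defSch_transport (htpη ζ hζ) (hYd n) h2)

end Monster
end Benign

namespace Benign

variable {L : FirstOrder.Language.{u, u}} {C : Type u} [L.Structure C] {lev : ℕ → Set C}
variable {S T R E B B' : Type u} [DSort L C S] [DSort L C T] [DSort L C R] [DSort L C E]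
  [DSort L C B] [DSort L C B']
local notation "Dfn" => IsDfn L C
local notation "Crd" => Coord L C
local notation "Tp" => TpEq L C
local notation "FER" => IsFER L C
local notation "Stp" => StpEq L C
local notation "DS" => DefSch L C
local notation "Ind" => Indep L C

/-- An element together with a finite tuple of parameters. -/
structure Node (L : FirstOrder.Language.{u, u}) (C : Type u) [L.Structure C] (S : Type u) where
  sort : Type u
  inst : DSort L C sort
  base : sort
  elt : S

/-- A node over a larger base, with the same type over the old base, which forks. -/
def Child (L : FirstOrder.Language.{u, u}) (C : Type u) [L.Structure C] (S : Type u) [DSort L C S]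
    (n' n : Node L C S) : Prop :=
  letI := n.inst
  letI := n'.inst
  ∃ pr : n'.sort → n.sort, Coord L C pr ∧ pr n'.base = n.base ∧
    TpEq L C (n'.elt, n.base) (n.elt, n.base) ∧ ¬Indep L C n'.elt n.base n'.base

open Classical in
/-- The foundation rank of forking. -/
noncomputable def frank (L : FirstOrder.Language.{u, u}) (C : Type u) [L.Structure C] {S B : Type u}
    [DSort L C S] [i : DSort L C B] (x : S) (b : B) : Ordinal.{u + 1} :=
  if h : WellFounded (Child L C S) then
    haveI : IsWellFounded _ (Child L C S) := ⟨h⟩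
    IsWellFounded.rank (Child L C S) ⟨B, i, b, x⟩ else 0

local notation "rk" => frank L C

namespace Monster

theorem child_wf (hM : Monster L lev) : WellFounded (Child L C S) := by
  rw [wellFounded_iff_isEmpty_descending_chain]
  refine ⟨fun ⟨f, hf⟩ => ?_⟩
  letI : ∀ n, DSort L C (f n).sort := fun n => (f n).inst
  choose pr h1 h2 h3 h4 using hf
  exact hM.no_forking_chain (fun n => (f n).sort) (fun n => (f n).base) (fun n => (f n).elt) pr h1 h2 h3 h4

theorem node_induction (hM : Monster L lev)
    {P : Node L C S → Prop} (H : ∀ n, (∀ n', Child L C S n' n → P n') → P n) :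
    ∀ n, P n := fun n => hM.child_wf.induction n H

theorem frank_lt (hM : Monster L lev)
    {x x' : S} {b : B} {b' : B'} {pr : B' → B} (h1 : Crd pr) (h2 : pr b' = b)
    (h3 : Tp (x', b) (x, b)) (h4 : ¬Ind x' b b') : rk x' b' < rk x b := by
  have h := hM.child_wf (S := S)
  unfold frank
  rw [dif_pos h, dif_pos h]
  have : IsWellFounded _ (Child L C S) := ⟨h⟩
  exact IsWellFounded.rank_lt_of_rel ⟨pr, h1, h2, h3, h4⟩

theorem frank_le (hM : Monster L lev) {x : S} {b : B} {o : Ordinal.{u + 1}}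
    (H : ∀ {B' : Type u} [DSort L C B'] (x' : S) (b' : B') (pr : B' → B), Crd pr → pr b' = b →
      Tp (x', b) (x, b) → ¬Ind x' b b' → rk x' b' < o) : rk x b ≤ o := by
  have h := hM.child_wf (S := S)
  unfold frank at H ⊢
  have : IsWellFounded _ (Child L C S) := ⟨h⟩
  rw [dif_pos h, IsWellFounded.rank_eq]
  refine Ordinal.iSup_le ?_
  rintro ⟨⟨B', i, b', x'⟩, pr, h1, h2, h3, h4⟩
  have := H x' b' pr h1 h2 h3 h4
  rw [dif_pos h] at this
  exact Order.succ_le_of_lt this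

theorem frank_le_of_tp (hM : Monster L lev)
    {x x' : S} {b b' : B} (h : Tp (x, b) (x', b')) : rk x b ≤ rk x' b' := by
  suffices H : ∀ n : Node L C S, letI := n.inst
      ∀ x' b', Tp (n.elt, n.base) (x', b') → rk n.elt n.base ≤ rk x' b' from
    H ⟨B, _, b, x⟩ x' b' h
  refine hM.node_induction fun n ih => ?_
  · obtain ⟨B, i, b, x⟩ := n
    intro x' b' h
    refine hM.frank_le fun {D} _ y d pr h1 h2 h3 h4 => ?_
    obtain ⟨d', hd'⟩ := hM.tp_ext (h3.trans h) d
    have h2' : pr d' = b' := by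
      have hd : Dfn fun z : D × S × B => pr z.1 = z.2.2 := .eq (h1.comp Coord.fst) (by fun_prop)
      exact hd' _ hd h2
    refine (ih ⟨D, _, d, y⟩ ⟨pr, h1, h2, h3, h4⟩ x' d' (hd'.map (f := fun z : D × S × B => (z.2.1, z.1))
      (by fun_prop))).trans_lt (hM.frank_lt h1 h2' (.refl _) fun h5 => h4 ?_)
    exact hM.ind_transport (hd'.symm.map (f := fun z : D × S × B => ((z.2.1, z.1), z.2.2)) (by fun_prop)) h5

theorem frank_congr (hM : Monster L lev)
    {x x' : S} {b b' : B} (h : Tp (x, b) (x', b')) : rk x b = rk x' b' :=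
  le_antisymm (hM.frank_le_of_tp h) (hM.frank_le_of_tp h.symm)

theorem frank_le_of_coord (hM : Monster L lev)
    {x : S} {b : B} {b' : B'} {f : B' → B} (hf : Crd f) (h : f b' = b) :
    rk x b' ≤ rk x b := by
  refine hM.frank_le fun {D} _ y d pr h1 h2 h3 h4 => ?_
  have hd : Dcl L C d b' := h2 ▸ h1.dcl d
  refine hM.frank_lt (hf.comp h1) (by rw [← h, ← h2]) ?_ fun h5 => h4 ?_
  · rw [← h]
    exact h3.map (f := fun z : S × B' => (z.1, f z.2)) (by fun_prop)
  · exact hM.ind_over h5 (h ▸ hf.dcl b') ((Coord.fst.dcl _).trans hd) (Coord.fst.dcl _)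

theorem frank_le_of_ind (hM : Monster L lev)
    {x : S} {b : B} {e : E} (h : Ind x b e) : rk x b ≤ rk x (b, e) := by
  suffices H : ∀ n : Node L C S, letI := n.inst
      ∀ {E : Type u} [DSort L C E] (e : E), Ind n.elt n.base e →
        rk n.elt n.base ≤ rk n.elt (n.base, e) from
    H ⟨B, _, b, x⟩ e h
  clear h
  refine hM.node_induction fun n ih => ?_
  · obtain ⟨B, i, b, x⟩ := n
    intro E _ f h
    refine hM.frank_le fun {D} _ y d pr h1 h2 h3 h4 => ?_
    obtain ⟨d1, hd1⟩ := hM.tp_ext h3 d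
    obtain ⟨d2, hd2, hi⟩ := hM.exists_ind d1 (x, b) f
    have htp : Tp (d, y, b) (d2, x, b) := hd1.trans hd2.tp
    have h2' : pr d2 = b := by
      have hd : Dfn fun z : D × S × B => pr z.1 = z.2.2 := .eq (h1.comp Coord.fst) (by fun_prop)
      exact htp _ hd h2
    have h4' : ¬Ind x b d2 := fun h5 => h4 <|
      hM.ind_transport (htp.symm.map (f := fun z : D × S × B => ((z.2.1, z.1), z.2.2)) (by fun_prop)) h5
    have h6 : Ind f b (d2, x) := hM.ind_map (f := Prod.swap)
      (hM.ind_trans (hM.ind_symm h) (hM.ind_base (hM.ind_symm hi) (f := Prod.swap) (g := Prod.swap)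
        (Coord.snd.mk Coord.fst) (Coord.snd.mk Coord.fst) rfl rfl)) (Coord.snd.mk Coord.fst)
    have h7 : Ind x d2 f := hM.ind_of_dcl (hM.ind_symm (hM.ind_right h6)) (Coord.snd.dcl _)
      (Dcl.mk (h2' ▸ h1.dcl d2) (Coord.id'.dcl _))
    rw [hM.frank_congr (htp.map (f := fun z : D × S × B => (z.2.1, z.1)) (by fun_prop))]
    refine (ih ⟨D, _, d2, x⟩ ⟨pr, h1, h2', .refl _, h4'⟩ f h7).trans_lt ?_
    refine hM.frank_lt (pr := fun z : D × E => (pr z.1, z.2)) (by fun_prop) (by simp [h2']) (.refl _) fun h8 => h4' ?_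
    exact hM.ind_map (hM.ind_trans h h8) (f := fun z : E × D × E => z.2.1) (by fun_prop)

theorem frank_le_of_dcl (hM : Monster L lev)
    {x : S} {b : B} {b' : B'} (h : Dcl L C b b') : rk x b ≤ rk x b' :=
  (hM.frank_le_of_ind (hM.ind_self h)).trans (hM.frank_le_of_coord Coord.snd rfl)

theorem frank_lt_of_not_ind (hM : Monster L lev)
    {x : S} {b : B} {e : E} {g : R} (h : ¬Ind x b e) (hg : Dcl L C g b)
    (hg' : Dcl L C g e) : rk x g < rk x b :=
  (hM.frank_le_of_dcl (hg.mk hg')).trans_lt (hM.frank_lt Coord.fst rfl (.refl _) fun h' => h (hM.ind_map h' Coord.snd))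

theorem ind_of_frank_le (hM : Monster L lev)
    {x : S} {b : B} {e : E} {g : R} (h : rk x b ≤ rk x g) (hg : Dcl L C g b)
    (hg' : Dcl L C g e) : Ind x b e := by
  by_contra h'
  exact absurd h (not_le.2 (hM.frank_lt_of_not_ind h' hg hg'))

end Monster

theorem exists_min_ordinal {K : Ordinal.{u} → Prop} (h : ∃ o, K o) : ∃ o, K o ∧ ∀ o', K o' → o ≤ o' := by
  obtain ⟨o, h1, h2⟩ := Ordinal.lt_wf.has_min {o | K o} h
  exact ⟨o, h1, fun o' h => not_lt.1 (h2 o' h)⟩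

end Benign

namespace Benign

variable {L : FirstOrder.Language.{u, u}} {C : Type u} [L.Structure C] {lev : ℕ → Set C}
variable {S T R E B B' : Type u} [DSort L C S] [DSort L C T] [DSort L C R] [DSort L C E]
  [DSort L C B] [DSort L C B']
local notation "Dfn" => IsDfn L C
local notation "Crd" => Coord L C
local notation "Tp" => TpEq L C
local notation "FER" => IsFER L C
local notation "Stp" => StpEq L C
local notation "DS" => DefSch L C
local notation "Ind" => Indep L C
local notation "rk" => frank L C

section Quotients

/-- The quotient of a sort by a definable equivalence relation. -/
@[reducible] def DSort.quotient (s : Setoid S) (h : Dfn fun z : S × S => s z.1 z.2) :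
    DSort L C (Quotient s) where
  idx := DSort.idx L C S
  finite_idx := inferInstance
  rep' v := Quotient.mk s (DSort.rep L v)
  rep_surjective' := Quotient.mk_surjective.comp DSort.rep_surjective
  definable_ker' := by
    have : {v : DSort.idx L C S ⊕ DSort.idx L C S → C |
        Quotient.mk s (DSort.rep L (v ∘ Sum.inl)) = Quotient.mk s (DSort.rep L (v ∘ Sum.inr))} =
        {v | s (DSort.rep L (v ∘ Sum.inl)) (DSort.rep L (v ∘ Sum.inr))} :=
      Set.ext fun v => Quotient.eq
    exact this ▸ h

theorem Coord.quotient_mk (s : Setoid S) (h : Dfn fun z : S × S => s z.1 z.2) :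
    letI := DSort.quotient s h
    Crd (Quotient.mk s) :=
  ⟨_root_.id, fun _ => rfl⟩

end Quotients

/-- Equality of strong types over a set. -/
def StpA (L : FirstOrder.Language.{u, u}) {C : Type u} [L.Structure C] (A : Set C)
    [DSort L C S] (x y : S) : Prop :=
  ∀ ⦃E : Type u⦄ [DSort L C E] (a : E), Rat L A a → StpEq L C a x y

/-- Every finite tuple of the set `A` is independent from `x` over `b`. -/
def IndA (L : FirstOrder.Language.{u, u}) {C : Type u} [L.Structure C] (A : Set C)
    [DSort L C S] [DSort L C B] (x : S) (b : B) : Prop :=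
  ∀ ⦃E : Type u⦄ [DSort L C E] (a : E), Rat L A a → Indep L C x b a

variable {A MM : Set C}

theorem exists_ratA (L : FirstOrder.Language.{u, u}) {C : Type u} [L.Structure C] (A : Set C) :
    ∃ (E : Type u) (_ : DSort L C E) (a : E), Rat L A a :=
  ⟨Fin 0 → C, inferInstance, Fin.elim0, .pi fun i => i.elim0⟩

namespace StpA

theorem refl (x : S) : StpA L A x x := fun _ _ _ _ => .refl _ _

theorem symm {x y : S} (h : StpA L A x y) : StpA L A y x := fun _ _ a ha => (h a ha).symm

theorem trans {x y z : S} (h : StpA L A x y) (h' : StpA L A y z) : StpA L A x z :=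
  fun _ _ a ha => (h a ha).trans (h' a ha)

theorem map {x y : S} (h : StpA L A x y) {f : S → T} (hf : Crd f) : StpA L A (f x) (f y) :=
  fun _ _ a ha => (h a ha).map hf .id'

theorem tp {x y : S} (h : StpA L A x y) {a : E} (ha : Rat L A a) : Tp (x, a) (y, a) := (h a ha).tp

theorem tp' {x y : S} (h : StpA L A x y) : Tp x y := by
  obtain ⟨E, _, a, ha⟩ := exists_ratA L A
  exact (h.tp ha).map .fst

theorem with_base {x y : S} (h : StpA L A x y) {a : E} (ha : Rat L A a) :
    StpA L A (x, a) (y, a) := fun _ _ a' ha' =>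
  ((h (a', a) (ha'.prod ha)).pair)

end StpA

namespace Monster

theorem stpA_ext (hM : Monster L lev) (hA : A ⊆ lev 0) {x y : S} (h : StpA L A x y) (z : T) :
    ∃ z', StpA L A (x, z) (y, z') := by
  obtain ⟨n, hn⟩ := hM.exists_rat ((x, z), y)
  let ℱ : Filter T :=
    { sets := {X | ∃ (E : Type u) (_ : DSort L C E) (a : E)
        (F : ((S × T) × (S × T)) × E → Prop), Rat L A a ∧ IsFER L C F a ∧
        ∀ z', F (((x, z), (y, z')), a) → z' ∈ X}
      univ_sets := by
        obtain ⟨E, _, a, ha⟩ := exists_ratA L A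
        exact ⟨E, _, a, _, ha, .true a, fun _ _ => trivial⟩
      sets_of_superset := by
        rintro X Y ⟨E, i, a, F, h1, h2, h3⟩ h
        exact ⟨E, i, a, F, h1, h2, fun z' hz => h (h3 z' hz)⟩
      inter_sets := by
        rintro X Y ⟨E, i, a, F, h1, h2, h3⟩ ⟨E', i', a', F', h1', h2', h3'⟩
        refine ⟨E × E', inferInstance, (a, a'), _, h1.prod h1',
          (h2.comap (b := (a, a')) (g := Prod.fst) (f := fun z => z) .id' .fst).and
          (h2'.comap (b := (a, a')) (g := Prod.snd) (f := fun z => z) .id' .snd),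
          fun z' hz => ⟨h3 z' hz.1, h3' z' hz.2⟩⟩ }
  have : ℱ.NeBot := by
    refine Filter.neBot_iff.2 fun h0 => ?_
    have : (∅ : Set T) ∈ ℱ := h0 ▸ Filter.mem_bot
    obtain ⟨E, i, a, F, h1, h2, h3⟩ := this
    obtain ⟨z', hz'⟩ := hM.stp_ext (h a h1) z
    exact h3 z' (hz'.map (f := fun w : T × S => (w.2, w.1)) (g := fun w => w) (by fun_prop) .id' _ h2)
  obtain ⟨z', hz'⟩ := hM.sat n ℱ
  refine ⟨z', fun E _ a ha F hF => ?_⟩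
  exact hz' (fun w : T × ((S × T) × S) × E => F ((w.2.1.1, (w.2.1.2, w.1)), w.2.2))
    (hF.dfn.comp (by fun_prop)) (((x, z), y), a) (hn.prod (ha.mono (hA.trans (hM.mono n.zero_le))))
    ⟨E, _, a, F, ha, hF, fun _ h => h⟩

theorem stpA_of_ind (hM : Monster L lev) {β : B} {a : E} {x x' : S} (hs : Stp (β, a) x x')
    (h : IndA L A x (β, a)) (h' : IndA L A x' (β, a)) : StpA L A (β, x) (β, x') := by
  intro E' _ a' ha'
  have h1 : Stp (a', β) x x' := (hM.stp_of_ind hs (h a' ha') (h' a' ha')).of_dcl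
    (Coord.dcl (f := fun z : (B × E) × E' => (z.2, z.1.1)) (by fun_prop) _)
  exact h1.pair.map (f := fun w : S × B => (w.2, w.1)) (g := fun w => w) (by fun_prop) .id'

theorem exists_indA_base (hM : Monster L lev) (A : Set C) (x : S) (e : E) :
    ∃ (D : Type u) (_ : DSort L C D) (a : D), Rat L A a ∧ IndA L A x (e, a) := by
  obtain ⟨o, ⟨D, i, a, ha, ho⟩, hmin⟩ := exists_min_ordinal (K := fun o =>
    ∃ (D : Type u) (_ : DSort L C D) (a : D), Rat L A a ∧ rk x (e, a) = o) (by
      obtain ⟨E, i, a, ha⟩ := exists_ratA L A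
      exact ⟨_, E, i, a, ha, rfl⟩)
  refine ⟨D, i, a, ha, fun D' _ a' ha' => ?_⟩
  exact hM.ind_of_frank_le (g := (e, (a, a'))) (ho.trans_le (hmin _ ⟨_, _, _, ha.prod ha', rfl⟩))
    (Coord.dcl (f := fun z : E × D × D' => (z.1, z.2.1)) (by fun_prop) _)
    (Coord.dcl (f := fun z : E × D × D' => z.2.2) (by fun_prop) _)

end Monster

/-- Conditions which hold for every realization of the type of `(x, b, f)` independent from
a given element. -/
def Forced (L : FirstOrder.Language.{u, u}) (C : Type u) [L.Structure C] [DSort L C S]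
    [DSort L C B] [DSort L C R] [DSort L C E] (x : S) (b : B) (f : R)
    (Y : ((S × B) × R) × E → Prop) : Prop :=
  IsDfn L C Y ∧ ∀ x' b' f' g, TpEq L C ((x', b'), f') ((x, b), f) → Indep L C x' b' g →
    Y (((x', b'), f'), g)

theorem Monster.exists_of_forced (hM : Monster L lev) (n : ℕ) (x : S) (b : B) (f f' : R)
    (P : ∀ ⦃G : Type u⦄ [DSort L C G], G → Prop)
    (hP0 : ∃ (G : Type u) (_ : DSort L C G) (g : G), P g)
    (hP : ∀ ⦃G : Type u⦄ [DSort L C G] (g : G) ⦃G' : Type u⦄ [DSort L C G'] (g' : G'), P g → P g' →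
      ∃ (D : Type u) (_ : DSort L C D) (d : D) (p : D → G) (q : D → G'), P d ∧
        Crd p ∧ Crd q ∧ p d = g ∧ q d = g')
    (hf : Rat L (lev n) f') (hr : ∀ ⦃G : Type u⦄ [DSort L C G] (g : G), P g → Rat L (lev n) g)
    (h : ∀ ⦃G : Type u⦄ [DSort L C G] (g : G) (Y : ((S × B) × R) × G → Prop), P g →
      Forced L C x b f Y → ∃ x' b', Y (((x', b'), f'), g)) :
    ∃ x' b', Tp ((x', b'), f') ((x, b), f) ∧
      ∀ ⦃G : Type u⦄ [DSort L C G] (g : G), P g → Ind x' b' g := by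
  let ℱ : Filter (S × B) :=
    { sets := {X | ∃ (G : Type u) (_ : DSort L C G) (g : G) (Y : ((S × B) × R) × G → Prop),
        P g ∧ Forced L C x b f Y ∧ ∀ z, Y ((z, f'), g) → z ∈ X}
      univ_sets := by
        obtain ⟨G, _, g, hg⟩ := hP0
        exact ⟨G, _, g, _, hg, ⟨.const True, fun _ _ _ _ _ _ => trivial⟩, fun _ _ => trivial⟩
      sets_of_superset := by
        rintro X Y ⟨E, i, a, F, h1, h2, h3⟩ h
        exact ⟨E, i, a, F, h1, h2, fun z' hz => h (h3 z' hz)⟩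
      inter_sets := by
        rintro X X' ⟨G, i, g, Y, h1, h2, h3⟩ ⟨G', i', g', Y', h1', h2', h3'⟩
        obtain ⟨D, _, d, p, q, hd, hp, hq, rfl, rfl⟩ := hP g g' h1 h1'
        refine ⟨D, inferInstance, d, fun w => Y (w.1, p w.2) ∧ Y' (w.1, q w.2), hd,
          ⟨(h2.1.comp (f := fun w : ((S × B) × R) × D => (w.1, p w.2)) (by fun_prop)).and
          (h2'.1.comp (f := fun w : ((S × B) × R) × D => (w.1, q w.2)) (by fun_prop)), ?_⟩,
          fun z hz => ⟨h3 z hz.1, h3' z hz.2⟩⟩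
        exact fun x' b' f' g ht hi => ⟨h2.2 _ _ _ _ ht (hM.ind_map hi hp),
          h2'.2 _ _ _ _ ht (hM.ind_map hi hq)⟩ }
  have : ℱ.NeBot := by
    refine Filter.neBot_iff.2 fun h0 => ?_
    have : (∅ : Set (S × B)) ∈ ℱ := h0 ▸ Filter.mem_bot
    obtain ⟨G, i, g, Y, h1, h2, h3⟩ := this
    obtain ⟨x', b', h'⟩ := h g Y h1 h2
    exact h3 _ h'
  obtain ⟨⟨x', b'⟩, hx'⟩ := hM.sat n ℱ
  have key : ∀ ⦃G : Type u⦄ [DSort L C G] (g : G) (Y : ((S × B) × R) × G → Prop), P g →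
      Forced L C x b f Y → Y (((x', b'), f'), g) := by
    intro G _ g Y hg hY
    exact hx' (fun w : (S × B) × (R × G) => Y ((w.1, w.2.1), w.2.2)) (hY.1.comp (by fun_prop))
      (f', g) (hf.prod (hr g hg)) ⟨G, _, g, Y, hg, hY, fun _ h => h⟩
  have ht : Tp ((x', b'), f') ((x, b), f) := by
    obtain ⟨G, _, g, hg⟩ := hP0
    refine TpEq.symm fun Z hZ hz => ?_
    exact key g (fun w => Z w.1) hg ⟨hZ.comp (by fun_prop), fun _ _ _ _ h _ => h.symm Z hZ hz⟩
  refine ⟨x', b', ht, fun G _ g hg Y hY => ?_⟩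
  obtain ⟨D, hD, hD'⟩ := hM.exists_defSch x b hY
  rw [hD' x' b' (ht.symm.map .fst)]
  refine key g (fun w : ((S × B) × R) × G => Y (w.1.1.1, w.2, w.1.1.2) ↔ D (w.1.1, w.2)) hg
    ⟨(hY.comp (f := fun w : ((S × B) × R) × G => (w.1.1.1, w.2, w.1.1.2)) (by fun_prop)).iff
      (hD.comp (f := fun w : ((S × B) × R) × G => (w.1.1, w.2)) (by fun_prop)), ?_⟩
  intro x'' b'' f'' g'' h1 h2
  rw [← hD' x'' b'' (h1.symm.map .fst)]
  exact h2 Y hY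

end Benign

namespace Benign

variable {L : FirstOrder.Language.{u, u}} {C : Type u} [L.Structure C] {lev : ℕ → Set C}
variable {S T R E B B' : Type u} [DSort L C S] [DSort L C T] [DSort L C R] [DSort L C E]
  [DSort L C B] [DSort L C B']
local notation "Dfn" => IsDfn L C
local notation "Crd" => Coord L C
local notation "Tp" => TpEq L C
local notation "FER" => IsFER L C
local notation "Stp" => StpEq L C
local notation "DS" => DefSch L C
local notation "Ind" => Indep L C
local notation "rk" => frank L C

variable {A MM : Set C}

/-- A saturated model with a distinguished elementary submodel and a distinguished subset of it
such that the submodel realizes all strong types over its finite subsets. -/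
structure BPair (L : FirstOrder.Language.{u, u}) {C : Type u} [L.Structure C] (lev : ℕ → Set C)
    (A MM : Set C) : Prop where
  monster : Monster L lev
  sub : A ⊆ MM
  sub_lev : MM ⊆ lev 0
  ms : ∀ {S E : Type u} [DSort L C S] [DSort L C E] {e : E}, Rat L MM e → ∀ x : S,
    ∃ x' : S, Rat L MM x' ∧ StpEq L C e x x'

theorem IndA.transport (hM : Monster L lev) {x y : S} {α β : B} {a : E}
    (h : StpA L A (β, x) (α, y)) (ha : Rat L A a) (hi : IndA L A x (β, a)) : IndA L A y (α, a) := by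
  intro E' _ a' ha'
  refine hM.ind_transport ?_ (hi a' ha')
  exact (h.tp (ha.prod ha')).map
    (f := fun z : (B × S) × E × E' => ((z.1.2, z.2.2), (z.1.1, z.2.1))) (by fun_prop)

theorem Monster.indA_of_min (hM : Monster L lev) {x : S} {β : B} {a : E} (ha : Rat L A a)
    (h : ∀ ⦃E' : Type u⦄ [DSort L C E'] (a' : E'), Rat L A a' → rk x (β, a) ≤ rk x (β, a')) :
    IndA L A x (β, a) := fun E' _ a' ha' =>
  hM.ind_of_frank_le (g := (β, (a, a'))) (h _ (ha.prod ha'))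
    (Coord.dcl (f := fun z : B × E × E' => (z.1, z.2.1)) (by fun_prop) _)
    (Coord.dcl (f := fun z : B × E × E' => z.2.2) (by fun_prop) _)

namespace BPair

theorem sub_lev' (hB : BPair L lev A MM) : A ⊆ lev 0 := hB.sub.trans hB.sub_lev

theorem exists_copyable (hB : BPair L lev A MM)
    {β α : B} (hβ : Rat L MM β) (hα : Rat L MM α) (hs : StpA L A β α) (b : S) :
    ∃ b', Rat L MM b' ∧ Stp β b b' ∧ ∃ d, Rat L MM d ∧ StpA L A (β, b') (α, d) := by
  have hM := hB.monster
  obtain ⟨o, ho, hmin⟩ := exists_min_ordinal (K := fun o =>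
    (∃ b', Rat L MM b' ∧ Stp β b b' ∧ ∃ (E : Type u) (_ : DSort L C E) (a : E), Rat L A a ∧
      rk b' (β, a) = o) ∨
    ∃ y, Rat L MM y ∧ (∃ x, StpA L A (α, y) (β, x) ∧ Stp β x b) ∧
      ∃ (E : Type u) (_ : DSort L C E) (a : E), Rat L A a ∧ rk y (α, a) = o) (by
    obtain ⟨E, i, a, ha⟩ := exists_ratA L A
    obtain ⟨b', h1, h2⟩ := hB.ms hβ b
    exact ⟨_, .inl ⟨b', h1, h2, E, i, a, ha, rfl⟩⟩)
  rcases ho with ⟨b', h1, h2, E, i, a, ha, ho⟩ | ⟨y, h1, ⟨x, h2, h3⟩, E, i, a, ha, ho⟩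
  · obtain ⟨y, hy⟩ := hM.stpA_ext hB.sub_lev' hs b'
    obtain ⟨y', h3, h4⟩ := hB.ms (hα.prod (ha.mono hB.sub)) y
    have r1 : rk y (α, a) = o := by
      rw [← ho]
      exact hM.frank_congr ((hy.tp ha).symm.map
        (f := fun z : (B × S) × E => (z.1.2, (z.1.1, z.2))) (by fun_prop))
    have r2 : rk y' (α, a) = o := (hM.frank_congr h4.tp.symm).trans r1
    obtain ⟨x, hx⟩ := hM.stpA_ext hB.sub_lev' hy.symm y'
    have h5 : Stp β b' x := (h4.of_dcl (Coord.dcl .fst _)).transport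
      (hx.tp'.map (f := fun z : (B × S) × S => ((z.1.2, z.2), z.1.1)) (by fun_prop))
    have h6 : StpA L A (α, y') (β, x) :=
      hx.map (f := fun z : (B × S) × S => (z.1.1, z.2)) (by fun_prop)
    have h7 : IndA L A y' (α, a) := hM.indA_of_min ha fun E' _ a' ha' => by
      rw [r2]
      exact hmin _ (.inr ⟨y', h3, ⟨x, h6, (h2.trans h5).symm⟩, _, _, _, ha', rfl⟩)
    have h8 : IndA L A b' (β, a) := hM.indA_of_min ha fun E' _ a' ha' => by
      rw [ho]
      exact hmin _ (.inl ⟨b', h1, h2, _, _, _, ha', rfl⟩)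
    exact ⟨b', h1, h2, y', h3, hy.trans (hM.stpA_of_ind h4 (h8.transport hM hy ha) h7)⟩
  · obtain ⟨b', h4, h5⟩ := hB.ms (hβ.prod (ha.mono hB.sub)) x
    have r1 : rk x (β, a) = o := by
      rw [← ho]
      exact hM.frank_congr ((h2.tp ha).symm.map
        (f := fun z : (B × S) × E => (z.1.2, (z.1.1, z.2))) (by fun_prop))
    have r2 : rk b' (β, a) = o := (hM.frank_congr h5.tp.symm).trans r1
    have h6 : Stp β b b' := h3.symm.trans (h5.of_dcl (Coord.dcl .fst _))
    have h7 : IndA L A y (α, a) := hM.indA_of_min ha fun E' _ a' ha' => by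
      rw [ho]
      exact hmin _ (.inr ⟨y, h1, ⟨x, h2, h3⟩, _, _, _, ha', rfl⟩)
    have h8 : IndA L A b' (β, a) := hM.indA_of_min ha fun E' _ a' ha' => by
      rw [r2]
      exact hmin _ (.inl ⟨b', h4, h6, _, _, _, ha', rfl⟩)
    exact ⟨b', h4, h6, y, h1, (h2.trans (hM.stpA_of_ind h5 (h7.transport hM h2 ha) h8)).symm⟩

end BPair

/-- Every element of rank less than `θ` can be copied along elementary maps. -/
def Low (L : FirstOrder.Language.{u, u}) {C : Type u} [L.Structure C]
    (A MM : Set C) (θ : Ordinal.{u + 1}) : Prop :=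
  ∀ ⦃B S E : Type u⦄ [DSort L C B] [DSort L C S] [DSort L C E] (α β : B) (c : S) (a : E),
    Rat L MM α → Rat L MM β → Rat L MM c → Rat L A a → StpA L A α β → frank L C c (α, a) < θ →
    ∃ d, Rat L MM d ∧ StpA L A (α, c) (β, d)

/-- A failure of copying of minimal rank. -/
structure Root (L : FirstOrder.Language.{u, u}) {C : Type u} [L.Structure C] (lev : ℕ → Set C)
    (A MM : Set C) (θ : Ordinal.{u + 1}) [DSort L C S] [DSort L C R] [DSort L C E]
    (pr : S → E) (α β : S) (c : R) : Prop where
  bp : BPair L lev A MM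
  low : Low L A MM θ
  coord : Coord L C pr
  rat_left : Rat L MM α
  rat_right : Rat L MM β
  rat_elt : Rat L MM c
  stp : StpA L A α β
  no_copy : ¬∃ d, Rat L MM d ∧ StpA L A (α, c) (β, d)
  rank : frank L C c α = θ
  pr_eq : pr β = pr α
  rat_pr : Rat L A (pr α)
  ind_left : IndA L A α (pr α)
  ind_right : IndA L A β (pr α)

/-- An extension of a pair of conjugate tuples. -/
structure Ext (L : FirstOrder.Language.{u, u}) {C : Type u} [L.Structure C]
    (A MM : Set C) [DSort L C S] [DSort L C B] (α β : S) (π : B → S) (α' β' : B) : Prop where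
  coord : Coord L C π
  left : π α' = α
  right : π β' = β
  rat_left : Rat L MM α'
  rat_right : Rat L MM β'
  stp : StpA L A α' β'

theorem Ext.snoc {α β : S} {π : B → S} {α' β' : B} (h : Ext L A MM α β π α' β') {x y : T}
    (hx : Rat L MM x) (hy : Rat L MM y) (hs : StpA L A (α', x) (β', y)) :
    Ext L A MM α β (fun z : B × T => π z.1) (α', x) (β', y) :=
  ⟨h.coord.comp .fst, h.left, h.right, h.rat_left.prod hx, h.rat_right.prod hy, hs⟩

namespace Root
variable {θ : Ordinal.{u + 1}} {pr : S → E} {α β : S} {c : R}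

theorem ext_refl (hR : Root L lev A MM θ pr α β c) : Ext L A MM α β (fun z => z) α β :=
  ⟨.id', rfl, rfl, hR.rat_left, hR.rat_right, hR.stp⟩

theorem rank_le (hR : Root L lev A MM θ pr α β c)
    {π : B → S} {α' β' : B} (h : Ext L A MM α β π α' β') {a : T} (ha : Rat L A a) :
    θ ≤ rk c (α', a) := by
  by_contra hlt
  obtain ⟨d, h1, h2⟩ := hR.low α' β' c a h.rat_left h.rat_right hR.rat_elt ha h.stp (not_le.1 hlt)
  have := h.coord
  have h3 := h2.map (f := fun z : B × R => (π z.1, z.2)) (by fun_prop)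
  simp only [h.left, h.right] at h3
  exact hR.no_copy ⟨d, h1, h3⟩

theorem ind_ext (hR : Root L lev A MM θ pr α β c)
    {π : B → S} {α' β' : B} (h : Ext L A MM α β π α' β') {a : T} (ha : Rat L A a) :
    Ind c α (α', a) := by
  refine hR.bp.monster.ind_of_frank_le (hR.rank.trans_le (hR.rank_le h ha)) ?_
    (Coord.dcl .id' _)
  have := h.coord
  have h' := Coord.dcl (f := fun z : B × T => π z.1) (by fun_prop) (α', a)
  simpa only [h.left] using h'

theorem ind_ext' (hR : Root L lev A MM θ pr α β c)
    {π : B → S} {α' β' : B} (h : Ext L A MM α β π α' β') : Ind c α α' := by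
  obtain ⟨E, _, a, ha⟩ := exists_ratA L A
  exact hR.bp.monster.ind_left (hR.ind_ext h ha)

/-- Elements of small rank are independent from realizations of the minimal type. -/
theorem ind_of_rank_lt (hR : Root L lev A MM θ pr α β c)
    {v : R} {ν : S} {b : B} {d : T} (ht : Tp (v, ν) (c, α)) (hi : Ind v ν b)
    (hd : rk d (ν, b) < θ) : Ind v (ν, b) d := by
  have hM := hR.bp.monster
  obtain ⟨⟨b', d'⟩, h1⟩ := hM.tp_ext ht (b, d)
  obtain ⟨b0, hb0, h2, β0, hβ0, h3⟩ := hR.bp.exists_copyable hR.rat_left hR.rat_right hR.stp b'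
  have hE := hR.ext_refl.snoc hb0 hβ0 h3
  have i0 : Ind c α b0 := hM.ind_map (hR.ind_ext' hE) .snd
  have i1 : Ind c α b' := hM.ind_transport (h1.map
    (f := fun z : (B × T) × R × S => ((z.2.1, z.1.1), z.2.2)) (by fun_prop)) hi
  have t1 := hM.tp_of_ind h2 (hM.ind_symm i1) (hM.ind_symm i0)
  obtain ⟨d'', h4⟩ := hM.tp_ext t1 d'
  obtain ⟨d0, hd0, h5⟩ := hR.bp.ms ((hb0.prod hR.rat_elt).prod hR.rat_left) d''
  have t2 : Tp (d, ((b, v), ν)) (d0, ((b0, c), α)) :=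
    (h1.map (f := fun z : (B × T) × R × S => (z.1.2, ((z.1.1, z.2.1), z.2.2))) (by fun_prop)).trans
      (h4.trans h5.tp)
  have r1 : rk d0 (α, b0) < θ := by
    rwa [← hM.frank_congr (t2.map
      (f := fun z : T × (B × R) × S => (z.1, (z.2.2, z.2.1.1))) (by fun_prop))]
  obtain ⟨D, _, a, ha⟩ := exists_ratA L A
  obtain ⟨y, hy1, hy2⟩ := hR.low _ _ d0 a hE.rat_left hE.rat_right hd0 ha hE.stp
    ((hM.frank_le_of_coord Coord.fst rfl).trans_lt r1)
  have i2 := hR.ind_ext' (hE.snoc hd0 hy1 hy2)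
  have i3 : Ind c (α, b0) d0 := hM.ind_over i2 (Coord.dcl .fst _)
    (Coord.dcl (f := fun z : ((S × B) × T) × S => z.1.1) (by fun_prop) _)
    (Coord.dcl (f := fun z : ((S × B) × T) × S => z.1.2) (by fun_prop) _)
  exact hM.ind_transport (t2.symm.map
    (f := fun z : T × (B × R) × S => ((z.2.1.2, z.1), (z.2.2, z.2.1.1))) (by fun_prop)) i3

end Root
end Benign

namespace Benign

variable {L : FirstOrder.Language.{u, u}} {C : Type u} [L.Structure C] {lev : ℕ → Set C}
variable {S T R E B B' : Type u} [DSort L C S] [DSort L C T] [DSort L C R] [DSort L C E]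
  [DSort L C B] [DSort L C B']
local notation "Dfn" => IsDfn L C
local notation "Crd" => Coord L C
local notation "Tp" => TpEq L C
local notation "FER" => IsFER L C
local notation "Stp" => StpEq L C
local notation "DS" => DefSch L C
local notation "Ind" => Indep L C
local notation "rk" => frank L C

theorem exists_strong_rec {X : Type*} (f : ∀ n, (Fin n → X) → X) :
    ∃ y : ℕ → X, ∀ n, y n = f n fun j => y j :=
  ⟨WellFounded.fix (C := fun _ => X) Nat.lt_wfRel.wf fun n ih => f n fun j => ih j j.2,
    fun n => WellFounded.fix_eq _ _ n⟩

namespace Monster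

theorem ind_tuple (hM : Monster L lev) {y : ℕ → S} {b : B} {e : E}
    (h : ∀ n, Ind (y n) b (e, fun j : Fin n => y j)) (n : ℕ) : Ind (fun j : Fin n => y j) b e := by
  induction n with
  | zero =>
    refine hM.ind_symm (hM.ind_self ?_)
    have := Coord.dcl (L := L) (C := C) (f := fun _ : B => (fun j : Fin 0 => y j))
      ⟨fun k : Fin 0 × _ => k.1.elim0, fun v => funext fun j => j.elim0⟩ b
    exact this
  | succ n ih =>
    have h1 : Ind e b ((fun j : Fin n => y j), y n) :=
      hM.ind_trans (hM.ind_symm ih) (hM.ind_symm (hM.ind_right (hM.ind_map (h n)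
        (f := fun z : E × (Fin n → S) => (z.2, z.1)) (by fun_prop))))
    have h2 := hM.ind_map h1 (f := fun z : (Fin n → S) × S =>
      fun j : Fin (n + 1) => if hj : j.1 < n then z.1 ⟨j, hj⟩ else z.2) (by
        refine Coord.pi fun j => ?_
        by_cases hj : j.1 < n
        · simp only [hj, dite_true]
          fun_prop
        · simp only [hj, dite_false]
          fun_prop)
    refine hM.ind_symm ?_
    convert h2 using 2 with j
    by_cases hj : j.1 < n
    · simp [hj]
    · simp [hj, show (j : ℕ) = n by omega]

/-- A dependence of `x` on `a` over `b` is witnessed by a parameter that is recovered from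
independent conjugates of `x`. -/
theorem exists_canonical_parameter (hM : Monster L lev)
    {x : S} {b : B} {a : E} (hd : Dcl L C a b) (hx : ¬Ind x b a) :
    ∃ (N : ℕ) (Q : Type u) (_ : DSort L C Q) (mk : (Fin N → S) → Q) (w0 w : Fin N → S),
      Crd mk ∧ mk w0 = mk w ∧ (∀ j, Stp a x (w j)) ∧ Ind w a (x, w0) ∧ ¬Ind x b (mk w) ∧
      ∀ {R : Type u} [DSort L C R] (π : S → R), Crd π → Ind (π x) b a →
        Ind (fun j => π (w j)) b a := by
  obtain ⟨Y, hY, hYx⟩ : ∃ Y : S × E × B → Prop, Dfn Y ∧ ¬(Y (x, a, b) ↔ DS x b Y a) := by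
    by_contra hcon
    push Not at hcon
    exact hx fun Y hY => hcon Y hY
  -- the independent sequence
  choose! f hf1 hf2 using fun (n : ℕ) (t : Fin n → S) => hM.exists_ind x a (x, t)
  obtain ⟨y, hy⟩ := exists_strong_rec f
  have hy1 : ∀ n, Stp a x (y n) := fun n => by rw [hy]; exact hf1 _ _
  have hy2 : ∀ n, Ind (y n) a (x, fun j : Fin n => y j) := fun n => by rw [hy]; exact hf2 _ _
  have hev : ∀ g : E × B, ∃ n0, ∀ n, n0 ≤ n → Ind (y n) a g := by
    intro g
    obtain ⟨o, ⟨n0, ho⟩, hmin⟩ := exists_min_ordinal (K := fun o =>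
      ∃ n, rk g (a, fun j : Fin n => y j) = o) ⟨_, 0, rfl⟩
    have hres : ∀ m n (h : m ≤ n), Crd (fun z : E × (Fin n → S) =>
        (z.1, fun j : Fin m => z.2 (Fin.castLE h j))) := fun m n h => by fun_prop
    refine ⟨n0, fun n hn => ?_⟩
    have h1 : rk g (a, fun j : Fin n => y j) ≤ rk g (a, fun j : Fin (n + 1) => y j) :=
      ((hM.frank_le_of_coord (hres n0 n hn) rfl).trans_eq ho).trans (hmin _ ⟨_, rfl⟩)
    have h2 : Ind g (a, fun j : Fin n => y j) (y n) := by
      refine hM.ind_of_frank_le h1 ?_ ?_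
      · exact (hres n (n + 1) n.le_succ).dcl (a, fun j : Fin (n + 1) => y j)
      · exact Coord.dcl (f := fun z : E × (Fin (n + 1) → S) => z.2 (Fin.last n)) (by fun_prop)
          (a, fun j : Fin (n + 1) => y j)
    exact hM.ind_map (hM.ind_trans (hM.ind_map (hy2 n) .snd) (hM.ind_symm h2)) .snd
  -- the two traces
  set Y2 : S × (E × B) × E → Prop := fun z => Y (z.1, z.2.1) with hY2
  set Y1 : S × (E × B) × B → Prop := fun z => Y (z.1, z.2.1) with hY1
  have hY2d : Dfn Y2 := hY.comp (by fun_prop)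
  have hY1d : Dfn Y1 := hY.comp (by fun_prop)
  have hne : ¬(DS x a Y2 (a, b) ↔ DS x b Y1 (a, b)) := by
    intro h
    refine hYx (Iff.trans ?_ h)
    exact hM.ind_self ((Coord.id'.dcl a).mk hd) Y2 hY2d
  have htr : ∀ g, DS x a Y2 g ↔ ∀ᶠ n in (Filter.hyperfilter ℕ : Filter ℕ), Y (y n, g) := by
    intro g
    obtain ⟨n0, hn0⟩ := hev g
    have h1 : ∀ᶠ n in (Filter.hyperfilter ℕ : Filter ℕ), n0 ≤ n :=
      Filter.hyperfilter_le_cofinite (by rw [Nat.cofinite_eq_atTop]; exact Filter.eventually_ge_atTop n0)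
    have h2 : ∀ᶠ n in (Filter.hyperfilter ℕ : Filter ℕ), (Y (y n, g) ↔ DS x a Y2 g) := by
      filter_upwards [h1] with n hn
      exact (hn0 n hn Y2 hY2d).trans (hM.defSch_congr_stp (hy1 n).symm hY2d g)
    rw [Filter.eventually_congr h2, Filter.eventually_const]
  obtain ⟨k, v, hv⟩ := ((hM.stab hY).precomp y _root_.id).exists_trace (Filter.hyperfilter ℕ)
  simp only [id_eq] at hv
  obtain ⟨N, hN⟩ : ∃ N, ∀ i, v i < N := ⟨Finset.univ.sup v + 1, fun i =>
    Nat.lt_succ_of_le (Finset.le_sup (Finset.mem_univ i))⟩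
  let F : (Fin N → Prop) → Prop := fun pat => ∃ g, DS x a Y2 g ∧ ∀ j : Fin N, Y (y j, g) ↔ pat j
  let Z : (E × B) × (Fin N → S) → Prop := fun z => F fun j => Y (z.2 j, z.1)
  have hZ : Dfn Z := IsDfn.bool (Y := fun (j : Fin N) (z : (E × B) × (Fin N → S)) =>
    Y (z.2 j, z.1)) (fun j => hY.comp (by fun_prop)) F
  set w0 : Fin N → S := fun j => y j
  have hZ0 : ∀ g, Z (g, w0) ↔ DS x a Y2 g := by
    refine fun g => ⟨fun ⟨g', h1, h2⟩ => ?_, fun h => ⟨g, h, fun _ => Iff.rfl⟩⟩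
    rw [htr] at h1 ⊢
    exact hv g' g (fun i h => (h2 ⟨v i, hN i⟩).1 h) h1
  obtain ⟨w, hw1, hw2⟩ := hM.exists_ind w0 a (x, w0)
  have hw3 : Ind w a x := hM.ind_left hw2
  have hZw : ∀ g, Z (g, w) ↔ DS x a Y2 g := by
    obtain ⟨G, hG, hG'⟩ := hM.exists_defSch x a hY2d
    have h0 : Dfn fun z : ((Fin N → S) × S) × E => ∀ g, Z (g, z.1.1) ↔ G ((z.1.2, z.2), g) :=
      .all (.iff (hZ.comp (f := fun z : (((Fin N → S) × S) × E) × (E × B) => (z.2, z.1.1.1))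
        (by fun_prop)) (hG.comp
        (f := fun z : (((Fin N → S) × S) × E) × (E × B) => ((z.1.1.2, z.1.2), z.2)) (by fun_prop)))
    have h1 := (hM.tp_of_ind hw1 (hM.ind_tuple hy2 N) hw3) _ h0 (fun g => by
      rw [hZ0, hG' x a (.refl _)])
    intro g
    rw [h1 g, hG' x a (.refl _)]
  let s : Setoid (Fin N → S) := ⟨fun w w' => ∀ g, Z (g, w) ↔ Z (g, w'), fun _ _ => Iff.rfl,
    fun h g => (h g).symm, fun h h' g => (h g).trans (h' g)⟩
  have hs : Dfn fun z : (Fin N → S) × (Fin N → S) => s z.1 z.2 :=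
    .all (.iff (hZ.comp (f := fun z : ((Fin N → S) × (Fin N → S)) × (E × B) => (z.2, z.1.1))
      (by fun_prop)) (hZ.comp (f := fun z : ((Fin N → S) × (Fin N → S)) × (E × B) => (z.2, z.1.2))
      (by fun_prop)))
  letI := DSort.quotient s hs
  have hmk : Crd (Quotient.mk s) := Coord.quotient_mk s hs
  refine ⟨N, Quotient s, inferInstance, Quotient.mk s, w0, w, hmk,
    Quotient.sound fun g => (hZ0 g).trans (hZw g).symm, fun j => (hy1 j).trans
      (hw1.map (f := fun w : Fin N → S => w j) (g := fun z => z) (by fun_prop) .id'), hw2, ?_, ?_⟩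
  · intro hind
    refine hne ?_
    generalize (a, b) = g
    set e := Quotient.mk s w with he
    obtain ⟨g', h1, h2⟩ := hM.exists_ind g (b, e) (x, a)
    have i1 : Ind x b g' := hM.ind_map (hM.ind_trans hind (hM.ind_symm (hM.ind_left h2))) .snd
    have i2 : Ind x a g' := by
      have i3 : Ind x a e := hM.ind_map (hM.ind_symm hw3) hmk
      have i4 : Ind g' ((b, e), a) x := hM.ind_right (hM.ind_map h2
        (f := fun z : S × E => (z.2, z.1)) (by fun_prop))
      have i5 : Ind x (a, e) g' := by
        refine hM.ind_of_dcl (hM.ind_symm i4) ?_ ?_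
        · exact Coord.dcl (f := fun z : (B × Quotient s) × E => (z.2, z.1.2)) (by fun_prop) _
        · exact (((Coord.dcl .fst _).trans hd).mk (Coord.dcl .snd _)).mk (Coord.dcl .fst _)
      exact hM.ind_map (hM.ind_trans i3 i5) .snd
    have e1 : DS x b Y1 g ↔ DS x b Y1 g' := by
      have h3 : Stp b g g' := h1.of_dcl (Coord.dcl .fst _)
      rw [hM.defSch_symm x b g hY1d, hM.defSch_symm x b g' hY1d]
      exact hM.defSch_congr_stp h3 (hY1d.comp (f := fun z : (E × B) × S × B => (z.2.1, z.1, z.2.2)) (by fun_prop)) x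
    have hZ' : Dfn fun z : (E × B) × Quotient s => ∃ w, Quotient.mk s w = z.2 ∧ Z (z.1, w) :=
      .ex (.and (.eq (f := fun z : ((E × B) × Quotient s) × (Fin N → S) => Quotient.mk s z.2)
        (hmk.comp .snd) (by fun_prop)) (hZ.comp
        (f := fun z : ((E × B) × Quotient s) × (Fin N → S) => (z.1.1, z.2)) (by fun_prop)))
    have hZ'' : ∀ g, (∃ w, Quotient.mk s w = e ∧ Z (g, w)) ↔ DS x a Y2 g := by
      intro g
      refine ⟨fun ⟨w', h3, h4⟩ => ?_, fun h => ⟨w, rfl, (hZw g).2 h⟩⟩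
      exact (hZw g).1 ((Quotient.exact h3 g).1 h4)
    have e2 : DS x a Y2 g ↔ DS x a Y2 g' := by
      rw [← hZ'' g, ← hZ'' g']
      exact (h1.tp.map (f := fun z : (E × B) × (B × Quotient s) => (z.1, z.2.2))
        (by fun_prop)).iff hZ'
    rw [e1, e2]
    exact (i2 Y2 hY2d).symm.trans (i1 Y1 hY1d)
  · intro R _ π hπ hi
    have hcong : ∀ {W : Type u} [DSort L C W] {u u' : W}, Stp a u u' →
        Tp ((u, a), b) ((u', a), b) := fun h =>
      (h.of_dcl ((Coord.id'.dcl a).mk hd)).tp.map (f := fun z : _ × E × B => ((z.1, z.2.1), z.2.2))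
        (by fun_prop)
    have h1 : ∀ n, Ind (π (y n)) b (a, fun j : Fin n => π (y j)) := by
      intro n
      refine hM.ind_trans (hM.ind_transport (hcong ((hy1 n).map hπ .id')) hi) ?_
      refine hM.ind_of_dcl (b := a) ?_ (hd.mk (Coord.id'.dcl a)) (Coord.dcl .snd _)
      exact hM.ind_map_left (hM.ind_map (hy2 n)
        (f := fun z : S × (Fin n → S) => fun j => π (z.2 j)) (by fun_prop)) hπ
    exact hM.ind_transport (hcong (hw1.map (f := fun w : Fin N → S => fun j => π (w j))
      (g := fun z => z) (by fun_prop) .id')) (hM.ind_tuple h1 N)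

end Monster
end Benign

namespace Benign

variable {L : FirstOrder.Language.{u, u}} {C : Type u} [L.Structure C] {lev : ℕ → Set C}
variable {S T R E B B' : Type u} [DSort L C S] [DSort L C T] [DSort L C R] [DSort L C E]
  [DSort L C B] [DSort L C B']
local notation "Dfn" => IsDfn L C
local notation "Crd" => Coord L C
local notation "Tp" => TpEq L C
local notation "FER" => IsFER L C
local notation "Stp" => StpEq L C
local notation "DS" => DefSch L C
local notation "Ind" => Indep L C
local notation "rk" => frank L C

variable {A MM : Set C} {Q W : Type u} [DSort L C Q] [DSort L C W]

/-- The configuration obtained by analysing a failure of copying of minimal rank. -/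
structure Config (L : FirstOrder.Language.{u, u}) {C : Type u} [L.Structure C]
    (A MM : Set C) [DSort L C S] [DSort L C R] [DSort L C E] [DSort L C Q] [DSort L C W]
    (pr : S → E) (α β : S) (c : R) {N : ℕ} (mk : (Fin N → S) × (Fin N → R) → Q) (d : R)
    (m : Fin N → S) (δ : Fin N → R) (b : Fin N → W) (u : Fin N → R) (e : Q) : Prop where
  coord : Coord L C mk
  no_ind : ∀ v, Rat L MM v → StpEq L C β v d → ¬IndA L A v β
  ind_m : Indep L C m (pr α) (mk (m, δ), (β, d))
  tp : ∀ j, TpEq L C (δ j, m j) (c, α)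
  tp' : TpEq L C (d, β) (c, α)
  stp_u : ∀ j, StpEq L C β (u j) d
  ind_u : ∀ j, Indep L C (u j) β (m j, b j)
  ind_δ : ∀ j, Indep L C (δ j) (m j) (β, b j)
  not_ind_u : ∀ j, ¬Indep L C (u j) (β, (m j, b j)) (δ j)
  rat : Rat L MM e
  stp : StpEq L C (pr α) e (mk (m, δ))
  not_ind : ¬Indep L C c α e

namespace Root
variable {θ : Ordinal.{u + 1}} {pr : S → E} {α β : S} {c : R}

theorem dcl_right (hR : Root L lev A MM θ pr α β c) : Dcl L C β (pr α) := hR.pr_eq ▸ hR.coord.dcl β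

theorem exists_no_ind (hR : Root L lev A MM θ pr α β c)
    : ∃ d, Rat L MM d ∧ Stp (pr α) (α, c) (β, d) ∧ Tp (d, β) (c, α) ∧
    ∀ v, Rat L MM v → Stp β v d → ¬IndA L A v β := by
  have hM := hR.bp.monster
  obtain ⟨d, hd⟩ := hM.stpA_ext hR.bp.sub_lev' hR.stp c
  obtain ⟨d0, hd0, hs⟩ := hR.bp.ms hR.rat_right d
  have hd1 : Stp (pr α) (α, c) (β, d0) := (hd _ hR.rat_pr).trans
    ((StpEq.pair (c := β) (hs.of_dcl (hR.dcl_right.mk (Coord.id'.dcl β)))).map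
      (f := fun z : R × S => (z.2, z.1)) (g := fun z => z) (by fun_prop) .id')
  refine ⟨d0, hd0, hd1, hd1.symm.tp.map (f := fun z : (S × R) × E => (z.1.2, z.1.1))
    (by fun_prop), ?_⟩
  intro v h1 h2' h3
  have h2 : Stp β v d := h2'.trans hs.symm
  refine hR.no_copy ⟨v, h1, hd.trans ?_⟩
  have hdc : Dcl L C β (β, pr α) := (Coord.id'.dcl β).mk hR.dcl_right
  have hbase : ∀ {x : R}, IndA L A x β → IndA L A x (β, pr α) := fun h _ _ a ha =>
    hM.ind_of_dcl (h a ha) hdc (Coord.dcl .fst _)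
  refine hM.stpA_of_ind (a := pr α) (h2.symm.of_dcl hdc) (hbase ?_) (hbase h3)
  intro _ _ a ha
  refine hM.ind_transport ((hd.tp ha).map (f := fun z : (S × R) × _ => ((z.1.2, z.2), z.1.1))
    (by fun_prop)) (hM.ind_map (hR.ind_ext hR.ext_refl ha) .snd)

theorem exists_config (hR : Root L lev A MM θ pr α β c)
    : ∃ (N : ℕ) (Q W : Type u) (_ : DSort L C Q) (_ : DSort L C W)
    (mk : (Fin N → S) × (Fin N → R) → Q) (d : R) (m : Fin N → S) (δ : Fin N → R) (b : Fin N → W)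
    (u : Fin N → R) (e : Q), Config L A MM pr α β c mk d m δ b u e := by
  have hM := hR.bp.monster
  obtain ⟨d, hdM, hd, htp, hno⟩ := hR.exists_no_ind
  have hdr := hR.dcl_right
  have hββ : Dcl L C β (pr α, β) := hdr.mk (Coord.id'.dcl β)
  -- a finite part of `A` over which `(β, d)` is free from `A`
  obtain ⟨D, _, a', ha', hind⟩ := hM.exists_indA_base A (β, d) (pr α)
  set a := (pr α, a') with ha
  have haA : Rat L A a := hR.rat_pr.prod ha'
  have hda : Dcl L C a (pr α) := Coord.dcl .fst _
  have hnot : ¬Ind (β, d) (pr α) a := by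
    intro h
    refine hno d hdM (.refl _ _) fun D' _ a'' ha'' => ?_
    have i1 : Ind (β, d) (pr α) a'' := by
      refine hM.ind_map (hM.ind_trans h (hM.ind_of_dcl (hind a'' ha'') ?_ ?_)) .snd
      · exact hda.mk (Coord.id'.dcl a)
      · exact Coord.dcl .snd _
    exact hM.ind_symm (hM.ind_over (hM.ind_symm i1) hdr
      (Coord.dcl (f := fun z : (S × R) × E => z.1.1) (by fun_prop) _)
      (Coord.dcl (f := fun z : (S × R) × E => z.1.2) (by fun_prop) _))
  obtain ⟨N, Q, _, mk, w0, w, hmk, hww, hw1, hw2, hw3, hw4⟩ :=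
    hM.exists_canonical_parameter hda hnot
  set mk' : (Fin N → S) × (Fin N → R) → Q := fun z => mk fun j => (z.1 j, z.2 j) with hmk'
  have hmkc : Crd mk' := hmk.comp (by fun_prop)
  set m : Fin N → S := fun j => (w j).1
  set δ : Fin N → R := fun j => (w j).2
  have he : mk' (m, δ) = mk w := rfl
  rw [← he] at hw3
  set e := mk' (m, δ) with he'
  have hβa : Ind β (pr α) a := hR.ind_right a haA
  have hm : Ind m (pr α) (e, (β, d)) := by
    have h1 : Ind m (pr α) a := hw4 Prod.fst .fst hβa
    have h2 : Ind m a (e, (β, d)) := by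
      have h3 := hM.ind_map (hM.ind_map_left hw2 (f := fun w j => (w j).1) (by fun_prop))
        (f := fun z : (S × R) × (Fin N → S × R) => (mk z.2, z.1)) (by fun_prop)
      rwa [hww] at h3
    refine hM.ind_map (hM.ind_trans h1 (hM.ind_of_dcl h2 ?_ ?_)) .snd
    · exact hda.mk (Coord.id'.dcl a)
    · exact Coord.dcl .snd _
  have hβe : Ind β (pr α) e := by
    have h2 : Ind β a e := hM.ind_map_left (hM.ind_map (hM.ind_symm (hM.ind_left hw2)) hmk) .fst
    refine hM.ind_map (hM.ind_trans hβa (hM.ind_of_dcl h2 ?_ ?_)) .snd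
    · exact hda.mk (Coord.id'.dcl a)
    · exact Coord.dcl .snd _
  have hde : ¬Ind d β e := by
    intro h
    refine hw3 (hM.ind_symm (hM.ind_trans (hM.ind_symm hβe) (hM.ind_of_dcl (hM.ind_symm h) hββ ?_)))
    exact Coord.dcl .snd _
  have hδ : ∀ j, Tp (δ j, m j) (c, α) := fun j => (((hw1 j).tp.map
    (f := fun z : (S × R) × (E × D) => (z.1.2, z.1.1)) (by fun_prop)).symm).trans htp
  have hmδ : ∀ j j', Stp β (m j, δ j) (m j', δ j') := by
    intro j j'
    have h1 : ∀ j, Ind (m j, δ j) a (β, d) := fun j => hM.ind_left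
      (hM.ind_map_left hw2 (f := fun w : Fin N → S × R => w j) (by fun_prop))
    have h2 : Stp (a, (β, d)) (m j, δ j) (m j', δ j') :=
      hM.stp_of_ind ((hw1 j).symm.trans (hw1 j')) (h1 j) (h1 j')
    exact h2.of_dcl (Coord.dcl (f := fun z : (E × D) × (S × R) => z.2.1) (by fun_prop) _)
  -- the first coordinate of `δ` that depends on `d`
  have hdm : Ind d β m := hM.ind_symm (hM.ind_over hm hdr
    (Coord.dcl (f := fun z : (Q × (S × R)) × E => z.1.2.1) (by fun_prop) _)
    (Coord.dcl (f := fun z : (Q × (S × R)) × E => z.1.2.2) (by fun_prop) _))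
  obtain ⟨k, hk1, hk2⟩ : ∃ k : Fin N,
      Ind d β (m, fun i : Fin k => δ (Fin.castLE k.2.le i)) ∧
      ¬Ind d (β, (m, fun i : Fin k => δ (Fin.castLE k.2.le i))) (δ k) := by
    by_contra hcon
    push Not at hcon
    have key : ∀ k (hk : k ≤ N), Ind d β (m, fun i : Fin k => δ (Fin.castLE hk i)) := by
      intro k
      induction k with
      | zero =>
        intro hk
        exact hM.ind_map hdm (f := fun m : Fin N → S => (m, fun i : Fin 0 => δ (Fin.castLE hk i)))
          (.mk .id' ⟨fun k : Fin 0 × _ => k.1.elim0, fun v => funext fun j => j.elim0⟩)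
      | succ k ih =>
        intro hk
        have h1 := hM.ind_map (hM.ind_trans (ih (by omega)) (hcon ⟨k, hk⟩ (ih (by omega))))
          (f := fun z : ((Fin N → S) × (Fin k → R)) × R => (z.1.1,
            fun j : Fin (k + 1) => if hj : j.1 < k then z.1.2 ⟨j, hj⟩ else z.2)) (by
            refine .mk (by fun_prop) (Coord.pi fun j => ?_)
            by_cases hj : j.1 < k
            · simp only [hj, dite_true]
              fun_prop
            · simp only [hj, dite_false]
              fun_prop)
        convert h1 using 3 with j
        by_cases hj : j.1 < k
        · simp [hj, Fin.castLE]
        · simp only [hj, dite_false]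
          congr 1
          ext
          simp
          omega
    exact hde (hM.ind_map (key N le_rfl) hmkc)
  set b0 := (m, fun i : Fin k => δ (Fin.castLE k.2.le i)) with hb0
  have hmk0 : Dcl L C (β, b0) (m k) :=
    Coord.dcl (f := fun z : S × (Fin N → S) × (Fin k → R) => z.2.1 k) (by fun_prop) _
  have i0 : Ind (δ k) (m k) (β, b0) := by
    refine hM.ind_of_frank_le (g := (β, b0)) ?_ hmk0 (Coord.id'.dcl _)
    rw [hM.frank_congr (hδ k), hR.rank]
    by_contra hlt
    exact hk2 (hR.ind_of_rank_lt htp hk1 (not_le.1 hlt))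
  choose z hz using fun j => hM.stp_ext (hmδ k j) (d, b0)
  obtain ⟨e', hE⟩ := hM.stp_ext hd.symm e
  obtain ⟨ec, hec1, hec2⟩ := hR.bp.ms ((hR.rat_left.prod hR.rat_elt).prod (hR.rat_pr.mono hR.bp.sub)) e'
  refine ⟨N, Q, _, _, inferInstance, mk', d, m, δ, fun j => (z j).2, fun j => (z j).1, ec,
    hmkc, hno, hm, hδ, htp, ?_, ?_, ?_, ?_, hec1, ?_, ?_⟩
  · exact fun j => ((hz j).map (f := fun z : (R × _) × (S × R) => z.1.1) (g := fun z => z)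
      (by fun_prop) .id').symm
  · refine fun j => hM.ind_transport ((hz j).tp.map (f := fun z : ((R × _) × (S × R)) × S =>
      ((z.1.1.1, (z.1.2.1, z.1.1.2)), z.2)) (by fun_prop)) ?_
    exact hM.ind_map hk1 (f := fun z : (Fin N → S) × (Fin k → R) => (z.1 k, z)) (by fun_prop)
  · refine fun j => hM.ind_transport ((hz j).tp.map (f := fun z : ((R × _) × (S × R)) × S =>
      ((z.1.2.2, (z.2, z.1.1.2)), z.1.2.1)) (by fun_prop)) i0
  · intro j h
    refine hk2 (hM.ind_of_dcl (hM.ind_transport ((hz j).tp.symm.map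
      (f := fun z : ((R × _) × (S × R)) × S =>
      ((z.1.1.1, z.1.2.2), (z.2, (z.1.2.1, z.1.1.2)))) (by fun_prop)) h) ?_ ?_)
    · exact Coord.dcl (f := fun z : S × S × ((Fin N → S) × (Fin k → R)) => (z.1, z.2.2)) (by fun_prop) _
    · exact (Coord.dcl .fst _).mk (hmk0.mk (Coord.dcl .snd _))
  · have h1 : Stp (pr α) e e' := hE.map (f := fun z : Q × (S × R) => z.1) (g := fun z => z)
      (by fun_prop) .id'
    exact (h1.trans (hec2.of_dcl (Coord.dcl .snd _))).symm
  · intro h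
    refine hde (hM.ind_transport (TpEq.symm ?_) h)
    refine (hE.tp.map (f := fun z : (Q × (S × R)) × E => ((z.1.2.2, z.1.1), z.1.2.1))
      (by fun_prop)).trans (hec2.tp.map (f := fun z : Q × (S × R) × E =>
      ((z.2.1.2, z.1), z.2.1.1)) (by fun_prop))

end Root
end Benign

namespace Benign

variable {L : FirstOrder.Language.{u, u}} {C : Type u} [L.Structure C] {lev : ℕ → Set C}
variable {S T R E B B' : Type u} [DSort L C S] [DSort L C T] [DSort L C R] [DSort L C E]
  [DSort L C B] [DSort L C B']
local notation "Dfn" => IsDfn L C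
local notation "Crd" => Coord L C
local notation "Tp" => TpEq L C
local notation "FER" => IsFER L C
local notation "Stp" => StpEq L C
local notation "DS" => DefSch L C
local notation "Ind" => Indep L C
local notation "rk" => frank L C

variable {A MM : Set C} {Q W : Type u} [DSort L C Q] [DSort L C W]

theorem Ext.trans {α β : S} {π : B → S} {α' β' : B} (h : Ext L A MM α β π α' β') {π' : B' → B}
    {α'' β'' : B'} (h' : Ext L A MM α' β' π' α'' β'') :
    Ext L A MM α β (fun z => π (π' z)) α'' β'' :=
  ⟨h.coord.comp h'.coord, by rw [h'.left, h.left], by rw [h'.right, h.right], h'.rat_left,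
    h'.rat_right, h'.stp⟩

namespace Root
variable {θ : Ordinal.{u + 1}} {pr : S → E} {α β : S} {c : R}
variable {N : ℕ} {mk : (Fin N → S) × (Fin N → R) → Q} {d : R}
    {m : Fin N → S} {δ : Fin N → R} {b : Fin N → W} {u : Fin N → R} {e : Q}

/-- A free extension by a copy of the parameters of the configuration. -/
theorem exists_candidate (hR : Root L lev A MM θ pr α β c) (hC : Config L A MM pr α β c mk d m δ b u e)
    {π : B → S} {α' β' : B} (h : Ext L A MM α β π α' β') :
    ∃ x y : (Fin N → S) × (Fin N → W),
      Ext L A MM α' β' (fun z : B × (Fin N → S) × (Fin N → W) => z.1) (α', x) (β', y) ∧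
      Stp β (m, b) y ∧ Ind y.1 (pr α) β' := by
  have hM := hR.bp.monster
  have hdβ : Dcl L C β' β := by
    have := h.coord.dcl β'
    rwa [h.right] at this
  obtain ⟨x, hx, hi⟩ := hM.exists_ind (m, b) β β'
  obtain ⟨y, hy, hxy, x', hx', hs⟩ := hR.bp.exists_copyable h.rat_right h.rat_left h.stp.symm x
  have hxy' : Stp β x y := hxy.of_dcl hdβ
  refine ⟨x', y, ⟨.fst, rfl, rfl, h.rat_left.prod hx', h.rat_right.prod hy, hs.symm⟩,
    hx.trans hxy', ?_⟩
  have h1 : Ind y β β' := by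
    have hπ := h.coord
    have t := hxy.tp.map (f := fun z : ((Fin N → S) × (Fin N → W)) × B => (z, π z.2)) (by fun_prop)
    rw [h.right] at t
    exact hM.ind_transport t hi
  have h2 : Ind y.1 (pr α) β := by
    have h3 : Ind m (pr β) β := by
      rw [hR.pr_eq]
      exact hM.ind_map hC.ind_m (f := fun z : Q × S × R => z.2.1) (by fun_prop)
    rw [← hR.pr_eq]
    have := hR.coord
    exact hM.ind_transport ((hx.trans hxy').tp.map
      (f := fun z : ((Fin N → S) × (Fin N → W)) × S => ((z.1.1, z.2), pr z.2)) (by fun_prop)) h3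
  have h3 : Ind y.1 β β' := hM.ind_map_left h1 .fst
  exact hM.ind_map (hM.ind_trans h2 (hM.ind_of_dcl h3 (hR.dcl_right.mk (Coord.id'.dcl β))
    (Coord.dcl .snd _))) .snd

/-- The element `f` is interpreted over a free copy of the parameters by a sequence of elements
of small rank. -/
theorem exists_low_seq (hR : Root L lev A MM θ pr α β c) (hC : Config L A MM pr α β c mk d m δ b u e)
    {β' : B} {m' : Fin N → S} {b' : Fin N → W} (hβ' : Rat L MM (m', b'))
    (hd : Dcl L C β' (β, (m', b'))) (hs : Stp β (m, b) (m', b')) {f : Q} (hf : Rat L MM f)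
    (hfe : Stp (pr α) f e) (hi : Ind f (pr α) m') :
    ∃ δ' : Fin N → R, Rat L MM δ' ∧ mk (m', δ') = f ∧ ∀ j : Fin N,
      ∃ (D : Type u) (_ : DSort L C D) (a : D), Rat L A a ∧
        rk (δ' j) ((β', fun i : Fin j => δ' (Fin.castLE j.2.le i)), a) < θ := by
  have hM := hR.bp.monster
  have hmkc := hC.coord
  have hprc := hR.coord
  obtain ⟨⟨δ₁, u₁⟩, H⟩ := hM.stp_ext hs (δ, u)
  have i1 : Ind m' (pr α) (mk (m', δ₁)) := by
    have h3 : Ind m (pr β) (mk (m, δ)) := by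
      rw [hR.pr_eq]
      exact hM.ind_map hC.ind_m (f := fun z : Q × S × R => z.1) (by fun_prop)
    rw [← hR.pr_eq]
    exact hM.ind_transport (H.tp.map
      (f := fun z : (((Fin N → R) × (Fin N → R)) × ((Fin N → S) × (Fin N → W))) × S =>
        ((z.1.2.1, mk (z.1.2.1, z.1.1.1)), pr z.2)) (by fun_prop)) h3
  have s1 : Stp (pr α) (mk (m', δ₁)) f := by
    have h1 : Stp (pr α) (mk (m, δ)) (mk (m', δ₁)) := (H.map
      (f := fun z : ((Fin N → R) × (Fin N → R)) × ((Fin N → S) × (Fin N → W)) =>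
        mk (z.2.1, z.1.1)) (g := fun z => z) (by fun_prop) .id').of_dcl hR.dcl_right
    exact h1.symm.trans (hC.stp.symm.trans hfe.symm)
  obtain ⟨δ₂, h2⟩ := hM.stp_ext (hM.stp_of_ind s1 (hM.ind_symm i1) hi) δ₁
  have hm' : Rat L MM m' := hβ'.map .fst
  have hb' : Rat L MM b' := hβ'.map .snd
  obtain ⟨δ', hδ', h3⟩ := hR.bp.ms (hm'.prod hf) δ₂
  have e2 : mk (m', δ₂) = f := by
    have h4 := h2.tp (fun z : ((Fin N → R) × Q) × (E × (Fin N → S)) => mk (z.2.2, z.1.1) = z.1.2)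
      (.eq (by fun_prop) (by fun_prop))
    exact h4 rfl
  have e3 : mk (m', δ') = f := by
    have h4 := h3.tp (fun z : (Fin N → R) × ((Fin N → S) × Q) => mk (z.2.1, z.1) = z.2.2)
      (.eq (by fun_prop) (by fun_prop))
    exact h4 e2
  have s2 : Stp m' δ₁ δ' := ((h2.map (f := fun z : (Fin N → R) × Q => z.1) (g := fun z => z)
    (by fun_prop) .id').of_dcl (Coord.dcl .snd _)).trans (h3.of_dcl (Coord.dcl .fst _))
  refine ⟨δ', hδ', e3, fun j => ?_⟩
  by_contra hcon
  push Not at hcon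
  have s3 : Stp (m' j) (δ₁ j) (δ' j) := (s2.map (f := fun z : Fin N → R => z j) (g := fun z => z)
    (by fun_prop) .id').of_dcl (Coord.dcl (f := fun z : Fin N → S => z j) (by fun_prop) _)
  have t1 : Tp (δ' j, m' j) (c, α) := s3.symm.tp.trans (TpEq.trans (H.tp.symm.map
    (f := fun z : (((Fin N → R) × (Fin N → R)) × ((Fin N → S) × (Fin N → W))) × S =>
        (z.1.1.1 j, z.1.2.1 j)) (by fun_prop)) (hC.tp j))
  have i2 : ∀ {D : Type u} [DSort L C D] (a : D), Rat L A a → Ind (δ' j) (m' j) ((β, b' j), a) := by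
    intro D _ a ha
    refine hM.ind_of_frank_le (g := ((β', fun i : Fin j => δ' (Fin.castLE j.2.le i)), a)) ?_ ?_ ?_
    · rw [hM.frank_congr t1, hR.rank]
      exact hcon _ _ _ ha
    · exact (Coord.dcl (f := fun z : (B × (Fin j → R)) × D => z.1.1) (by fun_prop) _).trans
        (hd.trans (Coord.dcl (f := fun z : S × (Fin N → S) × (Fin N → W) => z.2.1 j)
          (by fun_prop) _))
    · exact Dcl.mk ((Coord.dcl (f := fun z : (B × (Fin j → R)) × D => z.1.1) (by fun_prop) _).trans
        (hd.trans (Coord.dcl (f := fun z : S × (Fin N → S) × (Fin N → W) => (z.1, z.2.2 j))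
          (by fun_prop) _))) (Coord.dcl .snd _)
  have i2' : Ind (δ' j) (m' j) (β, b' j) := by
    obtain ⟨D, _, a, ha⟩ := exists_ratA L A
    exact hM.ind_map (i2 a ha) .fst
  have i3 : Ind (δ₁ j) (m' j) (β, b' j) := hM.ind_transport (H.tp.map
    (f := fun z : (((Fin N → R) × (Fin N → R)) × ((Fin N → S) × (Fin N → W))) × S =>
        ((z.1.1.1 j, (z.2, z.1.2.2 j)), z.1.2.1 j)) (by fun_prop)) (hC.ind_δ j)
  obtain ⟨u₂, h4⟩ := hM.stp_ext (hM.stp_of_ind s3 i3 i2') (u₁ j)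
  obtain ⟨v, hv, h5⟩ := hR.bp.ms (((hm'.map (f := fun z : Fin N → S => z j) (by fun_prop)).prod
    (hR.rat_right.prod (hb'.map (f := fun z : Fin N → W => z j) (by fun_prop)))).prod
    (hδ'.map (f := fun z : Fin N → R => z j) (by fun_prop))) u₂
  have t2 : Tp ((u j, δ j), (m j, (β, b j))) ((v, δ' j), (m' j, (β, b' j))) :=
    TpEq.trans (H.tp.map
      (f := fun z : (((Fin N → R) × (Fin N → R)) × ((Fin N → S) × (Fin N → W))) × S =>
        ((z.1.1.2 j, z.1.1.1 j), (z.1.2.1 j, (z.2, z.1.2.2 j)))) (by fun_prop))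
      (h4.tp.trans (h5.tp.map (f := fun z : R × ((S × S × W) × R) => ((z.1, z.2.2), z.2.1))
        (by fun_prop)))
  have s4 : Stp β v d := by
    have q1 : Stp β (u j) (u₁ j) := H.map
      (f := fun z : ((Fin N → R) × (Fin N → R)) × ((Fin N → S) × (Fin N → W)) => z.1.2 j)
      (g := fun z => z) (by fun_prop) .id'
    have q2 : Stp β (u₁ j) u₂ := (h4.map (f := fun z : R × R => z.1) (g := fun z => z)
      (by fun_prop) .id').of_dcl (Coord.dcl (f := fun z : S × S × W => z.2.1) (by fun_prop) _)
    have q3 : Stp β u₂ v := h5.of_dcl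
      (Coord.dcl (f := fun z : (S × S × W) × R => z.1.2.1) (by fun_prop) _)
    exact ((q1.trans q2).trans q3).symm.trans (hC.stp_u j)
  have n1 : ¬Ind v (β, (m' j, b' j)) (δ' j) := fun hn => hC.not_ind_u j (hM.ind_transport
    (t2.symm.map (f := fun z : (R × R) × (S × S × W) =>
      ((z.1.1, z.1.2), (z.2.2.1, (z.2.1, z.2.2.2)))) (by fun_prop)) hn)
  refine hC.no_ind v hv s4 fun D _ a ha => ?_
  refine hM.ind_of_frank_le (g := (m' j, ((β, b' j), a))) ?_
    (Coord.dcl (f := fun z : S × (S × W) × D => z.2.1.1) (by fun_prop) _)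
    (Coord.dcl (f := fun z : S × (S × W) × D => z.2.2) (by fun_prop) _)
  rw [hM.frank_congr (s4.tp.trans hC.tp'), hR.rank]
  by_contra hlt
  refine n1 (hM.ind_symm ?_)
  refine hM.ind_over (hM.ind_trans (i2 a ha) (hR.ind_of_rank_lt t1 (i2 a ha) (not_le.1 hlt)))
    (Coord.dcl (f := fun z : S × S × W => z.2.1) (by fun_prop) _) ?_ ?_
  · exact Coord.dcl (f := fun z : (((S × W) × D) × R) × S => (z.1.1.1.1, (z.2, z.1.1.1.2)))
      (by fun_prop) _
  · exact Coord.dcl (f := fun z : (((S × W) × D) × R) × S => z.1.2) (by fun_prop) _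

end Root
end Benign

namespace Benign

variable {L : FirstOrder.Language.{u, u}} {C : Type u} [L.Structure C] {lev : ℕ → Set C}
variable {S T R E B B' : Type u} [DSort L C S] [DSort L C T] [DSort L C R] [DSort L C E]
  [DSort L C B] [DSort L C B']
local notation "Dfn" => IsDfn L C
local notation "Crd" => Coord L C
local notation "Tp" => TpEq L C
local notation "FER" => IsFER L C
local notation "Stp" => StpEq L C
local notation "DS" => DefSch L C
local notation "Ind" => Indep L C
local notation "rk" => frank L C

variable {A MM : Set C} {Q W : Type u} [DSort L C Q] [DSort L C W]

/-- Append an element to a tuple. -/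
def tsnoc {k : ℕ} (z : (Fin k → R) × R) : Fin (k + 1) → R :=
  fun j => if hj : j.1 < k then z.1 ⟨j, hj⟩ else z.2

theorem coord_tsnoc {k : ℕ} : Crd (tsnoc (R := R) (k := k)) := by
  refine Coord.pi fun j => ?_
  unfold tsnoc
  by_cases hj : j.1 < k
  · simp only [hj, dite_true]
    fun_prop
  · simp only [hj, dite_false]
    fun_prop

theorem tsnoc_castLE {N k : ℕ} (δ : Fin N → R) (hk : k + 1 ≤ N) :
    tsnoc (fun i : Fin k => δ (Fin.castLE (by omega) i), δ ⟨k, hk⟩) =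
      fun i : Fin (k + 1) => δ (Fin.castLE hk i) := by
  funext j
  by_cases hj : j.1 < k
  · simp [tsnoc, hj, Fin.castLE]
  · simp only [tsnoc, hj, dite_false]
    congr 1
    ext
    simp
    omega

namespace Root
variable {θ : Ordinal.{u + 1}} {pr : S → E} {α β : S} {c : R}

/-- Adjoin a sequence of elements of small rank on the right hand side. -/
theorem exists_ext_low_seq (hR : Root L lev A MM θ pr α β c)
    {π : B → S} {α' β' : B} (h : Ext L A MM α β π α' β') {N : ℕ}
    {δ : Fin N → R} (hδ : Rat L MM δ) (hlow : ∀ j : Fin N,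
      ∃ (D : Type u) (_ : DSort L C D) (a : D), Rat L A a ∧
        rk (δ j) ((β', fun i : Fin j => δ (Fin.castLE j.2.le i)), a) < θ) :
    ∃ x, Ext L A MM α' β' (fun z : B × (Fin N → R) => z.1) (α', x) (β', δ) := by
  have key : ∀ k (hk : k ≤ N), ∃ x, StpA L A (β', fun i : Fin k => δ (Fin.castLE hk i)) (α', x) ∧
      Rat L MM x := by
    intro k
    induction k with
    | zero =>
      intro hk
      refine ⟨fun i => i.elim0, ?_, .pi fun i => i.elim0⟩
      have := h.stp.symm.map (f := fun z : B => (z, fun i : Fin 0 => (i.elim0 : R)))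
        (.mk .id' (.pi fun i => i.elim0))
      convert this using 2 with j
    | succ k ih =>
      intro hk
      obtain ⟨x, hx, hxr⟩ := ih (by omega)
      obtain ⟨D, _, a, ha, hlt⟩ := hlow ⟨k, hk⟩
      have hr : Rat L MM fun i : Fin k => δ (Fin.castLE (by omega : k ≤ N) i) :=
        hδ.map (f := fun z : Fin N → R => fun i : Fin k => z (Fin.castLE (by omega : k ≤ N) i))
          (by fun_prop)
      obtain ⟨y, hy, hs⟩ := hR.low _ _ (δ ⟨k, hk⟩) a (h.rat_right.prod hr) (h.rat_left.prod hxr)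
        (hδ.map (f := fun z : Fin N → R => z ⟨k, hk⟩) (by fun_prop)) ha hx hlt
      refine ⟨tsnoc (x, y), ?_, (hxr.prod hy).map coord_tsnoc⟩
      rw [← tsnoc_castLE]
      exact hs.map (f := fun z : (B × (Fin k → R)) × R => (z.1.1, tsnoc (z.1.2, z.2)))
        (.mk (by fun_prop) (coord_tsnoc.comp (by fun_prop)))
  obtain ⟨x, hx, hxr⟩ := key N le_rfl
  exact ⟨x, .fst, rfl, rfl, h.rat_left.prod hxr, h.rat_right.prod hδ, hx.symm⟩

variable {N : ℕ} {mk : (Fin N → S) × (Fin N → R) → Q} {d : R}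
    {m : Fin N → S} {δ : Fin N → R} {b : Fin N → W} {u : Fin N → R} {e : Q}

theorem ind_of_candidate (hR : Root L lev A MM θ pr α β c) (hC : Config L A MM pr α β c mk d m δ b u e)
    {β' : B} {y : (Fin N → S) × (Fin N → W)} {f : Q} (hy : Ind y.1 (pr α) β')
    (hd : Dcl L C β' (pr α)) (hi : Ind f β' y) : Ind f (pr α) y.1 := by
  have hM := hR.bp.monster
  have h1 : Ind f β' y.1 := hM.ind_map hi .fst
  have h2 := hM.ind_trans hy (hM.ind_of_dcl (hM.ind_symm h1) (hd.mk (Coord.id'.dcl β'))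
    (Coord.dcl .snd _))
  exact hM.ind_symm (hM.ind_map h2 .snd)

/-- Any rational conjugate of the base element belongs to some extension. -/
theorem exists_ext_interpreting (hR : Root L lev A MM θ pr α β c) (hC : Config L A MM pr α β c mk d m δ b u e)
    {π : B → S} {α' β' : B} (h : Ext L A MM α β π α' β') {f : Q}
    (hf : Rat L MM f) (hfe : Stp (pr α) f e) :
    ∃ (D : Type u) (_ : DSort L C D) (π' : D → B) (α'' β'' : D) (κ : D → Q),
      Ext L A MM α' β' π' α'' β'' ∧ Crd κ ∧ κ β'' = f := by
  have hM := hR.bp.monster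
  obtain ⟨o, ⟨D, _, π', α₁, β₁, h1, ho⟩, hmin⟩ := exists_min_ordinal (K := fun o =>
    ∃ (D : Type u) (_ : DSort L C D) (π' : D → B) (α'' β'' : D),
      Ext L A MM α' β' π' α'' β'' ∧ rk f β'' = o)
    ⟨_, B, _, _, _, _, ⟨.id', rfl, rfl, h.rat_left, h.rat_right, h.stp⟩, rfl⟩
  have h2 := h.trans h1
  obtain ⟨x, y, hE, hs, hy⟩ := hR.exists_candidate hC h2
  have hdβ : Dcl L C β₁ β := by
    have := h2.coord.dcl β₁
    rwa [h2.right] at this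
  have hi : Ind f β₁ y := hM.ind_of_frank_le (g := (β₁, y))
    (ho.trans_le (hmin _ ⟨_, _, _, _, _, h1.trans hE, rfl⟩)) (Coord.dcl .fst _) (Coord.dcl .snd _)
  have hi' := hR.ind_of_candidate hC hy (hdβ.trans hR.dcl_right) hi
  obtain ⟨δ', hδ', he, hlow⟩ := hR.exists_low_seq hC (β' := (β₁, y)) (m' := y.1) (b' := y.2)
    (hE.rat_right.map .snd) (Dcl.mk ((Coord.dcl .fst _).trans hdβ) (Coord.dcl .snd _)) hs hf hfe hi'
  obtain ⟨x', hx'⟩ := hR.exists_ext_low_seq (h2.trans hE) hδ' hlow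
  have hmk := hC.coord
  exact ⟨_, inferInstance, _, _, _,
    fun z : (D × ((Fin N → S) × (Fin N → W))) × (Fin N → R) => mk (z.1.2.1, z.2),
    (h1.trans hE).trans hx', by fun_prop, he⟩

end Root
end Benign

namespace Benign

variable {L : FirstOrder.Language.{u, u}} {C : Type u} [L.Structure C] {lev : ℕ → Set C}
variable {S T R E B B' : Type u} [DSort L C S] [DSort L C T] [DSort L C R] [DSort L C E]
  [DSort L C B] [DSort L C B']
local notation "Dfn" => IsDfn L C
local notation "Crd" => Coord L C
local notation "Tp" => TpEq L C
local notation "FER" => IsFER L C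
local notation "Stp" => StpEq L C
local notation "DS" => DefSch L C
local notation "Ind" => Indep L C
local notation "rk" => frank L C

variable {A MM : Set C} {Q W P : Type u} [DSort L C Q] [DSort L C W] [DSort L C P]

/-- Saturation of the pair `(MM, A)` for definable conditions on families indexed by `Ω` quantified
universally over the tuples of `A`. -/
def StarSat (L : FirstOrder.Language.{u, u}) {C : Type u} [L.Structure C] (A MM : Set C)
    (Ω : Type u) : Prop :=
  ∀ ⦃Q P : Type u⦄ [DSort L C Q] [DSort L C P] (p : P), Rat L MM p →
    ∀ ⦃K : Type (u + 1)⦄ (E : K → Type u) [∀ k, DSort L C (E k)] (n : K → ℕ)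
      (J : ∀ k, Fin (n k) → Ω) (Y : ∀ k, (Fin (n k) → Q) × E k × P → Prop),
      (∀ k, IsDfn L C (Y k)) →
      (∀ t : Finset K, ∃ f : Ω → Q, (∀ i, Rat L MM (f i)) ∧
        ∀ k ∈ t, ∀ a, Rat L A a → Y k (fun l => f (J k l), a, p)) →
      ∃ f : Ω → Q, (∀ i, Rat L MM (f i)) ∧ ∀ k a, Rat L A a → Y k (fun l => f (J k l), a, p)

/-- A sequence of conjugates of `e` such that every member is related to a realization of the type
of `(c, α)` independent from the earlier ones. -/
structure IsSpread (L : FirstOrder.Language.{u, u}) {C : Type u} [L.Structure C] (A MM : Set C)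
    [DSort L C S] [DSort L C R] [DSort L C E] [DSort L C Q] (α : S) (c : R) (b : E) (e : Q)
    {I : Type*} [LT I] (f : I → Q) : Prop where
  rat : ∀ i, Rat L MM (f i)
  stp : ∀ i, StpEq L C b (f i) e
  exists_ind : ∀ i, ∃ v ν, TpEq L C ((v, ν), f i) ((c, α), e) ∧
    ∀ ⦃D : Type u⦄ [DSort L C D] (a : D), Rat L A a → ∀ (n : ℕ) (J : Fin n → I), (∀ l, J l < i) →
      Indep L C v ν (a, fun l => f (J l))

namespace Root
variable {θ : Ordinal.{u + 1}} {pr : S → E} {α β : S} {c : R}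
variable {N : ℕ} {mk : (Fin N → S) × (Fin N → R) → Q} {d : R}
    {m : Fin N → S} {δ : Fin N → R} {b : Fin N → W} {u : Fin N → R} {e : Q}

theorem exists_ext_interpreting_seq (hR : Root L lev A MM θ pr α β c) (hC : Config L A MM pr α β c mk d m δ b u e)
    {n : ℕ} (f : Fin n → Q) (hf : ∀ i, Rat L MM (f i))
    (hfe : ∀ i, Stp (pr α) (f i) e) :
    ∃ (D : Type u) (_ : DSort L C D) (π' : D → S) (α' β' : D) (κ : D → Fin n → Q),
      Ext L A MM α β π' α' β' ∧ Crd κ ∧ κ β' = f := by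
  induction n with
  | zero =>
    exact ⟨S, _, _, _, _, fun _ i => i.elim0, hR.ext_refl, .pi fun i => i.elim0,
      funext fun i => i.elim0⟩
  | succ n ih =>
    obtain ⟨D, _, π, α', β', κ, h1, h2, h3⟩ := ih (fun i : Fin n => f (Fin.castLE (by omega) i))
      (fun i => hf _) (fun i => hfe _)
    obtain ⟨D', _, π', α'', β'', κ', h4, h5, h6⟩ := hR.exists_ext_interpreting hC h1
      (hf (Fin.last n)) (hfe _)
    have := h4.coord
    refine ⟨D', _, _, α'', β'', fun z => tsnoc (κ (π' z), κ' z), h1.trans h4,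
      coord_tsnoc.comp (by fun_prop), ?_⟩
    change tsnoc (κ (π' β''), κ' β'') = f
    rw [h4.right, h3, h6]
    exact tsnoc_castLE f le_rfl

theorem exists_isSpread_fin (hR : Root L lev A MM θ pr α β c) (hC : Config L A MM pr α β c mk d m δ b u e)
    (n : ℕ) : ∃ f : Fin n → Q, IsSpread L A MM α c (pr α) e f := by
  have hM := hR.bp.monster
  induction n with
  | zero => exact ⟨fun i => i.elim0, fun i => i.elim0, fun i => i.elim0, fun i => i.elim0⟩
  | succ n ih =>
    obtain ⟨f, hf⟩ := ih
    obtain ⟨D, _, π, α', β', κ, h1, h2, h3⟩ := hR.exists_ext_interpreting_seq hC f hf.rat hf.stp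
    have hlt : ∀ (i : Fin (n + 1)) (h : i.1 < n), tsnoc (κ α', e) i = κ α' ⟨i, h⟩ := fun i h => by
      simp [tsnoc, h]
    have hge : ∀ (i : Fin (n + 1)) (h : ¬i.1 < n), tsnoc (κ α', e) i = e := fun i h => by
      simp [tsnoc, h]
    refine ⟨tsnoc (κ α', e), fun i => ?_, fun i => ?_, fun i => ?_⟩
    · exact ((h1.rat_left.prod hC.rat).map (f := fun z : D × Q => tsnoc (κ z.1, z.2) i)
        ((Coord.apply i).comp (coord_tsnoc.comp (by fun_prop))))
    · by_cases hi : i.1 < n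
      · rw [hlt i hi]
        have h4 := (h1.stp _ hR.rat_pr).map (f := fun z : D => κ z ⟨i, hi⟩) (g := fun z => z)
          (by fun_prop) .id'
        refine h4.trans ?_
        rw [h3]
        exact hf.stp _
      · rw [hge i hi]
        exact .refl _ _
    · by_cases hi : i.1 < n
      · obtain ⟨v, ν, h4, h5⟩ := hf.exists_ind ⟨i, hi⟩
        obtain ⟨⟨v', ν'⟩, h6⟩ := hM.stpA_ext hR.bp.sub_lev' h1.stp.symm (v, ν)
        refine ⟨v', ν', ?_, fun D' _ a ha n' J hJ => ?_⟩
        · rw [hlt i hi]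
          refine TpEq.trans (h6.symm.tp'.map
            (f := fun z : D × (R × S) => (z.2, κ z.1 ⟨i, hi⟩)) (by fun_prop)) ?_
          simp only [h3]
          exact h4
        · have hJ' : ∀ l, (J l).1 < n := fun l => lt_trans (hJ l) hi
          have h7 := h5 a ha n' (fun l => ⟨J l, hJ' l⟩) hJ
          have h8 : (fun l => tsnoc (κ α', e) (J l)) = fun l => κ α' ⟨J l, hJ' l⟩ :=
            funext fun l => hlt _ _
          rw [h8]
          have h9 := (h6.tp ha).map (f := fun z : (D × (R × S)) × D' =>
            ((z.1.2.1, (z.2, fun l => κ z.1.1 ⟨J l, hJ' l⟩)), z.1.2.2)) (by fun_prop)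
          simp only [h3] at h9
          exact hM.ind_transport h9 h7
      · rw [hge i hi]
        refine ⟨c, α, .refl _, fun D' _ a ha n' J hJ => ?_⟩
        have hJ' : ∀ l, (J l).1 < n := fun l => by have := hJ l; have := i.2; omega
        have h8 : (fun l => tsnoc (κ α', e) (J l)) = fun l => κ α' ⟨J l, hJ' l⟩ :=
            funext fun l => hlt _ _
        rw [h8]
        exact hM.ind_map (hR.ind_ext h1 ha)
          (f := fun z : D × D' => (z.2, fun l => κ z.1 ⟨J l, hJ' l⟩)) (by fun_prop)

/-- The conditions defining spreads. -/
structure SpreadCond (L : FirstOrder.Language.{u, u}) (C : Type u) [L.Structure C]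
    [DSort L C S] [DSort L C R] [DSort L C E] [DSort L C Q] (α : S) (c : R) (b : E) (e : Q)
    (Ω : Type u) [LT Ω] : Type (u + 1) where
  D : Type u
  inst : DSort L C D
  n : ℕ
  i : Ω
  J : Fin n → Ω
  lt : ∀ l, J l < i
  F : (Q × Q) × E → Prop
  fer : IsFER L C F b
  Y : ((R × S) × Q) × (D × (Fin n → Q)) → Prop
  forced : Forced L C c α e Y

attribute [instance] SpreadCond.inst

theorem exists_isSpread (hR : Root L lev A MM θ pr α β c) (hC : Config L A MM pr α β c mk d m δ b u e)
    {Ω : Type u} [LinearOrder Ω] (hΩ : StarSat L A MM Ω) :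
    ∃ f : Ω → Q, IsSpread L A MM α c (pr α) e f := by
  have hM := hR.bp.monster
  obtain ⟨f, hf, hf'⟩ := hΩ (Q := Q) (pr α, e) ((hR.rat_pr.mono hR.bp.sub).prod hC.rat)
    (K := SpreadCond L C α c (pr α) e Ω) (fun k => k.D) (fun k => k.n + 1)
    (fun k => Fin.cons k.i k.J)
    (fun k z => k.F ((z.1 0, z.2.2.2), z.2.2.1) ∧
      ∃ w : R × S, k.Y ((w, z.1 0), (z.2.1, fun l => z.1 l.succ))) (fun k => by
        refine IsDfn.and (k.fer.dfn.comp (by fun_prop)) (IsDfn.ex ?_)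
        exact k.forced.1.comp (f := fun p : ((Fin (k.n + 1) → Q) × k.D × E × Q) × (R × S) =>
          ((p.2, p.1.1 0), (p.1.2.1, fun l => p.1.1 l.succ))) (by fun_prop)) (fun t => by
      classical
      let s : Finset Ω := t.biUnion fun k => insert k.i (Finset.univ.image k.J)
      obtain ⟨g, hg⟩ := hR.exists_isSpread_fin hC s.card
      let pos : Ω → ℕ := fun x => (s.filter (· < x)).card
      have hpos : ∀ x ∈ s, pos x < s.card := fun x hx => Finset.card_lt_card
        (Finset.filter_ssubset.2 ⟨x, hx, lt_irrefl x⟩)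
      have hmono : ∀ x ∈ s, ∀ y, x < y → pos x < pos y := fun x hx y hxy => by
        refine Finset.card_lt_card ⟨fun z hz => ?_, fun h => ?_⟩
        · rw [Finset.mem_filter] at hz ⊢
          exact ⟨hz.1, hz.2.trans hxy⟩
        · exact lt_irrefl x (Finset.mem_filter.1 (h (Finset.mem_filter.2 ⟨hx, hxy⟩))).2
      let f : Ω → Q := fun x => if h : pos x < s.card then g ⟨pos x, h⟩ else e
      have hfs : ∀ x (h : x ∈ s), f x = g ⟨pos x, hpos x h⟩ := fun x h => by
        simp [f, hpos x h]
      refine ⟨f, fun x => ?_, fun k hk a ha => ?_⟩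
      · by_cases h : pos x < s.card
        · simp only [f, h, dite_true]
          exact hg.rat _
        · simp only [f, h, dite_false]
          exact hC.rat
      · have hi : k.i ∈ s := Finset.mem_biUnion.2 ⟨k, hk, Finset.mem_insert_self _ _⟩
        have hJ : ∀ l, k.J l ∈ s := fun l => Finset.mem_biUnion.2 ⟨k, hk,
          Finset.mem_insert_of_mem (Finset.mem_image_of_mem _ (Finset.mem_univ _))⟩
        obtain ⟨v, ν, h1, h2⟩ := hg.exists_ind ⟨pos k.i, hpos _ hi⟩
        simp only [Fin.cons_zero, Fin.cons_succ]
        have h3 : (fun l => f (k.J l)) = fun l => g ⟨pos (k.J l), hpos _ (hJ l)⟩ :=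
          funext fun l => hfs _ (hJ l)
        rw [h3, hfs _ hi]
        refine ⟨hg.stp _ _ k.fer, (v, ν), k.forced.2 _ _ _ _ h1 (h2 a ha _ _ fun l => ?_)⟩
        exact hmono _ (hJ l) _ (k.lt l))
  simp only [Fin.cons_zero, Fin.cons_succ] at hf'
  have htriv : ∀ {D : Type u} [DSort L C D], Forced L C c α e
      fun _ : ((R × S) × Q) × D => True := ⟨.const True, fun _ _ _ _ _ _ => trivial⟩
  refine ⟨f, hf, fun i F hF => ?_, fun i => ?_⟩
  · obtain ⟨D, _, a, ha⟩ := exists_ratA L A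
    exact (hf' ⟨D, _, 0, i, fun l => l.elim0, fun l => l.elim0, F, hF, _, htriv⟩ a ha).1
  · obtain ⟨v, ν, h1, h2⟩ := hM.exists_of_forced 0 c α e (f i)
      (fun G _ g => ∃ (D : Type u) (_ : DSort L C D) (a : D) (n : ℕ) (J : Fin n → Ω)
        (r : D × (Fin n → Q) → G), Rat L A a ∧ (∀ l, J l < i) ∧ Crd r ∧ r (a, fun l => f (J l)) = g)
      (by
        obtain ⟨D, _, a, ha⟩ := exists_ratA L A
        exact ⟨D, _, a, D, _, a, 0, fun l => l.elim0, Prod.fst, ha, fun l => l.elim0, .fst, rfl⟩)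
      (by
        rintro G _ g G' _ g' ⟨D, _, a, n, J, r, ha, hJ, hr, rfl⟩ ⟨D', _, a', n', J', r', ha', hJ',
          hr', rfl⟩
        refine ⟨(D × D') × (Fin (n + n') → Q), inferInstance,
          ((a, a'), fun l => f (Fin.append J J' l)),
          fun z => r (z.1.1, fun l => z.2 (Fin.castAdd n' l)),
          fun z => r' (z.1.2, fun l => z.2 (Fin.natAdd n l)),
          ⟨_, inferInstance, (a, a'), n + n', Fin.append J J', fun z => z, ha.prod ha', fun l => ?_,
            .id', rfl⟩, by fun_prop, by fun_prop, by simp, by simp⟩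
        refine Fin.addCases (fun l => ?_) (fun l => ?_) l
        · simpa using hJ l
        · simpa using hJ' l)
      ((hf i).mono hR.bp.sub_lev)
      (by
        rintro G _ g ⟨D, _, a, n, J, r, ha, hJ, hr, rfl⟩
        exact (((ha.mono hR.bp.sub).prod (Rat.pi fun l => hf (J l))).map hr).mono hR.bp.sub_lev)
      (by
        rintro G _ g Y ⟨D, _, a, n, J, r, ha, hJ, hr, rfl⟩ hY
        obtain ⟨w, hw⟩ := (hf' ⟨D, _, n, i, J, hJ, fun _ => True, .true _,
          fun z => Y (z.1, r z.2), hY.1.comp (by fun_prop), fun x' b' f' g h1 h2 =>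
            hY.2 _ _ _ _ h1 (hM.ind_map h2 hr)⟩ a ha).2
        exact ⟨w.1, w.2, hw⟩)
    exact ⟨v, ν, h1, fun D _ a ha n J hJ => h2 _ ⟨_, _, a, n, J, fun z => z, ha, hJ, .id', rfl⟩⟩

end Root
end Benign

namespace Benign

variable {L : FirstOrder.Language.{u, u}} {C : Type u} [L.Structure C] {lev : ℕ → Set C}
variable {S T R E B B' : Type u} [DSort L C S] [DSort L C T] [DSort L C R] [DSort L C E]
  [DSort L C B] [DSort L C B']
local notation "Dfn" => IsDfn L C
local notation "Crd" => Coord L C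
local notation "Tp" => TpEq L C
local notation "FER" => IsFER L C
local notation "Stp" => StpEq L C
local notation "DS" => DefSch L C
local notation "Ind" => Indep L C
local notation "rk" => frank L C

variable {A MM : Set C} {Q W : Type u} [DSort L C Q] [DSort L C W]

/-- A bundled extension of a pair of conjugate tuples. -/
structure ExtData (L : FirstOrder.Language.{u, u}) {C : Type u} [L.Structure C] (A MM : Set C)
    [DSort L C S] (α β : S) : Type (u + 1) where
  D : Type u
  inst : DSort L C D
  π : D → S
  left : D
  right : D
  ext : Ext L A MM α β π left right

attribute [instance] ExtData.inst

theorem exists_rat_coord {N : ℕ} (D : Fin N → Type u) [∀ j, DSort L C (D j)] (a : ∀ j, D j)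
    (ha : ∀ j, Rat L A (a j)) : ∃ (D' : Type u) (_ : DSort L C D') (a' : D'), Rat L A a' ∧
      ∀ j, ∃ r : D' → D j, Crd r ∧ r a' = a j := by
  induction N with
  | zero =>
    obtain ⟨D', i, a', ha'⟩ := exists_ratA L A
    exact ⟨D', i, a', ha', fun j => j.elim0⟩
  | succ N ih =>
    obtain ⟨D', _, a', ha', hr⟩ := ih (fun j => D j.succ) (fun j => a j.succ) (fun j => ha _)
    refine ⟨D' × D 0, inferInstance, (a', a 0), ha'.prod (ha 0), fun j => ?_⟩
    refine Fin.cases ⟨Prod.snd, .snd, rfl⟩ (fun j => ?_) j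
    obtain ⟨r, h1, h2⟩ := hr j
    exact ⟨fun z => r z.1, h1.comp .fst, h2⟩

namespace Root
variable {θ : Ordinal.{u + 1}} {pr : S → E} {α β : S} {c : R}

theorem false_of_spread (hR : Root L lev A MM θ pr α β c)
    {Ω : Type u} [LinearOrder Ω] (hΩ : StarSat L A MM Ω)
    (hb : ∀ (n : ℕ → ℕ) (J : ∀ k, Fin (n k) → Ω), ∃ i, ∀ k l, J k l < i) : False := by
  have hM := hR.bp.monster
  obtain ⟨N, Q, W, _, _, mk, d, m, δ, b, u, e, hC⟩ := hR.exists_config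
  obtain ⟨f, hf⟩ := hR.exists_isSpread hC hΩ
  have hmk := hC.coord
  -- a chain of free extensions
  have hnext : ∀ X : ExtData L A MM α β, ∃ (Y : ExtData L A MM α β) (τ : Y.D → X.D)
      (p : Y.D → (Fin N → S) × (Fin N → W)), Crd τ ∧ Crd p ∧ τ Y.right = X.right ∧
      Stp β (m, b) (p Y.right) ∧ Ind (p Y.right).1 (pr α) X.right := by
    intro X
    obtain ⟨x, y, h1, h2, h3⟩ := hR.exists_candidate hC X.ext
    exact ⟨⟨_, inferInstance, _, _, _, X.ext.trans h1⟩, Prod.fst, Prod.snd, .fst, .snd, rfl, h2, h3⟩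
  obtain ⟨s, hnext⟩ : ∃ s : ℕ → ExtData L A MM α β, ∀ k,
      ∃ (τ : (s (k + 1)).D → (s k).D) (p : (s (k + 1)).D → (Fin N → S) × (Fin N → W)),
        Crd τ ∧ Crd p ∧ τ (s (k + 1)).right = (s k).right ∧
        Stp β (m, b) (p (s (k + 1)).right) ∧ Ind (p (s (k + 1)).right).1 (pr α) (s k).right := by
    choose next hnext using hnext
    exact ⟨fun k => Nat.rec ⟨S, _, _, _, _, hR.ext_refl⟩ (fun _ => next) k, fun k => hnext _⟩
  have hmin : ∀ X : ExtData L A MM α β, ∃ (D : Type u) (_ : DSort L C D) (a : D) (n : ℕ)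
      (J : Fin n → Ω), Rat L A a ∧ ∀ ⦃D' : Type u⦄ [DSort L C D'] (a' : D'), Rat L A a' →
        ∀ (n' : ℕ) (J' : Fin n' → Ω),
          rk X.right (a, fun l => f (J l)) ≤ rk X.right (a', fun l => f (J' l)) := by
    intro X
    obtain ⟨o, ⟨D, _, a, n, J, h1, h2⟩, h3⟩ := exists_min_ordinal (K := fun o =>
      ∃ (D : Type u) (_ : DSort L C D) (a : D) (n : ℕ) (J : Fin n → Ω), Rat L A a ∧
        rk X.right (a, fun l => f (J l)) = o) (by
        obtain ⟨D, _, a, ha⟩ := exists_ratA L A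
        exact ⟨_, D, _, a, 0, fun l => l.elim0, ha, rfl⟩)
    exact ⟨D, _, a, n, J, h1, fun D' _ a' ha' n' J' => h2.trans_le (h3 _ ⟨_, _, _, _, _, ha', rfl⟩)⟩
  choose D iD a n J ha hmin using fun k => hmin (s k)
  obtain ⟨i, hi⟩ := hb n J
  obtain ⟨o, ⟨k, hk⟩, hkmin⟩ := exists_min_ordinal (K := fun o => ∃ k, rk (f i) (s k).right = o)
    ⟨rk (f i) (s 0).right, 0, rfl⟩
  set X := s k
  set Y := s (k + 1)
  obtain ⟨τ, p, hτ, hp, hτe, hps, hpi⟩ := hnext k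
  have hdβ : ∀ X : ExtData L A MM α β, Dcl L C X.right β := fun X => by
    have := X.ext.coord.dcl X.right
    rwa [X.ext.right] at this
  have hdτ : Dcl L C Y.right X.right := by
    have := hτ.dcl Y.right
    rwa [hτe] at this
  have i1 : Ind (f i) X.right (p Y.right) := hM.ind_of_frank_le (g := Y.right)
    (hk.trans_le (hkmin _ ⟨k + 1, rfl⟩)) hdτ (hp.dcl _)
  have i2 := hR.ind_of_candidate hC hpi ((hdβ X).trans hR.dcl_right) i1
  obtain ⟨δ', hδ', he, hlow⟩ := hR.exists_low_seq hC (β' := Y.right) (m' := (p Y.right).1)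
    (b' := (p Y.right).2) (Y.ext.rat_right.map hp) ((hdβ Y).mk (hp.dcl _)) hps (hf.rat i)
    (hf.stp i) i2
  choose D₁ iD₁ a₁ ha₁ hlow using hlow
  obtain ⟨D₂, _, a₂, ha₂, hr⟩ := exists_rat_coord D₁ a₁ ha₁
  -- the parameters over which the extension is free from `f i`
  obtain ⟨h, hh⟩ : ∃ h : (D (k + 1) × (Fin (n (k + 1)) → Q)) × D₂,
      h = ((a (k + 1), fun l => f (J (k + 1) l)), a₂) := ⟨_, rfl⟩
  have j1 : Ind Y.right h (f i) := by
    have h1 : Ind Y.right (a (k + 1), fun l => f (J (k + 1) l)) (a₂, f i) := by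
      refine hM.ind_of_frank_le (hmin (k + 1) (a (k + 1), a₂) ((ha _).prod ha₂) (n (k + 1) + 1)
        (Fin.snoc (J (k + 1)) i)) ?_ ?_
      · refine ((Coord.dcl (f := fun z : (D (k + 1) × D₂) × (Fin (n (k + 1) + 1) → Q) =>
          (z.1.1, fun l : Fin (n (k + 1)) => z.2 l.castSucc)) (by fun_prop) _)).trans ?_
        simp only [Fin.snoc_castSucc]
        exact Coord.id'.dcl _
      · refine ((Coord.dcl (f := fun z : (D (k + 1) × D₂) × (Fin (n (k + 1) + 1) → Q) =>
          (z.1.2, z.2 (Fin.last _))) (by fun_prop) _)).trans ?_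
        simp only [Fin.snoc_last]
        exact Coord.id'.dcl _
    rw [hh]
    refine hM.ind_over h1 (Coord.dcl .fst _) ?_ ?_
    · exact Coord.dcl (f := fun z : (D₂ × Q) × (D (k + 1) × (Fin (n (k + 1)) → Q)) => (z.2, z.1.1))
        (by fun_prop) _
    · exact Coord.dcl (f := fun z : (D₂ × Q) × (D (k + 1) × (Fin (n (k + 1)) → Q)) => z.1.2)
        (by fun_prop) _
  obtain ⟨v₀, ν₀, t₀, hv₀⟩ := hf.exists_ind i
  have j2 : Ind v₀ ν₀ h := by
    rw [hh]
    exact hM.ind_map (hv₀ (a (k + 1), a₂) ((ha _).prod ha₂) _ (J (k + 1)) (hi _))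
      (f := fun z : (D (k + 1) × D₂) × (Fin (n (k + 1)) → Q) => ((z.1.1, z.2), z.1.2)) (by fun_prop)
  obtain ⟨⟨v, ν⟩, hs, j3⟩ := hM.exists_ind (v₀, ν₀) (h, f i) Y.right
  have t₁ : Tp ((v, ν), f i) ((c, α), e) :=
    (hs.symm.tp.map (f := fun z : (R × S) × (_ × Q) => (z.1, z.2.2)) (by fun_prop)).trans t₀
  have j4 : Ind v ν h := hM.ind_transport (hs.tp.map
    (f := fun z : (R × S) × (_ × Q) => ((z.1.1, z.2.1), z.1.2)) (by fun_prop)) j2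
  have j5 : Ind Y.right h (v, ν) := hM.ind_map (hM.ind_trans j1 (hM.ind_symm j3)) .snd
  have j6 : Ind Y.right (ν, h) v := hM.ind_over j5
    (Coord.dcl .snd _)
    (Coord.dcl (f := fun z : (R × S) × _ => (z.1.2, z.2)) (by fun_prop) _)
    (Coord.dcl (f := fun z : (R × S) × _ => z.1.1) (by fun_prop) _)
  have j7 : Ind v ν (h, Y.right) := hM.ind_trans j4 (hM.ind_symm j6)
  have ht : Tp (v, ν) (c, α) := t₁.map .fst
  have key : ∀ k (hk : k ≤ N), Ind v ν ((h, Y.right), fun i : Fin k => δ' (Fin.castLE hk i)) := by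
    intro k
    induction k with
    | zero =>
      intro hk
      exact hM.ind_map j7 (f := fun z => (z, fun i : Fin 0 => δ' (Fin.castLE hk i)))
        (.mk .id' ⟨fun k : Fin 0 × _ => k.1.elim0, fun v => funext fun j => j.elim0⟩)
    | succ k ih =>
      intro hk
      have h1 := ih (by omega)
      obtain ⟨r, hr1, hr2⟩ := hr ⟨k, hk⟩
      have h2 := hR.ind_of_rank_lt ht h1 (d := δ' ⟨k, hk⟩) (by
        refine lt_of_le_of_lt ?_ (hlow ⟨k, hk⟩)
        refine hM.frank_le_of_dcl ?_
        rw [← hr2, hh]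
        exact Coord.dcl (f := fun z : S × ((((D _ × (Fin _ → Q)) × D₂) × Y.D) × (Fin k → R)) =>
          ((z.2.1.2, z.2.2), r z.2.1.1.2)) (by fun_prop) _)
      rw [← tsnoc_castLE]
      exact hM.ind_map (hM.ind_trans h1 h2) (f := fun z : ((_ × Y.D) × (Fin k → R)) × R =>
        (z.1.1, tsnoc (z.1.2, z.2))) (.mk (by fun_prop) (coord_tsnoc.comp (by fun_prop)))
  have hfin : Ind v ν (f i) := by
    rw [← he]
    exact hM.ind_map (key N le_rfl) (f := fun z : (_ × Y.D) × (Fin N → R) =>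
      mk ((p z.1.2).1, z.2)) (by fun_prop)
  exact hC.not_ind (hM.ind_transport
    (t₁.map (f := fun z : (R × S) × Q => ((z.1.1, z.2), z.1.2)) (by fun_prop)) hfin)

end Root
end Benign

namespace Benign

variable {L : FirstOrder.Language.{u, u}} {C : Type u} [L.Structure C] {lev : ℕ → Set C}
variable {S T R E B B' : Type u} [DSort L C S] [DSort L C T] [DSort L C R] [DSort L C E]
  [DSort L C B] [DSort L C B']
local notation "Dfn" => IsDfn L C
local notation "Crd" => Coord L C
local notation "Tp" => TpEq L C
local notation "FER" => IsFER L C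
local notation "Stp" => StpEq L C
local notation "DS" => DefSch L C
local notation "Ind" => Indep L C
local notation "rk" => frank L C

variable {A MM : Set C}

/-- Elementary maps preserving strong types over `A` extend inside `MM`. -/
theorem BPair.exists_copy (hB : BPair L lev A MM) {Ω : Type u} [LinearOrder Ω]
    (hΩ : StarSat L A MM Ω)
    (hb : ∀ (n : ℕ → ℕ) (J : ∀ k, Fin (n k) → Ω), ∃ i, ∀ k l, J k l < i)
    {α β : B} (hα : Rat L MM α) (hβ : Rat L MM β) (hs : StpA L A α β) {c : S} (hc : Rat L MM c) :
    ∃ d, Rat L MM d ∧ StpA L A (α, c) (β, d) := by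
  have hM := hB.monster
  by_contra hno
  obtain ⟨θ, ⟨B, S, E, _, _, _, α, β, c, a, hα, hβ, hc, ha, hs, hno, hθ⟩, hmin⟩ :=
    exists_min_ordinal (K := fun θ => ∃ (B S E : Type u) (_ : DSort L C B) (_ : DSort L C S)
      (_ : DSort L C E) (α β : B) (c : S) (a : E), Rat L MM α ∧ Rat L MM β ∧ Rat L MM c ∧ Rat L A a ∧
        StpA L A α β ∧ (¬∃ d, Rat L MM d ∧ StpA L A (α, c) (β, d)) ∧ rk c (α, a) = θ) (by
      obtain ⟨E, _, a, ha⟩ := exists_ratA L A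
      exact ⟨_, B, S, E, _, _, _, α, β, c, a, hα, hβ, hc, ha, hs, hno, rfl⟩)
  obtain ⟨D, _, a₁, ha₁, hi⟩ := hM.exists_indA_base A α a
  have hg := ha.prod ha₁
  have hadd : ∀ {x : B}, IndA L A x (a, a₁) → IndA L A (x, (a, a₁)) (a, a₁) :=
    fun h _ _ a' ha' => hM.ind_symm (hM.ind_over (hM.ind_symm (h a' ha')) (Coord.id'.dcl _)
      (Coord.dcl .snd _) (Coord.id'.dcl _))
  have hR : Root L lev A MM θ (Prod.snd : B × (E × D) → E × D) (α, (a, a₁)) (β, (a, a₁)) c := by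
    refine ⟨hB, ?_, .snd, hα.prod (hg.mono hB.sub), hβ.prod (hg.mono hB.sub), hc,
      hs.with_base hg, ?_, ?_, rfl, hg, hadd hi, hadd ?_⟩
    · intro B S E _ _ _ α β c a hα hβ hc ha hs hlt
      by_contra hno
      exact absurd (hmin _ ⟨B, S, E, _, _, _, α, β, c, a, hα, hβ, hc, ha, hs, hno, rfl⟩)
        (not_le.2 hlt)
    · rintro ⟨d, h1, h2⟩
      exact hno ⟨d, h1, h2.map (f := fun z : (B × (E × D)) × S => (z.1.1, z.2)) (by fun_prop)⟩
    · refine le_antisymm ?_ (hmin _ ⟨B, S, _, _, _, _, α, β, c, _, hα, hβ, hc, hg, hs, hno, rfl⟩)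
      rw [← hθ]
      exact hM.frank_le_of_coord (f := fun z : B × (E × D) => (z.1, z.2.1)) (by fun_prop) rfl
    · intro D' _ a' ha'
      exact hM.ind_transport ((hs.tp (hg.prod ha')).map (f := fun z : B × ((E × D) × D') =>
        ((z.1, z.2.2), z.2.1)) (by fun_prop)) (hi a' ha')
  exact hR.false_of_spread hΩ hb

end Benign

namespace Benign

variable {L : FirstOrder.Language.{u, u}} {C : Type u} [L.Structure C] {lev : ℕ → Set C}
variable {S T R E B B' : Type u} [DSort L C S] [DSort L C T] [DSort L C R] [DSort L C E]
  [DSort L C B] [DSort L C B']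
local notation "Dfn" => IsDfn L C
local notation "Crd" => Coord L C
local notation "Tp" => TpEq L C
local notation "FER" => IsFER L C
local notation "Stp" => StpEq L C
local notation "DS" => DefSch L C
local notation "Ind" => Indep L C
local notation "rk" => frank L C

theorem exists_order_unbounded : ∃ (Ω : Type u) (_ : LinearOrder Ω),
    ∀ (n : ℕ → ℕ) (J : ∀ k, Fin (n k) → Ω), ∃ i, ∀ k l, J k l < i := by
  refine ⟨(Ordinal.omega.{u} 1).ToType, inferInstance, fun n J => ?_⟩
  let f : (Σ k, Fin (n k)) → Ordinal.{u} := fun p => Order.succ (Ordinal.ToType.toOrd (J p.1 p.2)).1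
  have hf : ∀ p, f p < Ordinal.omega 1 := fun p =>
    (Cardinal.isSuccLimit_omega 1).succ_lt (Ordinal.ToType.toOrd (J p.1 p.2)).2
  refine ⟨Ordinal.ToType.mk ⟨⨆ p, f p, Ordinal.iSup_lt_omega_one hf⟩, fun k l => ?_⟩
  rw [← Ordinal.ToType.mk.symm.lt_iff_lt, OrderIso.symm_apply_apply, ← Subtype.coe_lt_coe]
  exact (Order.lt_succ _).trans_le (Ordinal.le_iSup f ⟨k, l⟩)

section Pair
variable {L' : FirstOrder.Language.{u, u}} {N : Type u} [L.Structure N] [L'.Structure N]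
  (j : N ↪ₑ[L] C)

theorem exists_rep_of_rat_range {x : S} (hx : Rat L (Set.range j) x) :
    ∃ v : DSort.idx L C S → N, DSort.rep L (j ∘ v) = x := by
  obtain ⟨v, hv, rfl⟩ := hx
  choose w hw using hv
  exact ⟨w, congrArg _ (funext hw)⟩

theorem rat_range (v : DSort.idx L C S → N) :
    Rat L (Set.range j) (DSort.rep L (j ∘ v) : S) := ⟨_, fun i => ⟨v i, rfl⟩, rfl⟩

/-- A predicate definable in an elementary extension restricts to one definable in an expansion. -/
theorem IsDfn.pull (φ : L →ᴸ L') [φ.IsExpansionOn N] {Y : S → Prop} (hY : Dfn Y) :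
    IsDfn L' N fun v : DSort.idx L C S → N => Y (DSort.rep L (j ∘ v)) := by
  obtain ⟨ψ, hψ⟩ := Set.empty_definable_iff.1 hY
  refine Set.empty_definable_iff.2 ⟨(φ.onFormula ψ).relabel fun i => (i, ()), ?_⟩
  ext v
  have h1 : Y (DSort.rep L (j ∘ DSort.rep L' v)) ↔ ψ.Realize (j ∘ (DSort.rep L' v : _ → N)) :=
    Set.ext_iff.1 hψ _
  have h2 : ψ.Realize (j ∘ (DSort.rep L' v : _ → N)) ↔ ψ.Realize (DSort.rep L' v : _ → N) :=
    j.map_formula ψ _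
  simp only [Set.mem_setOf_eq, h1, h2, Formula.realize_relabel, LHom.realize_onFormula]
  rfl

theorem exists_of_exists_range {Y : S × E → Prop} (hY : Dfn Y) (w : DSort.idx L C E → N)
    (h : ∃ s, Y (s, DSort.rep L (j ∘ w))) :
    ∃ v : DSort.idx L C S → N, Y (DSort.rep L (j ∘ v), DSort.rep L (j ∘ w)) := by
  obtain ⟨ψ, hψ⟩ := Set.empty_definable_iff.1 hY
  have hψ' : ∀ v : _ → C, Y (DSort.rep L v) ↔ ψ.Realize v := fun v => Set.ext_iff.1 hψ v
  obtain ⟨s, hs⟩ := h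
  obtain ⟨v, rfl⟩ := DSort.rep_surjective (L := L) (C := C) s
  have h1 : ((ψ.relabel Sum.swap).iExs (DSort.idx L C S)).Realize (j ∘ w) := by
    rw [Formula.realize_iExs]
    refine ⟨v, ?_⟩
    rw [Formula.realize_relabel, show Sum.elim (j ∘ w) v ∘ Sum.swap = Sum.elim v (j ∘ w) from
      funext (by rintro (i | i) <;> rfl)]
    exact (hψ' (Sum.elim v (j ∘ w))).1 hs
  rw [j.map_formula, Formula.realize_iExs] at h1
  obtain ⟨v', h2⟩ := h1
  rw [Formula.realize_relabel, ← j.map_formula] at h2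
  refine ⟨v', (hψ' (Sum.elim (j ∘ v') (j ∘ w))).2 ?_⟩
  exact (show j ∘ (Sum.elim w v' ∘ Sum.swap) = Sum.elim (j ∘ v') (j ∘ w) from
      funext (by rintro (i | i) <;> rfl)) ▸ h2

theorem Filtration.exists_simultaneous {I : Type u} {lev' : ℕ → Set N} (hN : Filtration L' I lev')
    (m : ℕ) {K : Type*} (V W : K → Type) [∀ k, Finite (V k)] [∀ k, Finite (W k)]
    (s : ∀ k, V k → I) (w : ∀ k, W k → N) (hw : ∀ k i, w k i ∈ lev' m)
    (χ : ∀ k, (V k → N) × (W k → N) → Prop) (hχ : ∀ k, IsDfn L' N (χ k))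
    (h : ∀ t : Finset K, ∃ v : I → N, ∀ k ∈ t, χ k (v ∘ s k, w k)) :
    ∃ v : I → N, ∀ k, χ k (v ∘ s k, w k) := by
  classical
  choose ψ hψ using fun k => Set.empty_definable_iff.1 (hχ k)
  let g : ∀ k, DSort.idx L' N ((V k → N) × (W k → N)) → lev' m ⊕ I := fun k =>
    Sum.elim (fun i => Sum.inr (s k i.1)) fun i => Sum.inl ⟨w k i.1, hw k i.1⟩
  have key : ∀ k (v : I → N), ((ψ k).relabel (g k)).Realize (Sum.elim Subtype.val v) ↔
      χ k (v ∘ s k, w k) := by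
    intro k v
    rw [Formula.realize_relabel]
    exact (Set.ext_iff.1 (hψ k) _).symm
  obtain ⟨v, -, hv⟩ := hN.sat m (Set.range fun k => (ψ k).relabel (g k)) (by
    intro F hF
    choose k hk using fun θ : F => hF θ.2
    obtain ⟨v, hv⟩ := h (F.attach.image k)
    refine ⟨v, fun θ hθ => ?_⟩
    have h1 := (key _ v).2 (hv _ (Finset.mem_image_of_mem k (Finset.mem_attach F ⟨θ, hθ⟩)))
    have h2 := hk ⟨θ, hθ⟩
    simp only at h2
    rwa [h2] at h1)
  exact ⟨v, fun k => (key k v).1 (hv _ ⟨k, rfl⟩)⟩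

end Pair
end Benign

namespace Benign

variable {L : FirstOrder.Language.{u, u}} {C : Type u} [L.Structure C] {lev : ℕ → Set C}
variable {S T R E B B' : Type u} [DSort L C S] [DSort L C T] [DSort L C R] [DSort L C E]
  [DSort L C B] [DSort L C B']
local notation "Dfn" => IsDfn L C
local notation "Crd" => Coord L C
local notation "Tp" => TpEq L C
local notation "FER" => IsFER L C
local notation "Stp" => StpEq L C
local notation "DS" => DefSch L C
local notation "Ind" => Indep L C
local notation "rk" => frank L C

section Pair
variable {L' : FirstOrder.Language.{u, u}} {N : Type u} [L.Structure N] [L'.Structure N]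
  {I : Type u} {lev' : ℕ → Set N}

theorem exists_bound_of_finite (hN : Filtration L' I lev') (hc : ∀ x, ∃ n, x ∈ lev' n)
    {V : Type} [Finite V] (v : V → N) :
    ∃ n, ∀ i, v i ∈ lev' n := by
  choose n hn using fun i => hc (v i)
  have := Fintype.ofFinite V
  exact ⟨Finset.univ.sup n, fun i => hN.mono (Finset.le_sup (Finset.mem_univ i)) (hn i)⟩

theorem exists_of_exists_level (φ : L →ᴸ L') [φ.IsExpansionOn N] (j : N ↪ₑ[L] C)
    (hN : Filtration L' I lev') {m : ℕ} {Y : S × E → Prop} (hY : Dfn Y) (w : DSort.idx L C E → N)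
    (hw : ∀ i, w i ∈ lev' m) (h : ∃ s, Y (s, DSort.rep L (j ∘ w))) :
    ∃ v : DSort.idx L C S → N, (∀ i, v i ∈ lev' m) ∧
      Y (DSort.rep L (j ∘ v), DSort.rep L (j ∘ w)) := by
  obtain ⟨v, hv⟩ := exists_of_exists_range j hY w h
  obtain ⟨θ, hθ⟩ := Set.empty_definable_iff.1 (hY.pull j φ)
  have hθ' : ∀ v : _ → N, Y (DSort.rep L (j ∘ v)) ↔ θ.Realize fun i => v i.1 :=
    fun v => Set.ext_iff.1 hθ (fun i => v i.1)
  have key : ∀ v : DSort.idx L C S → N, Y (DSort.rep L (j ∘ v), DSort.rep L (j ∘ w)) ↔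
      (θ.relabel fun i : (DSort.idx L C S ⊕ DSort.idx L C E) × Unit => i.1.swap).Realize (Sum.elim w v) := by
    intro v
    rw [Formula.realize_relabel, show (Sum.elim w v ∘
      fun i : (DSort.idx L C S ⊕ DSort.idx L C E) × Unit => i.1.swap) =
      fun i => (Sum.elim v w : DSort.idx L C (S × E) → N) i.1 from
        funext (by rintro ⟨i | i, -⟩ <;> rfl)]
    exact hθ' (Sum.elim v w)
  obtain ⟨v', h1, h2⟩ := hN.tv m _ _ _ w hw ⟨v, (key v).1 hv⟩
  exact ⟨v', h1, (key v').2 h2⟩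

theorem exists_stpEq_range (φ : L →ᴸ L') [φ.IsExpansionOn N] (j : N ↪ₑ[L] C)
    (hN : Filtration L' I lev') [Nonempty N] [Infinite I] {m : ℕ} (w : DSort.idx L C E → N)
    (hw : ∀ i, w i ∈ lev' m) (x : S) :
    ∃ v : DSort.idx L C S → N, Stp (DSort.rep L (j ∘ w) : E) x (DSort.rep L (j ∘ v)) := by
  classical
  obtain ⟨κ⟩ : Nonempty (DSort.idx L C S ↪ I) := by
    have := Fintype.ofFinite (DSort.idx L C S)
    exact ⟨(Fintype.equivFin _).toEmbedding.trans
      (Fin.valEmbedding.trans (Infinite.natEmbedding I))⟩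
  set e : E := DSort.rep L (j ∘ w) with he
  let K := {q : ((S × S) × E → Prop) × (DSort.idx L C S → N) // FER q.1 e ∧
    (∀ i, q.2 i ∈ lev' m) ∧ q.1 ((DSort.rep L (j ∘ q.2), x), e)}
  obtain ⟨v, hv⟩ := hN.exists_simultaneous m (K := K) (fun _ => DSort.idx L C S)
    (fun _ => DSort.idx L C S ⊕ DSort.idx L C E) (fun _ => κ) (fun k => Sum.elim k.1.2 w)
    (fun k => by rintro (i | i); exacts [k.2.2.1 i, hw i])
    (fun k p => k.1.1 ((DSort.rep L (j ∘ p.2 ∘ Sum.inl), DSort.rep L (j ∘ p.1)),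
      DSort.rep L (j ∘ p.2 ∘ Sum.inr)))
    (fun k => (k.2.1.dfn.pull j φ).comp (f := fun p : (DSort.idx L C S → N) ×
      (DSort.idx L C S ⊕ DSort.idx L C E → N) => (Sum.elim (Sum.elim (p.2 ∘ Sum.inl) p.1)
        (p.2 ∘ Sum.inr) : DSort.idx L C ((S × S) × E) → N))
      (Coord.pi fun i => match i with
        | .inl (.inl i) => (Coord.apply (L := L') (C := N) (S := N)
            (Sum.inl i : DSort.idx L C S ⊕ DSort.idx L C E)).comp Coord.snd
        | .inl (.inr i) => (Coord.apply (L := L') (C := N) (S := N) i).comp Coord.fst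
        | .inr i => (Coord.apply (L := L') (C := N) (S := N)
            (Sum.inr i : DSort.idx L C S ⊕ DSort.idx L C E)).comp Coord.snd))
    (by
      intro t
      let r : Fin (Fintype.card t) → K := fun i => ((Fintype.equivFin t).symm i).1
      obtain ⟨v, hv⟩ := exists_of_exists_range j (S := S) (E := (Fin (Fintype.card t) → S) × E)
        (Y := fun p => ∀ i, (r i).1.1 ((p.2.1 i, p.1), p.2.2))
        (.forall_finite fun i => (r i).2.1.dfn.comp
          (f := fun p : S × (Fin (Fintype.card t) → S) × E => ((p.2.1 i, p.1), p.2.2))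
            ((((Coord.apply i).comp (Coord.fst.comp Coord.snd)).mk Coord.fst).mk
              (Coord.snd.comp Coord.snd)))
        (Sum.elim (fun i : Fin (Fintype.card t) × DSort.idx L C S => (r i.1).1.2 i.2) w) ⟨x, fun i => (r i).2.2.2⟩
      refine ⟨Function.extend κ v fun _ => Classical.arbitrary N, fun k hk => ?_⟩
      rw [Function.extend_comp κ.injective]
      have h1 : (r (Fintype.equivFin t ⟨k, hk⟩)).1.1
          ((DSort.rep L (j ∘ (r (Fintype.equivFin t ⟨k, hk⟩)).1.2), DSort.rep L (j ∘ v)), e) := hv _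
      have h2 : r (Fintype.equivFin t ⟨k, hk⟩) = k := by simp only [r, Equiv.symm_apply_apply]
      rwa [h2] at h1)
  refine ⟨v ∘ κ, fun F hF => ?_⟩
  obtain ⟨ι, _, r, hr⟩ := hF.fin.exists_reps
  obtain ⟨r', h1, h2⟩ := exists_of_exists_level φ j hN (S := ι → S) (E := E)
    (Y := fun p => ∀ x, ∃ i, F ((x, p.1 i), p.2))
    (.all (.exists_finite fun i => hF.dfn.comp
      (f := fun q : ((ι → S) × E) × S => ((q.2, q.1.1 i), q.1.2))
        ((Coord.snd.mk ((Coord.apply i).comp (Coord.fst.comp Coord.fst))).mk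
          (Coord.snd.comp Coord.fst)))) w hw ⟨r, hr⟩
  obtain ⟨i, hi⟩ := h2 x
  have h3 : F ((DSort.rep L (j ∘ fun q => r' (i, q)), x), e) := hF.equiv.symm hi
  exact hF.equiv.trans (hF.equiv.symm h3) (hv ⟨(F, fun q => r' (i, q)), hF, fun q => h1 _, h3⟩)

end Pair
end Benign

namespace Benign

variable {L : FirstOrder.Language.{u, u}} {C : Type u} [L.Structure C] {lev : ℕ → Set C}
variable {S T R E B B' : Type u} [DSort L C S] [DSort L C T] [DSort L C R] [DSort L C E]
  [DSort L C B] [DSort L C B']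
local notation "Dfn" => IsDfn L C
local notation "Crd" => Coord L C
local notation "Tp" => TpEq L C
local notation "FER" => IsFER L C
local notation "Stp" => StpEq L C
local notation "DS" => DefSch L C
local notation "Ind" => Indep L C
local notation "rk" => frank L C

section Pair
variable {L' : FirstOrder.Language.{u, u}} {N : Type u} [L.Structure N] [L'.Structure N]
    {lev' : ℕ → Set N}

theorem starSat_range (φ : L →ᴸ L') [φ.IsExpansionOn N] (j : N ↪ₑ[L] C)
    {Ω : Type u} [Nonempty N] (hN : Filtration L' (Ω × ℕ) lev')
    (hc : ∀ x, ∃ n, x ∈ lev' n)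
    {AN : Set N} (hA : IsDfn L' N fun x => x ∈ AN) : StarSat L (j '' AN) (Set.range j) Ω := by
  classical
  intro Q P _ _ p hp K E _ n J Y hY h
  obtain ⟨w, rfl⟩ := exists_rep_of_rat_range j hp
  obtain ⟨m, hm⟩ := exists_bound_of_finite hN hc w
  obtain ⟨κ⟩ : Nonempty (DSort.idx L C Q ↪ ℕ) := by
    have := Fintype.ofFinite (DSort.idx L C Q)
    exact ⟨(Fintype.equivFin _).toEmbedding.trans Fin.valEmbedding⟩
  obtain ⟨v, hv⟩ := hN.exists_simultaneous m (K := K) (fun k => Fin (n k) × DSort.idx L C Q)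
    (fun _ => DSort.idx L C P) (fun k i => (J k i.1, κ i.2)) (fun _ => w) (fun _ => hm)
    (fun k p => ∀ z : DSort.idx L C (E k) → N, (∀ i, z i ∈ AN) →
      Y k (fun l => DSort.rep L (j ∘ fun q => p.1 (l, q)), DSort.rep L (j ∘ z),
        DSort.rep L (j ∘ p.2)))
    (fun k => .all (.imp (.forall_finite fun i => hA.comp ((Coord.apply i).comp Coord.snd))
      (((hY k).pull j φ).comp (f := fun p : ((Fin (n k) × DSort.idx L C Q → N) ×
        (DSort.idx L C P → N)) × (DSort.idx L C (E k) → N) => (Sum.elim p.1.1 (Sum.elim p.2 p.1.2) :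
          DSort.idx L C ((Fin (n k) → Q) × E k × P) → N))
      (Coord.pi fun i => match i with
        | .inl i => (Coord.apply (L := L') (C := N) (S := N) i).comp (Coord.fst.comp Coord.fst)
        | .inr (.inl i) => (Coord.apply (L := L') (C := N) (S := N) i).comp Coord.snd
        | .inr (.inr i) =>
          (Coord.apply (L := L') (C := N) (S := N) i).comp (Coord.snd.comp Coord.fst)))))
    (by
      intro t
      obtain ⟨f, hf, hft⟩ := h t
      choose g hg using fun i => exists_rep_of_rat_range j (hf i)
      refine ⟨fun q => Function.extend κ (g q.1) (fun _ => Classical.arbitrary N) q.2,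
        fun k hk z hz => ?_⟩
      have := hft k hk (DSort.rep L (j ∘ z)) ⟨_, fun i => ⟨z i, hz i, rfl⟩, rfl⟩
      simpa only [Function.comp_def, κ.injective.extend_apply, ← hg] using this)
  refine ⟨fun i => DSort.rep L (j ∘ fun q => v (i, κ q)), fun i => rat_range j _, fun k a ha => ?_⟩
  obtain ⟨z, hz, rfl⟩ := ha
  choose z' hz' hzz using hz
  obtain rfl : j ∘ z' = z := funext hzz
  exact hv k z' hz'

theorem stpA_range (φ : L →ᴸ L') [φ.IsExpansionOn N] (j : N ↪ₑ[L] C)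
    [Nonempty N] {n : ℕ} {I : Type u} (hN : Filtration L' I lev')
    {M : Type u} [L.Structure M] (i : M ↪ₑ[L] N) (hi : lev' 0 = Set.range i)
    {AN : Set N} (hA : IsDfn L' N fun x => x ∈ AN) {A : Set M} (hAA : ∀ a, i a ∈ AN ↔ a ∈ A)
    {x y : Fin n → M} (h : SameStrongTypeOver (L := L) A x y) :
    StpA L (j '' AN) (j ∘ i ∘ x) (j ∘ i ∘ y) := by
  intro E _ a ha F hF
  obtain ⟨z, hz, rfl⟩ := ha
  choose z' hz' hzz using hz
  obtain rfl : j ∘ z' = z := funext hzz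
  by_contra hxy
  obtain ⟨θ, hθ⟩ := Set.empty_definable_iff.1 hF.dfn
  let ι := DSort.idx L C E
  let Y : ((Fin n → N) × (Fin n → N)) × (ι → N) → Prop := fun p =>
    F ((j ∘ p.1.1, j ∘ p.1.2), DSort.rep L (j ∘ p.2))
  have hY : IsDfn L' N Y := (hF.dfn.pull j φ).comp
    (f := fun p : ((Fin n → N) × (Fin n → N)) × (ι → N) =>
      (Sum.elim (Sum.elim (fun q => p.1.1 q.1) fun q => p.1.2 q.1) p.2 :
        DSort.idx L C (((Fin n → C) × (Fin n → C)) × E) → N))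
    (Coord.pi fun i => match i with
      | .inl (.inl i) =>
        (Coord.apply (L := L') (C := N) (S := N) i.1).comp (Coord.fst.comp Coord.fst)
      | .inl (.inr i) =>
        (Coord.apply (L := L') (C := N) (S := N) i.1).comp (Coord.snd.comp Coord.fst)
      | .inr i => (Coord.apply (L := L') (C := N) (S := N) i).comp Coord.snd)
  let χ : L.Formula ((Fin n ⊕ Fin n) ⊕ ι) :=
    θ.relabel fun i : (Fin n × Unit ⊕ Fin n × Unit) ⊕ ι => match i with
      | .inl (.inl i) => .inl (.inl i.1)
      | .inl (.inr i) => .inl (.inr i.1)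
      | .inr i => .inr i
  have hχ : ∀ u v z, χ.Realize (Sum.elim (Sum.elim u v) z) ↔ Y ((u, v), z) := by
    intro u v z
    rw [Formula.realize_relabel, ← j.map_formula]
    refine Iff.trans (iff_of_eq (congrArg _ ?_)) (Set.ext_iff.1 hθ (Sum.elim (Sum.elim
      (fun q => j (u q.1)) fun q => j (v q.1)) (j ∘ z) :
        (Fin n × Unit ⊕ Fin n × Unit) ⊕ ι → C)).symm
    funext q
    rcases q with (q | q) | q <;> rfl
  have hχM : ∀ u v z, χ.Realize (Sum.elim (Sum.elim u v) z) ↔ Y ((i ∘ u, i ∘ v), i ∘ z) := by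
    intro u v z
    rw [← hχ, ← i.map_formula, Sum.comp_elim, Sum.comp_elim]
  obtain ⟨κ, _, ψ, hψ⟩ := hF.fin
  have := Fintype.ofFinite κ
  obtain ⟨z, ⟨v, hv, rfl⟩, ⟨hzA, h1, h2, h3, h4⟩, h5⟩ := hN.exists_rat_of_exists 0
    (S := ι → N) (E := (Fin n → N) × (Fin n → N))
    (Y := fun p => ((∀ q, p.1 q ∈ AN) ∧ (∀ u, Y ((u, u), p.1)) ∧
      (∀ u v, Y ((u, v), p.1) → Y ((v, u), p.1)) ∧
      (∀ u v w, Y ((u, v), p.1) → Y ((v, w), p.1) → Y ((u, w), p.1)) ∧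
      ∀ g : Fin (Fintype.card κ + 1) → Fin n → N, ∃ a b, a ≠ b ∧ Y ((g a, g b), p.1)) ∧
      ¬Y (p.2, p.1))
    ((IsDfn.and (.forall_finite fun i => hA.comp (by fun_prop)) <| .and
      (.all <| hY.comp (by fun_prop)) <| .and
      (.all <| .all <| .imp (hY.comp (by fun_prop)) (hY.comp (by fun_prop))) <| .and
      (.all <| .all <| .all <| .imp (hY.comp (by fun_prop)) <|
        .imp (hY.comp (by fun_prop)) (hY.comp (by fun_prop))) <|
      .all <| .exists_finite fun a => .exists_finite fun b => .and (.const _) <|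
        hY.comp (by fun_prop)).and (.not <| hY.comp (by fun_prop)))
    (e := (i ∘ x, i ∘ y))
    ⟨Sum.elim (fun q => i (x q.1)) fun q => i (y q.1), by
      rw [hi]; rintro (q | q) <;> exact ⟨_, rfl⟩, rfl⟩
    ⟨z', ⟨hz', fun u => hF.equiv.refl _, fun u v => hF.equiv.symm, fun u v w => hF.equiv.trans,
      fun g => by
        obtain ⟨a, b, hab, h⟩ := Fintype.exists_ne_map_eq_of_card_lt (fun a => ψ (j ∘ g a))
          (by simp)
        exact ⟨a, b, hab, hψ _ _ h⟩⟩, hxy⟩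
  rw [hi] at hv
  choose w hw using hv
  have hz : DSort.rep L' v = i ∘ fun q => w (q, ()) := funext fun q => (hw (q, ())).symm
  rw [hz] at hzA h1 h2 h3 h4 h5
  have hw' : ∀ q, w (q, ()) ∈ A := fun q => (hAA _).1 (hzA q)
  have key : ∀ u v : Fin n → M, (χ.relabel (Sum.map _root_.id fun q =>
      (⟨w (q, ()), hw' q⟩ : A))).Realize (Sum.elim (Sum.elim u v) Subtype.val) ↔
      Y ((i ∘ u, i ∘ v), i ∘ fun q => w (q, ())) := by
    intro u v
    rw [Formula.realize_relabel, ← hχM, Sum.elim_comp_map]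
    rfl
  refine h5 ((key x y).1 (h.2 _ ?_ ⟨Fintype.card κ, fun g => ?_⟩))
  · simp only [key]
    exact ⟨fun u => h1 _, fun h => h2 _ _ h, fun h h' => h3 _ _ _ h h'⟩
  · simp only [key]
    exact h4 fun a => i ∘ g a

end Pair
end Benign

namespace Benign

variable {L : FirstOrder.Language.{u, u}} {C : Type u} [L.Structure C] {lev : ℕ → Set C}
variable {S T R E B B' : Type u} [DSort L C S] [DSort L C T] [DSort L C R] [DSort L C E]
  [DSort L C B] [DSort L C B']
local notation "Dfn" => IsDfn L C
local notation "Crd" => Coord L C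
local notation "Tp" => TpEq L C
local notation "FER" => IsFER L C
local notation "Stp" => StpEq L C
local notation "DS" => DefSch L C
local notation "Ind" => Indep L C
local notation "rk" => frank L C

theorem exists_formula_finite_params {α B : Type*} (ψ : L.Formula (α ⊕ B)) :
    ∃ (m : ℕ) (b : Fin m → B) (ψ' : L.Formula (α ⊕ Fin m)),
      ∀ {N : Type u} [L.Structure N] (x : α → N) (v : B → N),
        ψ'.Realize (Sum.elim x (v ∘ b)) ↔ ψ.Realize (Sum.elim x v) := by
  classical
  let s := ψ.freeVarFinset.toRight
  let e := Fintype.equivFin s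
  refine ⟨_, fun i => (e.symm i).1, BoundedFormula.restrictFreeVar ψ fun a => match a with
    | ⟨.inl a, _⟩ => .inl a
    | ⟨.inr b, h⟩ => .inr (e ⟨b, Finset.mem_toRight.2 h⟩), fun x v => ?_⟩
  refine BoundedFormula.realize_restrictFreeVar _ ?_
  rintro ⟨a | b, h⟩
  · rfl
  · simp

theorem isDfn_realize {ι : Type} [Finite ι] (ψ : L.Formula ι) :
    Dfn fun v : ι → C => ψ.Realize v := by
  refine Set.empty_definable_iff.2 ⟨ψ.relabel fun i => (i, ()), ?_⟩
  ext v
  exact (Formula.realize_relabel (φ := ψ) (g := fun i => (i, ())) (v := v)).symm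

theorem exists_term_of_sum_unaryLang {N : Type u} [L.Structure N] [(L.sum unaryLang).Structure N]
    [(LHom.sumInl : L →ᴸ L.sum unaryLang).IsExpansionOn N] {α : Type*}
    (t : (L.sum unaryLang).Term α) :
    ∃ t' : L.Term α, ∀ v : α → N, t'.realize v = t.realize v := by
  induction t with
  | var a => exact ⟨.var a, fun v => rfl⟩
  | @func n f ts ih =>
    choose ts' hts using ih
    rcases f with f | f
    · refine ⟨.func f ts', fun v => ?_⟩
      simp only [Term.realize, hts]
      exact (LHom.map_onFunction (LHom.sumInl : L →ᴸ L.sum unaryLang) f _).symm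
    · exact f.elim

section Game
variable {N : Type u} [L.Structure N] (j : N ↪ₑ[L] C) {AN : Set N} {n : ℕ}

theorem StpA.realize_iff {k : ℕ} {x y : Fin n → N} {xs ys : Fin k → N}
    (h : StpA L (j '' AN) (j ∘ x, j ∘ xs) (j ∘ y, j ∘ ys))
    (ψ : L.Formula ((Fin n ⊕ AN) ⊕ Fin k)) :
    ψ.Realize (Sum.elim (Sum.elim x Subtype.val) xs) ↔
      ψ.Realize (Sum.elim (Sum.elim y Subtype.val) ys) := by
  obtain ⟨m, b, ψ', hψ⟩ := exists_formula_finite_params (ψ.relabel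
    (Sum.elim (Sum.elim (fun i => Sum.inl (Sum.inl i)) Sum.inr) fun i => Sum.inl (Sum.inr i)) :
      L.Formula ((Fin n ⊕ Fin k) ⊕ AN))
  have key : ∀ (x : Fin n → N) (xs : Fin k → N),
      ψ.Realize (Sum.elim (Sum.elim x Subtype.val) xs) ↔
      ψ'.Realize (Sum.elim (Sum.elim (j ∘ x) (j ∘ xs)) (j ∘ Subtype.val ∘ b)) := by
    intro x xs
    rw [← Sum.comp_elim, ← Sum.comp_elim, j.map_formula, hψ, Formula.realize_relabel]
    refine iff_of_eq (congrArg _ (funext ?_))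
    rintro ((i | i) | i) <;> rfl
  rw [key, key]
  exact (h.tp (E := Fin m → C) (a := j ∘ Subtype.val ∘ b)
    (Rat.pi fun i => ⟨fun _ => j (b i), fun _ => ⟨_, (b i).2, rfl⟩, rfl⟩)).iff
    ((isDfn_realize ψ').comp
      (f := fun p : ((Fin n → C) × (Fin k → C)) × (Fin m → C) =>
        (Sum.elim (Sum.elim p.1.1 p.1.2) p.2 : (Fin n ⊕ Fin k) ⊕ Fin m → C))
      (Coord.pi fun i => match i with
        | .inl (.inl i) => (Coord.apply i).comp (Coord.fst.comp Coord.fst)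
        | .inl (.inr i) => (Coord.apply i).comp (Coord.snd.comp Coord.fst)
        | .inr i => (Coord.apply i).comp Coord.snd))

variable [(L.sum unaryLang).Structure N]
    [(LHom.sumInl : L →ᴸ L.sum unaryLang).IsExpansionOn N]

theorem BPair.realize_lstar_iff (hB : BPair L lev (j '' AN) (Set.range j))
    {Ω : Type u} [LinearOrder Ω] (hΩ : StarSat L (j '' AN) (Set.range j) Ω)
    (hb : ∀ (n : ℕ → ℕ) (J : ∀ k, Fin (n k) → Ω), ∃ i, ∀ k l, J k l < i)
    (hP : ∀ {k : ℕ} (r : unaryLang.Relations k) (v : Fin k → N),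
      @Structure.RelMap (L.sum unaryLang) N _ k (Sum.inr r) v ↔
        v (Fin.cast r.down.symm 0) ∈ AN) {k : ℕ}
    (ψ : (L.sum unaryLang).BoundedFormula (Fin n ⊕ AN) k) {x y : Fin n → N} {xs ys : Fin k → N}
    (h : StpA L (j '' AN) (j ∘ x, j ∘ xs) (j ∘ y, j ∘ ys)) :
    ψ.Realize (Sum.elim x Subtype.val) xs ↔ ψ.Realize (Sum.elim y Subtype.val) ys := by
  induction ψ generalizing x y with
  | falsum => rfl
  | equal t₁ t₂ =>
    obtain ⟨t₁', h₁⟩ := exists_term_of_sum_unaryLang (N := N) t₁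
    obtain ⟨t₂', h₂⟩ := exists_term_of_sum_unaryLang (N := N) t₂
    have := StpA.realize_iff j h (t₁'.equal t₂')
    simp only [Formula.realize_equal, h₁, h₂] at this
    exact this
  | @rel k l r ts =>
    choose ts' hts using fun i => exists_term_of_sum_unaryLang (N := N) (ts i)
    rcases r with r | r
    · have := StpA.realize_iff j h (r.formula ts')
      simp only [Formula.realize_rel, hts] at this
      have e : ∀ v : Fin l → N, @Structure.RelMap (L.sum unaryLang) N _ l (Sum.inl r) v ↔
          Structure.RelMap r v := fun v =>
        iff_of_eq (LHom.map_onRelation (LHom.sumInl : L →ᴸ L.sum unaryLang) r v)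
      exact (e _).trans (this.trans (e _).symm)
    · refine (hP r _).trans (Iff.trans ?_ (hP r _).symm)
      have key : ∀ {x y : Fin n → N} {xs ys : Fin k → N},
          StpA L (j '' AN) (j ∘ x, j ∘ xs) (j ∘ y, j ∘ ys) → ∀ i,
          (ts i).realize (Sum.elim (Sum.elim x Subtype.val) xs) ∈ AN →
          (ts i).realize (Sum.elim (Sum.elim y Subtype.val) ys) ∈ AN := by
        intro x y xs ys h i hi
        have := (StpA.realize_iff j h ((ts' i).equal
          (Term.var (Sum.inl (Sum.inr ⟨_, hi⟩))))).1 (by simp [Formula.realize_equal, hts])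
        simp only [Formula.realize_equal, hts, Term.realize_var, Sum.elim_inl, Sum.elim_inr] at this
        rwa [this]
      exact ⟨key h _, key h.symm _⟩
  | imp _ _ ih₁ ih₂ => exact imp_congr (ih₁ h) (ih₂ h)
  | @all k ψ ih =>
    have hrat : ∀ {m : ℕ} (v : Fin m → N), Rat L (Set.range j) (j ∘ v) := fun v =>
      Rat.pi fun i => ⟨fun _ => j (v i), fun _ => ⟨_, rfl⟩, rfl⟩
    have key : ∀ {x y : Fin n → N} {xs ys : Fin k → N},
        StpA L (j '' AN) (j ∘ x, j ∘ xs) (j ∘ y, j ∘ ys) →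
        (∀ c, ψ.Realize (Sum.elim y Subtype.val) (Fin.snoc ys c)) →
        ∀ c, ψ.Realize (Sum.elim x Subtype.val) (Fin.snoc xs c) := by
      intro x y xs ys h hall c
      obtain ⟨d, ⟨d', hd, rfl⟩, hcd⟩ := hB.exists_copy hΩ hb ((hrat x).prod (hrat xs))
        ((hrat y).prod (hrat ys)) h (c := j c) ⟨fun _ => j c, fun _ => ⟨_, rfl⟩, rfl⟩
      obtain ⟨d, hd⟩ := hd ()
      refine (ih ?_).2 (hall d)
      have e : ∀ (zs : Fin k → N) c, j ∘ (Fin.snoc zs c : Fin (k + 1) → N) =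
          Fin.snoc (j ∘ zs) (j c) := fun zs c => Fin.comp_snoc j zs c
      rw [e, e, hd]
      exact hcd.map (f := fun p : ((Fin n → C) × (Fin k → C)) × C =>
          (p.1.1, (Fin.snoc p.1.2 p.2 : Fin (k + 1) → C)))
        ((Coord.fst.comp Coord.fst).mk (Coord.pi fun i => by
          refine Fin.lastCases ?_ (fun i => ?_) i
          · simpa using Coord.snd
          · simpa using (Coord.apply i).comp (Coord.snd.comp Coord.fst)))
    exact ⟨key h.symm, key h⟩

end Game
end Benign

namespace Benign

variable {L : FirstOrder.Language.{u, u}} {C : Type u} [L.Structure C] {lev : ℕ → Set C}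

theorem Filtration.monster [Nonempty C] {T : L.Theory} (hss : Superstable L T) (hT : C ⊨ T)
    {I : Type u} [Infinite I] (hC : Filtration L I lev) (hc : ∀ x, ∃ n, x ∈ lev n) :
    Monster L lev where
  mono := hC.mono
  cover := hc
  sat n ℱ _ := (hC.exists_realization n ℱ).imp fun _ h => h.2
  tv n _ hY _ he h := hC.exists_rat_of_exists n hY he h
  no_order hY x y h := _root_.Benign.no_order hss hT hY x y h
  no_tree hψ h := _root_.Benign.no_tree hss hT hψ h

end Benign

namespace Benign

/-- If `M` is a model of a superstable complete first-order theory `T`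
and `A ⊆ M` is arbitrary, then `A` is weakly benign in `M`: tuples realizing the same
strong type over `A` realize the same type over `A` in `L* = L ∪ {P}` with `P` naming
`A`. -/
theorem superstable_weakly_benign {L : FirstOrder.Language.{u, u}} {M : Type u}
    [L.Structure M] (T : L.Theory) (hcomplete : T.IsComplete) (hmodel : M ⊨ T)
    (hss : Superstable L T) (A : Set M) :
    IsWeaklyBenign (L := L) A := by
  intro n x y h
  rcases isEmpty_or_nonempty M with hM | hM
  · rw [Subsingleton.elim x y]
    exact fun _ => Iff.rfl
  letI : unaryLang.Structure M := unaryStructure A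
  intro ψ
  obtain ⟨Ω, _, hb⟩ := exists_order_unbounded.{u}
  have : Nonempty Ω := ⟨(hb (fun _ => 0) fun _ i => i.elim0).choose⟩
  obtain ⟨N, _, i, lev', hN, hi, hcN⟩ := exists_filtration (L := L.sum unaryLang) (Ω × ℕ) M
  letI : L.Structure N := (LHom.sumInl : L →ᴸ L.sum unaryLang).reduct N
  have : Nonempty N := ⟨i hM.some⟩
  let iL : M ↪ₑ[L] N :=
    { toFun := i
      map_formula' := fun n θ v => by
        have := i.map_formula ((LHom.sumInl : L →ᴸ L.sum unaryLang).onFormula θ) v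
        rwa [LHom.realize_onFormula, LHom.realize_onFormula] at this }
  obtain ⟨C, _, j, lev, hC, hj, hcC⟩ := exists_filtration (L := L) (Ω × ℕ) N
  have : Nonempty C := ⟨j (i hM.some)⟩
  have hT : C ⊨ T := (j.theory_model_iff T).1 ((iL.theory_model_iff T).1 hmodel)
  let P : (L.sum unaryLang).Relations 1 := Sum.inr ⟨rfl⟩
  let AN : Set N := {a | Structure.RelMap P ![a]}
  have hiA : ∀ a, i a ∈ AN ↔ a ∈ A := by
    intro a
    have h1 : Structure.RelMap P (i ∘ ![a]) ↔ Structure.RelMap P ![a] := i.map_rel P ![a]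
    rw [show (i ∘ ![a] : Fin 1 → N) = ![i a] from funext fun k => by fin_cases k; rfl] at h1
    exact h1
  have hP : ∀ {k : ℕ} (r : unaryLang.Relations k) (v : Fin k → N),
      @Structure.RelMap (L.sum unaryLang) N _ k (Sum.inr r) v ↔
        v (Fin.cast r.down.symm 0) ∈ AN := by
    rintro k ⟨rfl⟩ v
    refine iff_of_eq (congrArg (Structure.RelMap P) (funext fun k => ?_))
    fin_cases k
    rfl
  have hA : IsDfn (L.sum unaryLang) N fun a => a ∈ AN := by
    refine Set.empty_definable_iff.2 ⟨P.formula₁ (Term.var ()), ?_⟩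
    ext v
    simp only [Set.mem_setOf_eq]
    exact (Formula.realize_rel₁ (L := L.sum unaryLang) (M := N) (R := P) (t := Term.var ()) (v := v)).symm
  have hB : BPair L lev (j '' AN) (Set.range j) :=
    { monster := hC.monster hss hT hcC
      sub := Set.image_subset_range _ _
      sub_lev := hj.ge
      ms := by
        intro S E _ _ e he x
        obtain ⟨w, rfl⟩ := exists_rep_of_rat_range j he
        obtain ⟨m, hm⟩ := exists_bound_of_finite hN hcN w
        obtain ⟨v, hv⟩ := exists_stpEq_range (LHom.sumInl : L →ᴸ L.sum unaryLang) j hN w hm x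
        exact ⟨_, rat_range j v, hv⟩ }
  have hs := stpA_range (LHom.sumInl : L →ᴸ L.sum unaryLang) j hN iL hi hA hiA h
  have hΩ : StarSat L (j '' AN) (Set.range j) Ω :=
    starSat_range (LHom.sumInl : L →ᴸ L.sum unaryLang) j hN hcN hA
  have hs' : StpA L (j '' AN) (j ∘ i ∘ x, j ∘ (default : Fin 0 → N))
      (j ∘ i ∘ y, j ∘ (default : Fin 0 → N)) :=
    hs.map (f := fun v : Fin n → C => (v, j ∘ (default : Fin 0 → N)))
      (Coord.id'.mk (Coord.pi fun i => i.elim0))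
  have key := hB.realize_lstar_iff j hΩ hb hP
    (ψ.relabel (Sum.map _root_.id fun a : A => (⟨i a, (hiA a).2 a.2⟩ : AN)) :
      (L.sum unaryLang).Formula (Fin n ⊕ AN)) hs'
  have tr : ∀ x : Fin n → M, ψ.Realize (Sum.elim x Subtype.val) ↔
      (ψ.relabel (Sum.map _root_.id fun a : A => (⟨i a, (hiA a).2 a.2⟩ : AN)) :
        (L.sum unaryLang).Formula (Fin n ⊕ AN)).Realize (Sum.elim (i ∘ x) Subtype.val) := by
    intro x
    rw [Formula.realize_relabel, ← i.map_formula, Sum.comp_elim, Sum.elim_comp_map]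
    rfl
  exact (tr x).trans (key.trans (tr y).symm)

end Benign
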